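/- arXiv:2309.07342 — 2 statements merged into one kernel-verified Lean document; each statement's English description precedes it below -/
import Mathlib

section
/- Existence, uniqueness, and forward estimate for the self-similar wave ODE with asymptotic data at v = 0 (Proposition 4.4 of the paper, single-mode version): for every even integer n ≥ 4 there exists a constant C > 0, depending only on n, such that for every λ ≥ 0 and every pair (φ₀, h) ∈ ℝ² the following hold. (Existence) There exist ψ : [0,∞) → ℝ and O ∈ ℝ such that ψ has asymptotic data (φ₀, O, h) at v = 0 in the mode-λ sense. (Uniqueness) If ψ₁ has asymptotic data (φ₀, O₁, h) and ψ₂ has asymptotic data (φ₀, O₂, h) at v = 0, then ψ₁ = ψ₂ (and O₁ = O₂). (Estimate) For any such ψ, setting 𝔥 := h − O·log√(1+λ²) (the single-mode version of the renormalization 𝔥 = h − (log∇)O), one has: √(1+λ²)·Σ_{a=0}^{n/2} (ψ⁽ᵃ⁾(1))² + (1+λ²)^(−1/2)·(ψ⁽ⁿᐟ²⁺¹⁾(1))² ≤ C·( 𝔥² + (1+λ²)ⁿ·φ₀² ). -/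
open Set Filter

/-- `ψ` solves the mode-`lam` self-similar wave ODE on `(0,∞)`:
`v(v+1)²·ψ'' + (1 − n/2)·(v+1)²·ψ' + n·v·(v+1)·ψ' + λ²·ψ = 0`. -/
def SolvesWaveODE (n : ℕ) (lam : ℝ) (ψ : ℝ → ℝ) : Prop :=
  ∀ v > (0:ℝ),
    v * (v + 1) ^ 2 * iteratedDeriv 2 ψ v
      + (1 - (n : ℝ) / 2) * (v + 1) ^ 2 * deriv ψ v
      + (n : ℝ) * v * (v + 1) * deriv ψ v
      + lam ^ 2 * ψ v = 0

/-- `ψ : [0,∞) → ℝ` has asymptotic data `(φ₀, O, h)` at `v = 0` in the mode-`lam`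
sense: `ψ` is continuous on `[0,∞)`, smooth on `(0,∞)`, solves the mode-`lam`
self-similar wave ODE on `(0,∞)`, its derivatives `ψ⁽ᵃ⁾` extend continuously to
`v = 0` for `0 ≤ a ≤ n/2 − 1`, `ψ(0) = φ₀`, and `ψ⁽ⁿᐟ²⁾(v) = (1/2)·O·log v + h
+ O(v·(1 + (log v)²))`, `v·ψ⁽ⁿᐟ²⁺¹⁾(v) = O/2 + O(v·(1 + (log v)²))` on `(0,1]`. -/
def HasAsymptoticDataODE (n : ℕ) (lam : ℝ) (ψ : ℝ → ℝ) (φ₀ O h : ℝ) : Prop :=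
  ContinuousOn ψ (Ici 0) ∧ ContDiffOn ℝ (⊤ : ℕ∞) ψ (Ioi 0) ∧ SolvesWaveODE n lam ψ ∧
  (∀ a ≤ n / 2 - 1, ∃ L : ℝ,
    Tendsto (iteratedDeriv a ψ) (nhdsWithin 0 (Ioi 0)) (nhds L)) ∧
  ψ 0 = φ₀ ∧
  ∃ K : ℝ, 0 ≤ K ∧ ∀ v ∈ Ioc (0:ℝ) 1,
    |iteratedDeriv (n / 2) ψ v - (1 / 2) * O * Real.log v - h|
        ≤ K * v * (1 + Real.log v ^ 2) ∧
    |v * iteratedDeriv (n / 2 + 1) ψ v - O / 2| ≤ K * v * (1 + Real.log v ^ 2)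

/-- A real sequence whose growth is slower than any exponential `R ^ j` with `R > 1`. -/
def SubExp (a : ℕ → ℝ) : Prop := ∀ R > (1 : ℝ), ∃ C, ∀ j, |a j| ≤ C * R ^ j

/-- The sum of the power series with coefficients `a`. -/
noncomputable def powSum (a : ℕ → ℝ) (y : ℝ) : ℝ := ∑' j, a j * y ^ j

/-- The coefficients of the derivative of a power series. -/
def derivSeq (a : ℕ → ℝ) (j : ℕ) : ℝ := (j + 1) * a (j + 1)

/-- The coefficients of `y` times a power series. -/
def mulVarSeq (a : ℕ → ℝ) : ℕ → ℝ
  | 0 => 0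
  | j + 1 => a j

theorem SubExp.add {a b : ℕ → ℝ} (ha : SubExp a) (hb : SubExp b) :
    SubExp (fun j => a j + b j) := by
  intro R hR
  obtain ⟨C, hC⟩ := ha R hR
  obtain ⟨D, hD⟩ := hb R hR
  refine ⟨C + D, fun j => ?_⟩
  have := abs_add_le (a j) (b j)
  nlinarith [hC j, hD j]

theorem SubExp.const_mul {a : ℕ → ℝ} (c : ℝ) (ha : SubExp a) :
    SubExp (fun j => c * a j) := by
  intro R hR
  obtain ⟨C, hC⟩ := ha R hR
  refine ⟨|c| * C, fun j => ?_⟩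
  rw [abs_mul, mul_assoc]
  exact mul_le_mul_of_nonneg_left (hC j) (abs_nonneg c)

theorem SubExp.shift {a : ℕ → ℝ} (ha : SubExp a) (k : ℕ) :
    SubExp (fun j => a (k + j)) := by
  intro R hR
  obtain ⟨C, hC⟩ := ha R hR
  refine ⟨C * R ^ k, fun j => ?_⟩
  rw [mul_assoc, ← pow_add]
  exact hC _

theorem SubExp.mulVarSeq {a : ℕ → ℝ} (ha : SubExp a) : SubExp (mulVarSeq a) := by
  intro R hR
  obtain ⟨C, hC⟩ := ha R hR
  have hC0 : 0 ≤ C := by have := (abs_nonneg _).trans (hC 0); simpa using this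
  refine ⟨C, fun j => ?_⟩
  cases j with
  | zero => simpa [_root_.mulVarSeq] using hC0
  | succ j =>
    refine (hC j).trans (mul_le_mul_of_nonneg_left ?_ hC0)
    exact pow_le_pow_right₀ hR.le (Nat.le_succ j)

theorem exists_natCast_mul_pow_le {r R : ℝ} (hr : 0 < r) (h : r < R) :
    ∃ D, ∀ j : ℕ, (j : ℝ) * r ^ j ≤ D * R ^ j := by
  have hq : |r / R| < 1 := by
    rw [abs_of_pos (by have := hr.trans h; positivity), div_lt_one (hr.trans h)]
    exact h
  have ht := tendsto_self_mul_const_pow_of_abs_lt_one hq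
  obtain ⟨D, hD⟩ := ht.bddAbove_range
  refine ⟨D, fun j => ?_⟩
  have h1 : (j : ℝ) * (r / R) ^ j ≤ D := hD ⟨j, rfl⟩
  have hR : 0 < R ^ j := pow_pos (hr.trans h) j
  rw [div_pow, ← mul_div_assoc, div_le_iff₀ hR] at h1
  exact h1

theorem SubExp.natCast_mul {a : ℕ → ℝ} (ha : SubExp a) : SubExp (fun j => (j : ℝ) * a j) := by
  intro R hR
  obtain ⟨C, hC⟩ := ha ((1 + R) / 2) (by linarith)
  have hC0 : 0 ≤ C := by have := (abs_nonneg _).trans (hC 0); simpa using this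
  obtain ⟨D, hD⟩ := exists_natCast_mul_pow_le (r := (1 + R) / 2) (R := R) (by linarith)
    (by linarith)
  refine ⟨C * D, fun j => ?_⟩
  rw [abs_mul, Nat.abs_cast]
  calc (j : ℝ) * |a j| ≤ j * (C * ((1 + R) / 2) ^ j) := by gcongr; exact hC j
    _ = C * (j * ((1 + R) / 2) ^ j) := by ring
    _ ≤ C * (D * R ^ j) := mul_le_mul_of_nonneg_left (hD j) hC0
    _ = _ := by ring

theorem SubExp.derivSeq {a : ℕ → ℝ} (ha : SubExp a) : SubExp (derivSeq a) := by
  have := ha.natCast_mul.shift 1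
  convert this using 2 with j
  simp [_root_.derivSeq, add_comm]

theorem SubExp.summable {a : ℕ → ℝ} (ha : SubExp a) {y : ℝ} (hy : |y| < 1) :
    Summable (fun j => a j * y ^ j) := by
  obtain ⟨R, hR1, hR⟩ : ∃ R > 1, R * |y| < 1 := by
    refine ⟨2 / (1 + |y|), ?_, ?_⟩
    · rw [gt_iff_lt, lt_div_iff₀ (by positivity)]; linarith
    · rw [div_mul_eq_mul_div, div_lt_one (by positivity)]; linarith
  obtain ⟨C, hC⟩ := ha R hR1
  refine Summable.of_norm_bounded (g := fun j => C * (R * |y|) ^ j)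
    ((summable_geometric_of_lt_one (by positivity) hR).mul_left C) fun j => ?_
  rw [norm_mul, norm_pow, Real.norm_eq_abs, Real.norm_eq_abs, mul_pow, ← mul_assoc]
  gcongr
  exact hC j

theorem powSum_add {a b : ℕ → ℝ} (ha : SubExp a) (hb : SubExp b) {y : ℝ} (hy : |y| < 1) :
    powSum (fun j => a j + b j) y = powSum a y + powSum b y := by
  unfold powSum
  rw [← (ha.summable hy).tsum_add (hb.summable hy)]
  simp only [add_mul]

theorem powSum_const_mul (c : ℝ) (a : ℕ → ℝ) (y : ℝ) :
    powSum (fun j => c * a j) y = c * powSum a y := by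
  unfold powSum
  rw [← tsum_mul_left]
  simp only [mul_assoc]

theorem powSum_mulVarSeq {a : ℕ → ℝ} (ha : SubExp a) {y : ℝ} (hy : |y| < 1) :
    powSum (mulVarSeq a) y = y * powSum a y := by
  unfold powSum
  rw [(ha.mulVarSeq.summable hy).tsum_eq_zero_add, ← tsum_mul_left]
  simp only [mulVarSeq, zero_mul, zero_add, pow_succ]
  congr 1; ext j; ring

theorem powSum_split {a : ℕ → ℝ} (ha : SubExp a) (k : ℕ) {y : ℝ} (hy : |y| < 1) :
    powSum a y = (∑ j ∈ Finset.range k, a j * y ^ j) + y ^ k * powSum (fun j => a (k + j)) y := by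
  unfold powSum
  rw [← (ha.summable hy).sum_add_tsum_nat_add k, ← tsum_mul_left]
  congr 2; ext j; rw [add_comm j k, pow_add]; ring

theorem powSum_zero (a : ℕ → ℝ) : powSum a 0 = a 0 := by
  unfold powSum
  rw [tsum_eq_single 0 (by intro j hj; simp [hj])]
  simp

theorem hasDerivAt_powSum {a : ℕ → ℝ} (ha : SubExp a) {y : ℝ} (hy : |y| < 1) :
    HasDerivAt (powSum a) (powSum (derivSeq a) y) y := by
  obtain ⟨r, hyr, hr1⟩ := exists_between hy
  have hr0 : 0 < r := (abs_nonneg y).trans_lt hyr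
  have hs := ha.derivSeq.summable (y := r) (by rwa [abs_of_pos hr0])
  have key := hasDerivAt_tsum_of_isPreconnected (𝕜 := ℝ) (F := ℝ)
    (g := fun j y => a j * y ^ j) (g' := fun j y => a j * (j * y ^ (j - 1)))
    (u := fun j => |a j * (j * r ^ (j - 1))|) (t := Metric.ball 0 r) (y₀ := 0) (y := y)
    ?_ Metric.isOpen_ball (convex_ball 0 r).isPreconnected
    (fun j z _ => (hasDerivAt_pow j z).const_mul (a j)) ?_ (by simpa using hr0)
    (ha.summable (by simp)) (by simpa using hyr)
  · have h2 : Summable (fun j => a j * (j * y ^ (j - 1))) := by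
      rw [← summable_nat_add_iff 1]
      refine (ha.derivSeq.summable hy).congr fun j => ?_
      simp [derivSeq]; ring
    have h3 : powSum (derivSeq a) y = ∑' j, a j * (j * y ^ (j - 1)) := by
      unfold powSum
      rw [h2.tsum_eq_zero_add]
      simp only [CharP.cast_eq_zero, zero_mul, mul_zero, zero_add]
      congr 1; ext j; simp [derivSeq]; ring
    rw [h3]
    exact key
  · rw [← summable_nat_add_iff 1]
    refine hs.abs.congr fun j => ?_
    simp [derivSeq]; ring
  · intro j z hz
    simp only [Metric.mem_ball, dist_zero_right, Real.norm_eq_abs] at hz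
    rw [Real.norm_eq_abs, abs_mul, abs_mul, abs_mul, abs_mul, abs_pow, abs_pow, abs_of_pos hr0]
    gcongr

theorem contDiffOn_powSum {a : ℕ → ℝ} (ha : SubExp a) :
    ContDiffOn ℝ (⊤ : ℕ∞) (powSum a) (Ioo (-1) 1) := by
  rw [contDiffOn_infty]
  intro k
  induction k generalizing a with
  | zero =>
    rw [Nat.cast_zero, contDiffOn_zero]
    exact fun y hy => (hasDerivAt_powSum ha (abs_lt.2 hy)).continuousAt.continuousWithinAt
  | succ k ih =>
    push_cast
    rw [contDiffOn_succ_iff_deriv_of_isOpen isOpen_Ioo]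
    refine ⟨fun y hy =>
      (hasDerivAt_powSum ha (abs_lt.2 hy)).differentiableAt.differentiableWithinAt, by simp, ?_⟩
    exact (ih ha.derivSeq).congr fun y hy => (hasDerivAt_powSum ha (abs_lt.2 hy)).deriv

/-- Solutions of a first order recurrence whose multiplier is asymptotically at most one grow
subexponentially. -/
theorem subExp_of_recurrence {a s ρ : ℕ → ℝ} (hρ : ∀ R > (1 : ℝ), ∀ᶠ j in atTop, |ρ j| ≤ R)
    (hs : SubExp s) (h : ∀ᶠ j in atTop, a (j + 1) = ρ j * a j + s j) : SubExp a := by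
  intro R hR
  obtain ⟨C, hC⟩ := hs R hR
  have hC0 : 0 ≤ C := by have := (abs_nonneg _).trans (hC 0); simpa using this
  obtain ⟨N, hN⟩ := eventually_atTop.1 ((hρ ((1 + R) / 2) (by linarith)).and h)
  set M := C / ((R - 1) / 2) + ∑ j ∈ Finset.range (N + 1), |a j| with hM
  have hsum : 0 ≤ ∑ j ∈ Finset.range (N + 1), |a j| := Finset.sum_nonneg fun _ _ => abs_nonneg _
  have hCR : 0 ≤ C / ((R - 1) / 2) := div_nonneg hC0 (by linarith)
  have hM0 : 0 ≤ M := by positivity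
  have hCM : C ≤ M * ((R - 1) / 2) := by
    rw [← div_le_iff₀ (by linarith)]; linarith
  have hle : ∀ j ≤ N, |a j| ≤ M * R ^ j := by
    intro j hj
    have h1 : |a j| ≤ M := by
      have := Finset.single_le_sum (f := fun j => |a j|) (fun i _ => abs_nonneg (a i))
        (Finset.mem_range.2 (Nat.lt_succ_of_le hj))
      linarith
    exact h1.trans (le_mul_of_one_le_right hM0 (one_le_pow₀ hR.le))
  refine ⟨M, fun j => ?_⟩
  rcases le_total j N with hj | hj
  · exact hle j hj
  · induction j, hj using Nat.le_induction with
    | base => exact hle N le_rfl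
    | succ j hj ih =>
      obtain ⟨h1, h2⟩ := hN j hj
      have hRj : 0 < R ^ j := pow_pos (by linarith) j
      calc |a (j + 1)| ≤ |ρ j| * |a j| + |s j| := by
            rw [h2, ← abs_mul]; exact abs_add_le _ _
        _ ≤ (1 + R) / 2 * (M * R ^ j) + M * ((R - 1) / 2) * R ^ j := by
            gcongr
            exact (hC j).trans (by gcongr)
        _ = M * R ^ (j + 1) := by rw [pow_succ]; ring

/-- The multiplier polynomial of the Frobenius recurrence. -/
def frobQ (m : ℕ) (lam : ℝ) (j : ℕ) : ℝ := (j : ℝ) ^ 2 + (1 - 2 * m) * j - lam ^ 2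

/-- The indicial polynomial, shifted by one. -/
def frobP (m j : ℕ) : ℝ := ((j : ℝ) + 1) * (j + 1 - m)

/-- The coefficients of the non-logarithmic Frobenius recurrence, before the resonance. -/
noncomputable def lowCoef (m : ℕ) (lam : ℝ) : ℕ → ℝ
  | 0 => 1
  | j + 1 => frobQ m lam j / frobP m j * lowCoef m lam j

/-- The coefficients of the regular solution `y ^ m + ⋯`. -/
noncomputable def regCoef (m : ℕ) (lam : ℝ) : ℕ → ℝ
  | 0 => 0
  | j + 1 => if j + 1 = m then 1 else frobQ m lam j / frobP m j * regCoef m lam j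

/-- The coefficient of the logarithmic term of the singular solution. -/
noncomputable def logConst (m : ℕ) (lam : ℝ) : ℝ :=
  frobQ m lam (m - 1) * lowCoef m lam (m - 1) / m

/-- The forcing which the logarithmic term induces in the recurrence for `singCoef`. -/
noncomputable def logForcing (m : ℕ) (lam : ℝ) (j : ℕ) : ℝ :=
  logConst m lam * (((2 * j + 1 - 2 * m) * regCoef m lam j
    - (2 * (j + 1) - m) * regCoef m lam (j + 1)) / frobP m j)

/-- The coefficients of the part of the singular solution without logarithm. -/
noncomputable def singCoef (m : ℕ) (lam : ℝ) : ℕ → ℝ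
  | 0 => 1
  | j + 1 => if j + 1 = m then 0 else
      frobQ m lam j / frobP m j * singCoef m lam j + logForcing m lam j

theorem frobP_ne_zero {m j : ℕ} (h : j + 1 ≠ m) : frobP m j ≠ 0 := by
  unfold frobP
  refine mul_ne_zero (by positivity) (sub_ne_zero.2 ?_)
  exact_mod_cast h

theorem frobP_eq_zero {m j : ℕ} (h : j + 1 = m) : frobP m j = 0 := by
  subst h; simp [frobP]

theorem regCoef_of_lt {m : ℕ} (lam : ℝ) {j : ℕ} (h : j < m) : regCoef m lam j = 0 := by
  induction j with
  | zero => rfl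
  | succ j ih => rw [regCoef, if_neg h.ne, ih (by omega), mul_zero]

theorem regCoef_self {m : ℕ} (hm : 2 ≤ m) (lam : ℝ) : regCoef m lam m = 1 := by
  obtain ⟨k, rfl⟩ : ∃ k, m = k + 1 := ⟨m - 1, by omega⟩
  rw [regCoef, if_pos rfl]

theorem regCoef_recurrence (m : ℕ) (lam : ℝ) (j : ℕ) :
    frobP m j * regCoef m lam (j + 1) = frobQ m lam j * regCoef m lam j := by
  by_cases h : j + 1 = m
  · rw [frobP_eq_zero h, regCoef_of_lt lam (show j < m by omega)]; ring
  · rw [regCoef, if_neg h]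
    field_simp [frobP_ne_zero h]

theorem singCoef_of_lt {m : ℕ} (lam : ℝ) {j : ℕ} (h : j < m) :
    singCoef m lam j = lowCoef m lam j := by
  induction j with
  | zero => rfl
  | succ j ih =>
    rw [singCoef, if_neg h.ne, ih (by omega), lowCoef, logForcing, regCoef_of_lt lam h,
      regCoef_of_lt lam (show j < m by omega)]
    simp

theorem singCoef_self {m : ℕ} (hm : 2 ≤ m) (lam : ℝ) : singCoef m lam m = 0 := by
  obtain ⟨k, rfl⟩ : ∃ k, m = k + 1 := ⟨m - 1, by omega⟩
  rw [singCoef, if_pos rfl]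

theorem singCoef_recurrence {m : ℕ} (hm : 2 ≤ m) (lam : ℝ) (j : ℕ) :
    frobP m j * singCoef m lam (j + 1) - frobQ m lam j * singCoef m lam j
      + logConst m lam * ((2 * (j + 1) - m) * regCoef m lam (j + 1)
        - (2 * j + 1 - 2 * m) * regCoef m lam j) = 0 := by
  by_cases h : j + 1 = m
  · have hj : j < m := by omega
    have hm0 : (m : ℝ) ≠ 0 := by positivity
    have hj1 : ((j : ℝ) + 1) = m := by exact_mod_cast h
    rw [frobP_eq_zero h, regCoef_of_lt lam hj, h, regCoef_self hm, singCoef_of_lt lam hj, hj1,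
      logConst, show m - 1 = j by omega]
    field_simp
    ring
  · rw [singCoef, if_neg h, logForcing]
    field_simp [frobP_ne_zero h]
    ring

/-- A bound for the growth of the Frobenius coefficients per step. -/
def stepBound (m : ℕ) : ℝ := 2 * m * (m + 1)

theorem one_le_stepBound {m : ℕ} (hm : 2 ≤ m) : 1 ≤ stepBound m := by
  have : (2 : ℝ) ≤ m := by exact_mod_cast hm
  unfold stepBound; nlinarith

theorem sq_le_abs_frobP {m j : ℕ} (h : j + 1 ≠ m) :
    ((j : ℝ) + 1) ^ 2 ≤ (m + 1) * |frobP m j| := by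
  unfold frobP
  rw [abs_mul, abs_of_pos (show (0 : ℝ) < (j : ℝ) + 1 by positivity)]
  have key : ((j : ℝ) + 1) ≤ (m + 1) * |(j : ℝ) + 1 - m| := by
    rcases lt_or_gt_of_ne h with h | h
    · have h' : (j : ℝ) + 1 + 1 ≤ m := by exact_mod_cast h
      have := neg_abs_le ((j : ℝ) + 1 - m)
      have : 0 ≤ (m : ℝ) := by positivity
      nlinarith
    · have h' : (m : ℝ) + 1 ≤ j + 1 := by exact_mod_cast h
      have := le_abs_self ((j : ℝ) + 1 - m)
      have : 0 ≤ (m : ℝ) := by positivity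
      nlinarith
  have : (0 : ℝ) < (j : ℝ) + 1 := by positivity
  nlinarith

theorem abs_frobQ_le {m : ℕ} (hm : 2 ≤ m) (lam : ℝ) (j : ℕ) :
    |frobQ m lam j| ≤ 2 * m * ((j : ℝ) + 1) ^ 2 * (1 + lam ^ 2) := by
  have hm' : (2 : ℝ) ≤ m := by exact_mod_cast hm
  have hj : (0 : ℝ) ≤ j := by positivity
  have hmj : 0 ≤ (m : ℝ) * j := by positivity
  have hl := sq_nonneg lam
  have h1 : (1 : ℝ) ≤ 2 * m * ((j : ℝ) + 1) ^ 2 := by nlinarith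
  have h2 : (j : ℝ) ^ 2 + 2 * m * j ≤ 2 * m * ((j : ℝ) + 1) ^ 2 := by nlinarith
  unfold frobQ
  rw [abs_le]
  constructor <;> nlinarith

theorem abs_frobQ_div_frobP_le {m j : ℕ} (hm : 2 ≤ m) (lam : ℝ) (h : j + 1 ≠ m) :
    |frobQ m lam j / frobP m j| ≤ stepBound m * (1 + lam ^ 2) := by
  have hP := abs_pos.2 (frobP_ne_zero h)
  rw [abs_div, div_le_iff₀ hP]
  refine (abs_frobQ_le hm lam j).trans ?_
  have := sq_le_abs_frobP h
  have h0 : 0 ≤ 2 * (m : ℝ) * (1 + lam ^ 2) := by positivity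
  unfold stepBound
  nlinarith [mul_le_mul_of_nonneg_left this h0]

theorem abs_logForcing_le {m : ℕ} (hm : 2 ≤ m) (lam : ℝ) (j : ℕ) :
    |logForcing m lam j| ≤
      |logConst m lam| * stepBound m * (|regCoef m lam j| + |regCoef m lam (j + 1)|) := by
  have hs := one_le_stepBound hm
  by_cases h : j + 1 = m
  · rw [logForcing, frobP_eq_zero h]
    simp only [div_zero, mul_zero, abs_zero]
    positivity
  have hP := abs_pos.2 (frobP_ne_zero h)
  have hm' : (2 : ℝ) ≤ m := by exact_mod_cast hm
  have hj : (0 : ℝ) ≤ j := by positivity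
  have hmj : 0 ≤ (m : ℝ) * j := by positivity
  have hsP : 2 * (m : ℝ) * (j + 1) ≤ stepBound m * |frobP m j| := by
    have := sq_le_abs_frobP h
    have h1 : ((j : ℝ) + 1) ≤ (m + 1) * |frobP m j| := by nlinarith
    unfold stepBound
    nlinarith
  have hq : |2 * (j : ℝ) + 1 - 2 * m| ≤ 2 * m * (j + 1) := by
    rw [abs_le]; constructor <;> nlinarith
  have hp : |2 * ((j : ℝ) + 1) - m| ≤ 2 * m * (j + 1) := by
    rw [abs_le]; constructor <;> nlinarith
  rw [logForcing, abs_mul, mul_assoc]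
  refine mul_le_mul_of_nonneg_left ?_ (abs_nonneg _)
  rw [abs_div, div_le_iff₀ hP]
  refine (abs_sub _ _).trans ?_
  rw [abs_mul, abs_mul]
  have e1 := mul_le_mul_of_nonneg_right (hq.trans hsP) (abs_nonneg (regCoef m lam j))
  have e2 := mul_le_mul_of_nonneg_right (hp.trans hsP) (abs_nonneg (regCoef m lam (j + 1)))
  linarith

theorem eventually_abs_frobQ_div_frobP_le (m : ℕ) (lam : ℝ) (R : ℝ) (hR : 1 < R) :
    ∀ᶠ j in atTop, |frobQ m lam j / frobP m j| ≤ R := by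
  have h1 := tendsto_natCast_atTop_atTop (R := ℝ) |>.eventually_ge_atTop
    ((2 * m + 1 + R * m + lam ^ 2) / (R - 1))
  filter_upwards [h1, eventually_ge_atTop (m + 1)] with j hj hjm
  have hR1 : 0 < R - 1 := by linarith
  rw [div_le_iff₀ hR1] at hj
  have hjm' : (m : ℝ) + 1 ≤ j := by exact_mod_cast hjm
  have hm : (0 : ℝ) ≤ m := by positivity
  have hl := sq_nonneg lam
  have hP : 0 < frobP m j := mul_pos (by positivity) (by linarith)
  rw [abs_div, abs_of_pos hP, div_le_iff₀ hP]
  have hPl : (j : ℝ) * (j - m) ≤ frobP m j := by unfold frobP; nlinarith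
  have hQ : |frobQ m lam j| ≤ j ^ 2 + (2 * m + 1) * j + lam ^ 2 := by
    have hmj : 0 ≤ (m : ℝ) * j := by positivity
    unfold frobQ
    rw [abs_le]; constructor <;> nlinarith
  have e1 : (2 * m + 1 + R * m + lam ^ 2) * (j : ℝ) ≤ j * (R - 1) * j :=
    mul_le_mul_of_nonneg_right hj (by linarith)
  have e2 : lam ^ 2 ≤ lam ^ 2 * j := le_mul_of_one_le_right hl (by linarith)
  have e3 : R * ((j : ℝ) * (j - m)) ≤ R * frobP m j :=
    mul_le_mul_of_nonneg_left hPl (by linarith)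
  nlinarith

theorem subExp_regCoef (m : ℕ) (lam : ℝ) : SubExp (regCoef m lam) := by
  refine subExp_of_recurrence (s := fun _ => 0) (eventually_abs_frobQ_div_frobP_le m lam)
    (fun R _ => ⟨0, by simp⟩) ?_
  filter_upwards [eventually_ge_atTop m] with j hj
  rw [regCoef, if_neg (by omega), add_zero]

theorem subExp_logForcing {m : ℕ} (hm : 2 ≤ m) (lam : ℝ) : SubExp (logForcing m lam) := by
  intro R hR
  obtain ⟨C, hC⟩ := subExp_regCoef m lam R hR
  refine ⟨|logConst m lam| * stepBound m * (C + C * R), fun j => ?_⟩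
  refine (abs_logForcing_le hm lam j).trans ?_
  have hs := one_le_stepBound hm
  have h1 := hC (j + 1)
  rw [pow_succ] at h1
  rw [mul_assoc _ (C + C * R)]
  refine mul_le_mul_of_nonneg_left ?_ (by positivity)
  linarith [hC j]

theorem subExp_singCoef {m : ℕ} (hm : 2 ≤ m) (lam : ℝ) : SubExp (singCoef m lam) := by
  refine subExp_of_recurrence (eventually_abs_frobQ_div_frobP_le m lam)
    (subExp_logForcing hm lam) ?_
  filter_upwards [eventually_ge_atTop m] with j hj
  rw [singCoef, if_neg (by omega)]

theorem abs_regCoef_add_le {m : ℕ} (hm : 2 ≤ m) (lam : ℝ) (i : ℕ) :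
    |regCoef m lam (m + i)| ≤ (stepBound m * (1 + lam ^ 2)) ^ i := by
  induction i with
  | zero => simp [regCoef_self hm]
  | succ i ih =>
    rw [← add_assoc, regCoef, if_neg (by omega), abs_mul, pow_succ']
    have hs := one_le_stepBound hm
    exact mul_le_mul (abs_frobQ_div_frobP_le hm lam (by omega)) ih (abs_nonneg _) (by positivity)

theorem abs_lowCoef_le {m : ℕ} (hm : 2 ≤ m) (lam : ℝ) {j : ℕ} (hj : j < m) :
    |lowCoef m lam j| ≤ (stepBound m * (1 + lam ^ 2)) ^ j := by
  induction j with
  | zero => simp [lowCoef]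
  | succ j ih =>
    rw [lowCoef, abs_mul, pow_succ']
    have hs := one_le_stepBound hm
    exact mul_le_mul (abs_frobQ_div_frobP_le hm lam (by omega)) (ih (by omega)) (abs_nonneg _)
      (by positivity)

theorem abs_logConst_le {m : ℕ} (hm : 2 ≤ m) (lam : ℝ) :
    |logConst m lam| ≤ (stepBound m * (1 + lam ^ 2)) ^ m := by
  have hs := one_le_stepBound hm
  have hm0 : (0 : ℝ) < m := by positivity
  obtain ⟨k, rfl⟩ : ∃ k, m = k + 1 := ⟨m - 1, by omega⟩
  rw [logConst, show k + 1 - 1 = k by omega, abs_div, abs_mul, Nat.abs_cast, div_le_iff₀ hm0,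
    pow_succ', mul_assoc (stepBound (k + 1) * (1 + lam ^ 2)), mul_comm _ (((k + 1 : ℕ)) : ℝ),
    ← mul_assoc]
  refine mul_le_mul ?_ (abs_lowCoef_le hm lam (by omega)) (abs_nonneg _) (by positivity)
  refine (abs_frobQ_le hm lam k).trans ?_
  unfold stepBound
  push_cast
  have : (0 : ℝ) ≤ 2 * (k + 1) ^ 2 * (1 + lam ^ 2) := by positivity
  nlinarith

theorem abs_logConst_mul_regCoef_le {m : ℕ} (hm : 2 ≤ m) (lam : ℝ) (j : ℕ) :
    |logConst m lam| * |regCoef m lam j| ≤ (stepBound m * (1 + lam ^ 2)) ^ j := by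
  have hs := one_le_stepBound hm
  rcases lt_or_ge j m with h | h
  · rw [regCoef_of_lt lam h, abs_zero, mul_zero]; positivity
  · obtain ⟨i, rfl⟩ := Nat.exists_eq_add_of_le h
    rw [pow_add]
    exact mul_le_mul (abs_logConst_le hm lam) (abs_regCoef_add_le hm lam i) (abs_nonneg _)
      (by positivity)

theorem abs_singCoef_le {m : ℕ} (hm : 2 ≤ m) (lam : ℝ) (j : ℕ) :
    |singCoef m lam j| ≤ (3 * stepBound m ^ 2 * (1 + lam ^ 2)) ^ j := by
  have hs := one_le_stepBound hm
  have hl := sq_nonneg lam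
  set s := stepBound m with hsdef
  set X := 1 + lam ^ 2 with hX
  have hX1 : 1 ≤ X := by linarith
  induction j with
  | zero => simp [singCoef]
  | succ j ih =>
    by_cases h : j + 1 = m
    · rw [singCoef, if_pos h, abs_zero]; positivity
    rw [singCoef, if_neg h]
    refine (abs_add_le _ _).trans ?_
    have h1 : |frobQ m lam j / frobP m j * singCoef m lam j| ≤
        s * X * (3 * s ^ 2 * X) ^ j := by
      rw [abs_mul]
      exact mul_le_mul (abs_frobQ_div_frobP_le hm lam h) ih (abs_nonneg _) (by positivity)
    have h2 : |logForcing m lam j| ≤ s * ((s * X) ^ j + (s * X) ^ (j + 1)) := by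
      refine (abs_logForcing_le hm lam j).trans ?_
      have e1 := abs_logConst_mul_regCoef_le hm lam j
      have e2 := abs_logConst_mul_regCoef_le hm lam (j + 1)
      rw [mul_comm _ s, mul_assoc, mul_add]
      exact mul_le_mul_of_nonneg_left (add_le_add e1 e2) (by positivity)
    have hpow : (s * X) ^ j ≤ (s ^ 2 * X) ^ j := by
      apply pow_le_pow_left₀ (by positivity)
      exact mul_le_mul_of_nonneg_right (le_self_pow₀ hs two_ne_zero) (by linarith)
    have h3 : (s ^ 2 * X) ^ j ≤ (3 * s ^ 2 * X) ^ j := by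
      apply pow_le_pow_left₀ (by positivity)
      have : 0 ≤ s ^ 2 * X := by positivity
      nlinarith
    have hB : 0 ≤ (3 * s ^ 2 * X) ^ j := by positivity
    have hss : s ≤ s ^ 2 * X := by
      have : s * 1 ≤ s * (s * X) := mul_le_mul_of_nonneg_left (by nlinarith) (by linarith)
      nlinarith
    have h4 : s * (s * X) ^ j ≤ s ^ 2 * X * (3 * s ^ 2 * X) ^ j :=
      mul_le_mul hss (hpow.trans h3) (by positivity) (by positivity)
    have h5 : s * (s * X) ^ (j + 1) ≤ s ^ 2 * X * (3 * s ^ 2 * X) ^ j := by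
      rw [pow_succ']
      have : s * (s * X * (s * X) ^ j) = s ^ 2 * X * (s * X) ^ j := by ring
      rw [this]
      exact mul_le_mul_of_nonneg_left (hpow.trans h3) (by positivity)
    have h6 : s * X * (3 * s ^ 2 * X) ^ j ≤ s ^ 2 * X * (3 * s ^ 2 * X) ^ j := by
      refine mul_le_mul_of_nonneg_right ?_ hB
      exact mul_le_mul_of_nonneg_right (le_self_pow₀ hs two_ne_zero) (by linarith)
    rw [pow_succ']
    linarith

/-- The coefficients of `y * f'(y)` for a power series `f`. -/
def eulerSeq (a : ℕ → ℝ) (j : ℕ) : ℝ := j * a j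

theorem SubExp.eulerSeq {a : ℕ → ℝ} (ha : SubExp a) : SubExp (eulerSeq a) := ha.natCast_mul

theorem mul_powSum_derivSeq {a : ℕ → ℝ} (ha : SubExp a) {y : ℝ} (hy : |y| < 1) :
    y * powSum (derivSeq a) y = powSum (eulerSeq a) y := by
  rw [← powSum_mulVarSeq ha.derivSeq hy]
  congr 1; ext j
  cases j <;> simp [mulVarSeq, derivSeq, eulerSeq]

theorem sq_mul_powSum_derivSeq_derivSeq {a : ℕ → ℝ} (ha : SubExp a) {y : ℝ} (hy : |y| < 1) :
    y ^ 2 * powSum (derivSeq (derivSeq a)) y =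
      powSum (eulerSeq (eulerSeq a)) y - powSum (eulerSeq a) y := by
  have h1 := mul_powSum_derivSeq ha.derivSeq hy
  have h2 := powSum_mulVarSeq ha.derivSeq.eulerSeq hy
  have h3 : powSum (fun j => mulVarSeq (eulerSeq (derivSeq a)) j + eulerSeq a j) y =
      powSum (eulerSeq (eulerSeq a)) y := by
    congr 1; ext j
    cases j with
    | zero => simp [mulVarSeq, eulerSeq]
    | succ j => simp [mulVarSeq, eulerSeq, derivSeq]; ring
  rw [powSum_add ha.derivSeq.eulerSeq.mulVarSeq ha.eulerSeq hy] at h3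
  rw [pow_two, mul_assoc, h1]
  linarith

theorem regCoef_euler_identity (m : ℕ) (lam : ℝ) {y : ℝ} (hy : |y| < 1) :
    powSum (eulerSeq (eulerSeq (regCoef m lam))) y
        - m * powSum (eulerSeq (regCoef m lam)) y =
      y * (powSum (eulerSeq (eulerSeq (regCoef m lam))) y
        + (1 - 2 * m) * powSum (eulerSeq (regCoef m lam)) y
        - lam ^ 2 * powSum (regCoef m lam) y) := by
  have hb := subExp_regCoef m lam
  set b := regCoef m lam with hbdef
  have h1 : powSum (fun j => eulerSeq (eulerSeq b) j + (-m) * eulerSeq b j) y =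
      powSum (mulVarSeq (fun j => (eulerSeq (eulerSeq b) j + (1 - 2 * m) * eulerSeq b j)
        + (-lam ^ 2) * b j)) y := by
    congr 1; ext j
    cases j with
    | zero => simp [mulVarSeq, eulerSeq]
    | succ j =>
      have := regCoef_recurrence m lam j
      unfold frobP frobQ at this
      simp only [mulVarSeq, eulerSeq, ← hbdef] at this ⊢
      push_cast
      linear_combination this
  rw [powSum_mulVarSeq ((hb.eulerSeq.eulerSeq.add (hb.eulerSeq.const_mul _)).add
      (hb.const_mul _)) hy,
    powSum_add hb.eulerSeq.eulerSeq (hb.eulerSeq.const_mul _) hy,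
    powSum_add (hb.eulerSeq.eulerSeq.add (hb.eulerSeq.const_mul _)) (hb.const_mul _) hy,
    powSum_add hb.eulerSeq.eulerSeq (hb.eulerSeq.const_mul _) hy,
    powSum_const_mul, powSum_const_mul, powSum_const_mul] at h1
  linear_combination h1

theorem singCoef_euler_identity {m : ℕ} (hm : 2 ≤ m) (lam : ℝ) {y : ℝ} (hy : |y| < 1) :
    powSum (eulerSeq (eulerSeq (singCoef m lam))) y
        - m * powSum (eulerSeq (singCoef m lam)) y
        + logConst m lam * (2 * powSum (eulerSeq (regCoef m lam)) y
          - m * powSum (regCoef m lam) y) =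
      y * (powSum (eulerSeq (eulerSeq (singCoef m lam))) y
        + (1 - 2 * m) * powSum (eulerSeq (singCoef m lam)) y
        - lam ^ 2 * powSum (singCoef m lam) y
        + logConst m lam * (2 * powSum (eulerSeq (regCoef m lam)) y
          + (1 - 2 * m) * powSum (regCoef m lam) y)) := by
  have hb := subExp_regCoef m lam
  have ha := subExp_singCoef hm lam
  have hb0 : regCoef m lam 0 = 0 := rfl
  set b := regCoef m lam with hbdef
  set a := singCoef m lam with hadef
  set l := logConst m lam
  have h1 : powSum (fun j => (eulerSeq (eulerSeq a) j + (-m) * eulerSeq a j)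
        + l * (2 * eulerSeq b j + (-m) * b j)) y =
      powSum (mulVarSeq (fun j => ((eulerSeq (eulerSeq a) j + (1 - 2 * m) * eulerSeq a j)
        + (-lam ^ 2) * a j) + l * (2 * eulerSeq b j + (1 - 2 * m) * b j))) y := by
    congr 1; ext j
    cases j with
    | zero => simp [mulVarSeq, eulerSeq, hb0]
    | succ j =>
      have := singCoef_recurrence hm lam j
      unfold frobP frobQ at this
      simp only [mulVarSeq, eulerSeq, ← hbdef, ← hadef] at this ⊢
      push_cast
      linear_combination this
  have e1 := hb.eulerSeq.const_mul 2
  have e2 := hb.const_mul (-(m : ℝ))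
  have e3 := hb.const_mul (1 - 2 * (m : ℝ))
  have e4 := ha.eulerSeq.eulerSeq
  have e5 := ha.eulerSeq.const_mul (-(m : ℝ))
  have e6 := ha.eulerSeq.const_mul (1 - 2 * (m : ℝ))
  have e7 := ha.const_mul (-lam ^ 2)
  rw [powSum_mulVarSeq (((e4.add e6).add e7).add ((e1.add e3).const_mul l)) hy,
    powSum_add (e4.add e5) ((e1.add e2).const_mul l) hy,
    powSum_add ((e4.add e6).add e7) ((e1.add e3).const_mul l) hy,
    powSum_add (e4.add e6) e7 hy, powSum_add e4 e5 hy, powSum_add e4 e6 hy,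
    powSum_const_mul l, powSum_const_mul l, powSum_add e1 e2 hy, powSum_add e1 e3 hy] at h1
  simp only [powSum_const_mul] at h1
  linear_combination h1

/-- The general solution in the variable `y = v / (1 + v)`. -/
noncomputable def ySol (m : ℕ) (lam c d y : ℝ) : ℝ :=
  c * powSum (singCoef m lam) y
    + (c * logConst m lam * Real.log y + d) * powSum (regCoef m lam) y

/-- The first derivative of `ySol`. -/
noncomputable def ySolDeriv (m : ℕ) (lam c d y : ℝ) : ℝ :=
  c * powSum (derivSeq (singCoef m lam)) y
    + (c * logConst m lam * y⁻¹ * powSum (regCoef m lam) y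
      + (c * logConst m lam * Real.log y + d) * powSum (derivSeq (regCoef m lam)) y)

/-- The second derivative of `ySol`. -/
noncomputable def ySolDeriv₂ (m : ℕ) (lam c d y : ℝ) : ℝ :=
  c * powSum (derivSeq (derivSeq (singCoef m lam))) y
    + ((c * logConst m lam * (-(y ^ 2)⁻¹) * powSum (regCoef m lam) y
        + c * logConst m lam * y⁻¹ * powSum (derivSeq (regCoef m lam)) y)
      + (c * logConst m lam * y⁻¹ * powSum (derivSeq (regCoef m lam)) y
        + (c * logConst m lam * Real.log y + d)
          * powSum (derivSeq (derivSeq (regCoef m lam))) y))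

theorem hasDerivAt_ySol {m : ℕ} (hm : 2 ≤ m) (lam c d : ℝ) {y : ℝ} (hy : y ∈ Ioo (0 : ℝ) 1) :
    HasDerivAt (ySol m lam c d) (ySolDeriv m lam c d y) y := by
  have hy1 : |y| < 1 := by rw [abs_of_pos hy.1]; exact hy.2
  have hf := hasDerivAt_powSum (subExp_singCoef hm lam) hy1
  have hg := hasDerivAt_powSum (subExp_regCoef m lam) hy1
  have hl := ((Real.hasDerivAt_log hy.1.ne').const_mul (c * logConst m lam)).add_const d
  exact (hf.const_mul c).add (hl.mul hg)

theorem hasDerivAt_ySolDeriv {m : ℕ} (hm : 2 ≤ m) (lam c d : ℝ) {y : ℝ}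
    (hy : y ∈ Ioo (0 : ℝ) 1) :
    HasDerivAt (ySolDeriv m lam c d) (ySolDeriv₂ m lam c d y) y := by
  have hy1 : |y| < 1 := by rw [abs_of_pos hy.1]; exact hy.2
  have hf := hasDerivAt_powSum (subExp_singCoef hm lam).derivSeq hy1
  have hg := hasDerivAt_powSum (subExp_regCoef m lam) hy1
  have hg' := hasDerivAt_powSum (subExp_regCoef m lam).derivSeq hy1
  have hl := ((Real.hasDerivAt_log hy.1.ne').const_mul (c * logConst m lam)).add_const d
  have hi := (hasDerivAt_inv hy.1.ne').const_mul (c * logConst m lam)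
  exact (hf.const_mul c).add ((hi.mul hg).add (hl.mul hg'))

theorem ySol_ode {m : ℕ} (hm : 2 ≤ m) (lam c d : ℝ) {y : ℝ} (hy : y ∈ Ioo (0 : ℝ) 1) :
    y * (1 - y) * ySolDeriv₂ m lam c d y + (1 - m) * (1 - 2 * y) * ySolDeriv m lam c d y
      + lam ^ 2 * ySol m lam c d y = 0 := by
  have hy1 : |y| < 1 := by rw [abs_of_pos hy.1]; exact hy.2
  have hy0 : y ≠ 0 := hy.1.ne'
  have ha := subExp_singCoef hm lam
  have hb := subExp_regCoef m lam
  have f1 := mul_powSum_derivSeq ha hy1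
  have f2 := sq_mul_powSum_derivSeq_derivSeq ha hy1
  have g1 := mul_powSum_derivSeq hb hy1
  have g2 := sq_mul_powSum_derivSeq_derivSeq hb hy1
  have hg := regCoef_euler_identity m lam hy1
  have hf := singCoef_euler_identity hm lam hy1
  rw [← f1, eq_add_of_sub_eq f2.symm, ← g1, ← f1] at hf
  rw [← g1, eq_add_of_sub_eq g2.symm, ← g1] at hg
  unfold ySol ySolDeriv ySolDeriv₂
  field_simp
  linear_combination c * hf + (c * logConst m lam * Real.log y + d) * hg

/-- The general solution of the self-similar wave equation. -/
noncomputable def waveSol (m : ℕ) (lam c d v : ℝ) : ℝ := ySol m lam c d (v / (1 + v))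

theorem div_one_add_mem_Ioo {v : ℝ} (hv : 0 < v) : v / (1 + v) ∈ Ioo (0 : ℝ) 1 :=
  ⟨by positivity, by rw [div_lt_one (by positivity)]; linarith⟩

theorem hasDerivAt_div_one_add {v : ℝ} (hv : 1 + v ≠ 0) :
    HasDerivAt (fun v : ℝ => v / (1 + v)) (((1 + v) ^ 2)⁻¹) v := by
  have h := (hasDerivAt_id' v).fun_div ((hasDerivAt_id' v).const_add 1) hv
  rwa [one_mul, mul_one, add_sub_cancel_right, one_div] at h

theorem hasDerivAt_waveSol {m : ℕ} (hm : 2 ≤ m) (lam c d : ℝ) {v : ℝ} (hv : 0 < v) :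
    HasDerivAt (waveSol m lam c d)
      (ySolDeriv m lam c d (v / (1 + v)) * ((1 + v) ^ 2)⁻¹) v :=
  (hasDerivAt_ySol hm lam c d (div_one_add_mem_Ioo hv)).comp v
    (hasDerivAt_div_one_add (by positivity))

theorem solvesWaveODE_waveSol {m : ℕ} (hm : 2 ≤ m) (lam c d : ℝ) :
    SolvesWaveODE (2 * m) lam (waveSol m lam c d) := by
  intro v hv
  have hv1 : 1 + v ≠ 0 := by positivity
  have h1 : deriv (waveSol m lam c d) =ᶠ[nhds v]
      fun v => ySolDeriv m lam c d (v / (1 + v)) * ((1 + v) ^ 2)⁻¹ := by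
    filter_upwards [Ioi_mem_nhds hv] with w hw
    exact (hasDerivAt_waveSol hm lam c d hw).deriv
  have h2 := (HasDerivAt.comp v (hasDerivAt_ySolDeriv hm lam c d (div_one_add_mem_Ioo hv))
    (hasDerivAt_div_one_add hv1)).fun_mul
    ((((hasDerivAt_id' v).const_add 1).fun_pow 2).fun_inv (pow_ne_zero 2 hv1))
  have h3 : iteratedDeriv 2 (waveSol m lam c d) v =
      ySolDeriv₂ m lam c d (v / (1 + v)) * ((1 + v) ^ 2)⁻¹ * ((1 + v) ^ 2)⁻¹
        - ySolDeriv m lam c d (v / (1 + v)) * (2 * (1 + v) / ((1 + v) ^ 2) ^ 2) := by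
    rw [iteratedDeriv_succ, iteratedDeriv_one, h1.deriv_eq]
    refine h2.deriv.trans ?_
    simp only [Function.comp_apply]
    ring
  rw [h3, h1.eq_of_nhds]
  have hode := ySol_ode hm lam c d (div_one_add_mem_Ioo hv)
  unfold waveSol
  set y := v / (1 + v) with hy
  have hvy : y * (1 + v) = v := by rw [hy]; field_simp
  have hy2 : y * (1 - y) = v * ((1 + v) ^ 2)⁻¹ := by rw [hy]; field_simp; ring
  have hy3 : 1 - 2 * y = (1 - v) * (1 + v)⁻¹ := by rw [hy]; field_simp; ring
  rw [hy2, hy3] at hode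
  clear_value y
  field_simp at hode ⊢
  push_cast
  linear_combination 2 * (1 + v) ^ 2 * hode

/-- The constants appearing in the derivatives of `v ^ m * log v`. -/
def logDerivCoef (m : ℕ) : ℕ → ℕ
  | 0 => 0
  | a + 1 => (m - a) * logDerivCoef m a + m.descFactorial a

theorem contDiffOn_iteratedDeriv_of_isOpen {f : ℝ → ℝ} {U : Set ℝ} (hU : IsOpen U)
    (hf : ContDiffOn ℝ (⊤ : ℕ∞) f U) (a : ℕ) : ContDiffOn ℝ (⊤ : ℕ∞) (iteratedDeriv a f) U := by
  induction a with
  | zero => simpa using hf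
  | succ a ih =>
    rw [iteratedDeriv_succ]
    exact ((contDiffOn_infty_iff_deriv_of_isOpen hU).1 ih).2

theorem ContDiffOn.hasDerivAt_of_isOpen {f : ℝ → ℝ} {U : Set ℝ} (hU : IsOpen U)
    (hf : ContDiffOn ℝ (⊤ : ℕ∞) f U) {v : ℝ} (hv : v ∈ U) : HasDerivAt f (deriv f v) v :=
  ((hf.differentiableOn (by simp)).differentiableAt (hU.mem_nhds hv)).hasDerivAt

theorem exists_iteratedDeriv_eq_pow_mul_log {m : ℕ} {U : Set ℝ} (hU : IsOpen U)
    (hU0 : Ici (0 : ℝ) ⊆ U) {ψ F G E : ℝ → ℝ} (hF : ContDiffOn ℝ (⊤ : ℕ∞) F U)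
    (hG : ContDiffOn ℝ (⊤ : ℕ∞) G U) (hE : ContDiffOn ℝ (⊤ : ℕ∞) E U)
    (hψ : ∀ v > 0, ψ v = F v + v ^ m * (Real.log v * G v + E v)) {a : ℕ} (ha : a ≤ m) :
    ∃ A B : ℝ → ℝ, ContDiffOn ℝ (⊤ : ℕ∞) A U ∧ ContDiffOn ℝ (⊤ : ℕ∞) B U ∧
      A 0 = m.descFactorial a * G 0 ∧
      B 0 = logDerivCoef m a * G 0 + m.descFactorial a * E 0 ∧
      ∀ v > 0, iteratedDeriv a ψ v =
        iteratedDeriv a F v + v ^ (m - a) * (Real.log v * A v + B v) := by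
  induction a with
  | zero => exact ⟨G, E, hG, hE, by simp, by simp [logDerivCoef], by simpa using hψ⟩
  | succ a ih =>
    obtain ⟨A, B, hA, hB, hA0, hB0, h⟩ := ih (by omega)
    obtain ⟨k, hk⟩ : ∃ k, m - a = k + 1 := ⟨m - a - 1, by omega⟩
    have hA' := ((contDiffOn_infty_iff_deriv_of_isOpen hU).1 hA).2
    have hB' := ((contDiffOn_infty_iff_deriv_of_isOpen hU).1 hB).2
    refine ⟨fun v => (k + 1) * A v + v * deriv A v,
      fun v => (k + 1) * B v + A v + v * deriv B v,
      (contDiffOn_const.mul hA).add (contDiffOn_id.mul hA'),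
      ((contDiffOn_const.mul hB).add hA).add (contDiffOn_id.mul hB'), ?_, ?_, ?_⟩
    · simp only [zero_mul, add_zero, hA0, Nat.descFactorial_succ, hk]
      push_cast; ring
    · simp only [zero_mul, add_zero, hA0, hB0, Nat.descFactorial_succ, hk, logDerivCoef]
      push_cast; ring
    · intro v hv
      have hvU : v ∈ U := hU0 (le_of_lt hv)
      have hv0 : v ≠ 0 := ne_of_gt hv
      have hev : iteratedDeriv a ψ =ᶠ[nhds v]
          fun v => iteratedDeriv a F v + v ^ (k + 1) * (Real.log v * A v + B v) := by
        filter_upwards [Ioi_mem_nhds hv] with w hw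
        rw [h w hw, hk]
      have hFd := (contDiffOn_iteratedDeriv_of_isOpen hU hF a).hasDerivAt_of_isOpen hU hvU
      have hd := hFd.fun_add ((hasDerivAt_pow (k + 1) v).fun_mul
        (((Real.hasDerivAt_log hv0).fun_mul (hA.hasDerivAt_of_isOpen hU hvU)).fun_add
          (hB.hasDerivAt_of_isOpen hU hvU)))
      rw [iteratedDeriv_succ, hev.deriv_eq, hd.deriv, iteratedDeriv_succ,
        show m - (a + 1) = k by omega]
      simp only [Nat.add_sub_cancel, pow_succ]
      push_cast
      field_simp
      ring

theorem exists_abs_sub_le_of_contDiffOn {U : Set ℝ} (hU : IsOpen U) (hU0 : Ici (0 : ℝ) ⊆ U)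
    {f : ℝ → ℝ} (hf : ContDiffOn ℝ (⊤ : ℕ∞) f U) :
    ∃ K, 0 ≤ K ∧ ∀ v ∈ Icc (0 : ℝ) 1, |f v| ≤ K ∧ |deriv f v| ≤ K ∧ |f v - f 0| ≤ K * v := by
  have hsub : Icc (0 : ℝ) 1 ⊆ U := fun v hv => hU0 hv.1
  have hf' := ((contDiffOn_infty_iff_deriv_of_isOpen hU).1 hf).2
  obtain ⟨K₁, h₁⟩ := isCompact_Icc.exists_bound_of_continuousOn (hf.continuousOn.mono hsub)
  obtain ⟨K₂, h₂⟩ := isCompact_Icc.exists_bound_of_continuousOn (hf'.continuousOn.mono hsub)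
  have h0 : (0 : ℝ) ∈ Icc (0 : ℝ) 1 := by simp
  refine ⟨max K₁ K₂, (norm_nonneg _).trans ((h₁ 0 h0).trans (le_max_left _ _)), fun v hv =>
    ⟨(h₁ v hv).trans (le_max_left _ _), (h₂ v hv).trans (le_max_right _ _), ?_⟩⟩
  have := (convex_Icc (0 : ℝ) 1).norm_image_sub_le_of_norm_deriv_le (f := f) (C := max K₁ K₂)
    (fun x hx => (hf.hasDerivAt_of_isOpen hU (hsub hx)).differentiableAt)
    (fun x hx => (h₂ x hx).trans (le_max_right _ _)) h0 hv
  simpa [abs_of_nonneg hv.1] using this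

theorem hasAsymptoticDataODE_of_eq {m : ℕ} (hm : 2 ≤ m) {U : Set ℝ} (hU : IsOpen U)
    (hU0 : Ici (0 : ℝ) ⊆ U) {lam : ℝ} {ψ F G E : ℝ → ℝ} (hF : ContDiffOn ℝ (⊤ : ℕ∞) F U)
    (hG : ContDiffOn ℝ (⊤ : ℕ∞) G U) (hE : ContDiffOn ℝ (⊤ : ℕ∞) E U)
    (hψ : ∀ v ≥ 0, ψ v = F v + v ^ m * (Real.log v * G v + E v))
    (hode : SolvesWaveODE (2 * m) lam ψ) :
    HasAsymptoticDataODE (2 * m) lam ψ (F 0) (2 * m.factorial * G 0)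
      (iteratedDeriv m F 0 + logDerivCoef m m * G 0 + m.factorial * E 0) := by
  have hψ' : ∀ v > 0, ψ v = F v + v ^ m * (Real.log v * G v + E v) := fun v hv => hψ v hv.le
  have hpos : Ioi (0 : ℝ) ⊆ U := Ioi_subset_Ici_self.trans hU0
  have hn : 2 * m / 2 = m := by omega
  -- continuity of the regularised expressions up to `v = 0`
  have hcont : ∀ (k : ℕ) (F A B : ℝ → ℝ), ContDiffOn ℝ (⊤ : ℕ∞) F U →
      ContDiffOn ℝ (⊤ : ℕ∞) A U → ContDiffOn ℝ (⊤ : ℕ∞) B U →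
      ContinuousOn (fun v => F v + v ^ k * (v * Real.log v * A v + v * B v)) U :=
    fun k F A B hF hA hB => hF.continuousOn.add ((continuousOn_id.pow k).mul
      ((Real.continuous_mul_log.continuousOn.mul hA.continuousOn).add
        (continuousOn_id.mul hB.continuousOn)))
  rw [HasAsymptoticDataODE, hn]
  refine ⟨?_, ?_, hode, ?_, ?_, ?_⟩
  · obtain ⟨k, rfl⟩ : ∃ k, m = k + 1 := ⟨m - 1, by omega⟩
    refine ((hcont k F G E hF hG hE).mono hU0).congr fun v hv => ?_
    rw [hψ v hv]; ring
  · refine ContDiffOn.congr ?_ hψ'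
    exact (hF.mono hpos).add ((contDiffOn_id.pow m).mul (((contDiffOn_id.log
      fun v hv => ne_of_gt hv).mul (hG.mono hpos)).add (hE.mono hpos)))
  · intro a ha
    obtain ⟨A, B, hA, hB, -, -, h⟩ :=
      exists_iteratedDeriv_eq_pow_mul_log hU hU0 hF hG hE hψ' (show a ≤ m by omega)
    obtain ⟨k, hk⟩ : ∃ k, m - a = k + 1 := ⟨m - a - 1, by omega⟩
    have hc := hcont k _ A B (contDiffOn_iteratedDeriv_of_isOpen hU hF a) hA hB
    have h0 := (hc.continuousAt (hU.mem_nhds (hU0 self_mem_Ici))).tendsto.mono_left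
      (nhdsWithin_le_nhds (s := Ioi (0 : ℝ)))
    refine ⟨_, h0.congr' ?_⟩
    filter_upwards [self_mem_nhdsWithin] with v hv
    rw [h v hv, hk]; ring
  · rw [hψ 0 le_rfl, zero_pow (by omega)]; ring
  · obtain ⟨A, B, hA, hB, hA0, hB0, h⟩ :=
      exists_iteratedDeriv_eq_pow_mul_log hU hU0 hF hG hE hψ' le_rfl
    simp only [Nat.descFactorial_self, Nat.sub_self, pow_zero, one_mul] at hA0 hB0 h
    have hFm := contDiffOn_iteratedDeriv_of_isOpen hU hF m
    obtain ⟨K₁, hK₁, h₁⟩ := exists_abs_sub_le_of_contDiffOn hU hU0 hFm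
    obtain ⟨K₂, hK₂, h₂⟩ := exists_abs_sub_le_of_contDiffOn hU hU0 hA
    obtain ⟨K₃, hK₃, h₃⟩ := exists_abs_sub_le_of_contDiffOn hU hU0 hB
    refine ⟨K₁ + 2 * K₂ + K₃, by positivity, fun v hv => ?_⟩
    have hvI : v ∈ Icc (0 : ℝ) 1 := ⟨hv.1.le, hv.2⟩
    obtain ⟨f1, f2, f3⟩ := h₁ v hvI
    obtain ⟨a1, a2, a3⟩ := h₂ v hvI
    obtain ⟨b1, b2, b3⟩ := h₃ v hvI
    have hv0 : 0 < v := hv.1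
    set l := Real.log v with hl
    have hl1 : |l| ≤ 1 + l ^ 2 := by
      rw [abs_le]; constructor <;> nlinarith [sq_nonneg (l - 1), sq_nonneg (l + 1)]
    have hl2 : 1 ≤ 1 + l ^ 2 := by nlinarith
    have e1 : K₁ * v ≤ K₁ * v * (1 + l ^ 2) := le_mul_of_one_le_right (by positivity) hl2
    have e2 : K₂ * v ≤ K₂ * v * (1 + l ^ 2) := le_mul_of_one_le_right (by positivity) hl2
    have e3 : K₃ * v ≤ K₃ * v * (1 + l ^ 2) := le_mul_of_one_le_right (by positivity) hl2
    constructor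
    · have heq : iteratedDeriv m ψ v - 1 / 2 * (2 * m.factorial * G 0) * l
          - (iteratedDeriv m F 0 + logDerivCoef m m * G 0 + m.factorial * E 0) =
          (iteratedDeriv m F v - iteratedDeriv m F 0) + l * (A v - A 0) + (B v - B 0) := by
        rw [h v hv0, hA0, hB0]; ring
      rw [heq]
      refine (abs_add_three _ _ _).trans ?_
      rw [abs_mul]
      have : |l| * |A v - A 0| ≤ (1 + l ^ 2) * (K₂ * v) :=
        mul_le_mul hl1 a3 (abs_nonneg _) (by positivity)
      nlinarith
    · have hev : iteratedDeriv m ψ =ᶠ[nhds v]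
          fun v => iteratedDeriv m F v + (Real.log v * A v + B v) := by
        filter_upwards [Ioi_mem_nhds hv0] with w hw
        exact h w hw
      have hd := (hFm.hasDerivAt_of_isOpen hU (hpos hv0)).fun_add
        (((Real.hasDerivAt_log hv0.ne').fun_mul (hA.hasDerivAt_of_isOpen hU (hpos hv0))).fun_add
          (hB.hasDerivAt_of_isOpen hU (hpos hv0)))
      have heq : v * iteratedDeriv (m + 1) ψ v - 2 * m.factorial * G 0 / 2 =
          v * deriv (iteratedDeriv m F) v + (A v - A 0) + (v * (l * deriv A v)
            + v * deriv B v) := by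
        rw [iteratedDeriv_succ, hev.deriv_eq, hd.deriv, hA0]
        field_simp
        ring
      rw [heq]
      refine (abs_add_three _ _ _).trans ?_
      have t1 : |v * deriv (iteratedDeriv m F) v| ≤ v * K₁ := by
        rw [abs_mul, abs_of_pos hv0]; gcongr
      have t2 : |v * (l * deriv A v) + v * deriv B v| ≤ v * ((1 + l ^ 2) * K₂) + v * K₃ := by
        refine (abs_add_le _ _).trans ?_
        rw [abs_mul, abs_mul, abs_mul, abs_of_pos hv0]
        gcongr
      nlinarith

/-- The constant term `h` in the asymptotics of the singular solution. -/
noncomputable def singTrace (m : ℕ) (lam : ℝ) : ℝ :=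
  ∑ j ∈ Finset.range m,
      singCoef m lam j * iteratedDeriv m (fun v : ℝ => (v / (1 + v)) ^ j) 0
    + logDerivCoef m m * logConst m lam

theorem hasAsymptoticDataODE_waveSol {m : ℕ} (hm : 2 ≤ m) (lam c d : ℝ) :
    HasAsymptoticDataODE (2 * m) lam (waveSol m lam c d) c
      (2 * m.factorial * (c * logConst m lam)) (c * singTrace m lam + m.factorial * d) := by
  have hU : IsOpen (Ioi (-1 / 2 : ℝ)) := isOpen_Ioi
  have hU0 : Ici (0 : ℝ) ⊆ Ioi (-1 / 2) := fun v hv => by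
    have : (0 : ℝ) ≤ v := hv
    show (-1 / 2 : ℝ) < v
    linarith
  have hpos : ∀ v ∈ Ioi (-1 / 2 : ℝ), 0 < 1 + v := fun v hv => by
    have : (-1 / 2 : ℝ) < v := hv
    linarith
  have h1v : ContDiffOn ℝ (⊤ : ℕ∞) (fun v : ℝ => 1 + v) (Ioi (-1 / 2)) :=
    contDiffOn_const.add contDiffOn_id
  have hy : ContDiffOn ℝ (⊤ : ℕ∞) (fun v : ℝ => v / (1 + v)) (Ioi (-1 / 2)) :=
    contDiffOn_id.div h1v fun v hv => (hpos v hv).ne'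
  have hmaps : MapsTo (fun v : ℝ => v / (1 + v)) (Ioi (-1 / 2)) (Ioo (-1) 1) := fun v hv => by
    have h0 := hpos v hv
    have : (-1 / 2 : ℝ) < v := hv
    constructor
    · rw [lt_div_iff₀ h0]; linarith
    · rw [div_lt_one h0]; linarith
  have hα := (subExp_singCoef hm lam).shift m
  have hβ := (subExp_regCoef m lam).shift m
  set α := fun i => singCoef m lam (m + i) with hαdef
  set β := fun i => regCoef m lam (m + i) with hβdef
  have hw : ContDiffOn ℝ (⊤ : ℕ∞) (fun v : ℝ => ((1 + v) ^ m)⁻¹) (Ioi (-1 / 2)) :=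
    (h1v.pow m).inv fun v hv => (pow_pos (hpos v hv) m).ne'
  have hSα : ContDiffOn ℝ (⊤ : ℕ∞) (fun v : ℝ => powSum α (v / (1 + v))) (Ioi (-1 / 2)) :=
    (contDiffOn_powSum hα).comp hy hmaps
  have hSβ : ContDiffOn ℝ (⊤ : ℕ∞) (fun v : ℝ => powSum β (v / (1 + v))) (Ioi (-1 / 2)) :=
    (contDiffOn_powSum hβ).comp hy hmaps
  have hlog : ContDiffOn ℝ (⊤ : ℕ∞) (fun v : ℝ => Real.log (1 + v)) (Ioi (-1 / 2)) :=
    h1v.log fun v hv => (hpos v hv).ne'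
  have key := hasAsymptoticDataODE_of_eq hm hU hU0 (lam := lam) (ψ := waveSol m lam c d)
    (F := fun v => c * ∑ j ∈ Finset.range m, singCoef m lam j * (v / (1 + v)) ^ j)
    (G := fun v => c * logConst m lam * ((1 + v) ^ m)⁻¹ * powSum β (v / (1 + v)))
    (E := fun v => ((1 + v) ^ m)⁻¹ * (c * powSum α (v / (1 + v))
      + (d - c * logConst m lam * Real.log (1 + v)) * powSum β (v / (1 + v))))
    (contDiffOn_const.mul (ContDiffOn.sum fun j _ => contDiffOn_const.mul (hy.pow j)))
    ((contDiffOn_const.mul hw).mul hSβ)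
    (hw.mul ((contDiffOn_const.mul hSα).add
      ((contDiffOn_const.sub (contDiffOn_const.mul hlog)).mul hSβ)))
    ?_ (solvesWaveODE_waveSol hm lam c d)
  · have hα0 : powSum α 0 = 0 := by
      rw [powSum_zero, hαdef]; exact singCoef_self hm lam
    have hβ0 : powSum β 0 = 1 := by
      rw [powSum_zero, hβdef]; exact regCoef_self hm lam
    have hF0 : ∑ j ∈ Finset.range m, singCoef m lam j * (0 : ℝ) ^ j = 1 := by
      rw [Finset.sum_eq_single_of_mem 0 (Finset.mem_range.2 (by omega))
        (fun j _ hj => by simp [hj])]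
      simp [singCoef]
    have hFm : iteratedDeriv m (fun v : ℝ =>
        c * ∑ j ∈ Finset.range m, singCoef m lam j * (v / (1 + v)) ^ j) 0 =
        c * ∑ j ∈ Finset.range m,
          singCoef m lam j * iteratedDeriv m (fun v : ℝ => (v / (1 + v)) ^ j) 0 := by
      rw [iteratedDeriv_const_mul_field, iteratedDeriv_fun_sum]
      · simp only [iteratedDeriv_const_mul_field]
      · intro j _
        have h0 : Ioi (-1 / 2 : ℝ) ∈ nhds 0 := hU.mem_nhds (hU0 self_mem_Ici)
        exact ((contDiffOn_const.mul (hy.pow j)).contDiffAt h0).of_le (by exact_mod_cast le_top)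
    rw [hFm] at key
    simp only [zero_div, add_zero, one_pow, inv_one, mul_one, one_mul, Real.log_one, mul_zero,
      sub_zero, hα0, hβ0, hF0, zero_add] at key
    convert key using 1
    rw [singTrace]; ring
  · intro v hv
    have hv1 : 0 < 1 + v := by linarith
    have hyv : |v / (1 + v)| < 1 := by
      rw [abs_of_nonneg (by positivity), div_lt_one hv1]; linarith
    have hb : powSum (regCoef m lam) (v / (1 + v)) =
        (v / (1 + v)) ^ m * powSum β (v / (1 + v)) := by
      rw [powSum_split (subExp_regCoef m lam) m hyv, Finset.sum_eq_zero, zero_add]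
      intro j hj
      rw [regCoef_of_lt lam (Finset.mem_range.1 hj), zero_mul]
    rw [waveSol, ySol, powSum_split (subExp_singCoef hm lam) m hyv, hb]
    rcases hv.eq_or_lt with rfl | hv
    · simp [show m ≠ 0 by omega]
    · rw [Real.log_div hv.ne' hv1.ne', div_pow, div_eq_mul_inv (v ^ m)]
      ring

/-- The first-order quantity entering the energy, in the variable `z = √v`. -/
noncomputable def energyFlux (m : ℕ) (ψ : ℝ → ℝ) (z : ℝ) : ℝ :=
  z ^ 2 * (1 + z ^ 2) * deriv ψ (z ^ 2) - (m - 1 / 2) / 2 * (1 - z ^ 2) * ψ (z ^ 2)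

/-- The energy density of the wave ODE, in the variable `z = √v`. -/
noncomputable def energyDensity (m : ℕ) (lam : ℝ) (ψ : ℝ → ℝ) (z : ℝ) : ℝ :=
  energyFlux m ψ z ^ 2 + (lam ^ 2 + (m - 1 / 2 : ℝ) ^ 2) * z ^ 2 * ψ (z ^ 2) ^ 2

/-- The logarithm of the weight used in the energy estimate. -/
noncomputable def energyExponent (m : ℕ) (s z : ℝ) : ℝ :=
  (2 * m - 1) * Real.log (1 + z ^ 2) - (2 * m + 1) * Real.log z + s * (z - z⁻¹)

/-- The weighted energy of the wave ODE, in the variable `z = √v`. -/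
noncomputable def weightedEnergy (m : ℕ) (lam s : ℝ) (ψ : ℝ → ℝ) (z : ℝ) : ℝ :=
  Real.exp (energyExponent m s z) * energyDensity m lam ψ z

theorem energyDensity_nonneg (m : ℕ) (lam : ℝ) (ψ : ℝ → ℝ) (z : ℝ) :
    0 ≤ energyDensity m lam ψ z := by
  unfold energyDensity; positivity

theorem hasDerivAt_energyExponent (m : ℕ) (s : ℝ) {z : ℝ} (hz : 0 < z) :
    HasDerivAt (energyExponent m s)
      ((2 * m - 1) * (2 * z / (1 + z ^ 2)) - (2 * m + 1) * z⁻¹ + s * (1 + (z ^ 2)⁻¹)) z := by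
  unfold energyExponent
  have h1 : HasDerivAt (fun z : ℝ => 1 + z ^ 2) (2 * z) z := by
    simpa using (hasDerivAt_pow 2 z).const_add 1
  have h2 := (h1.log (by positivity)).const_mul (2 * m - 1 : ℝ)
  have h3 := (Real.hasDerivAt_log hz.ne').const_mul (2 * m + 1 : ℝ)
  have h4 := ((hasDerivAt_id z).sub (hasDerivAt_inv hz.ne')).const_mul s
  refine ((h2.sub h3).add h4).congr_deriv ?_
  ring

theorem hasDerivAt_weightedEnergy {m : ℕ} {lam s : ℝ} {ψ : ℝ → ℝ}
    (hψ : ContDiffOn ℝ (⊤ : ℕ∞) ψ (Ioi 0)) (hode : SolvesWaveODE (2 * m) lam ψ) {z : ℝ}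
    (hz : 0 < z) :
    HasDerivAt (weightedEnergy m lam s ψ)
      (Real.exp (energyExponent m s z) * ((1 + z ^ 2) / z ^ 2 *
        (((m - 1 / 2 : ℝ) ^ 2 + (m - 1 / 2)) * (energyFlux m ψ z * (z * ψ (z ^ 2)))
          + s * energyDensity m lam ψ z))) z := by
  have hv : 0 < z ^ 2 := by positivity
  have hsq : HasDerivAt (fun z : ℝ => z ^ 2) (2 * z) z := by simpa using hasDerivAt_pow 2 z
  have hP : HasDerivAt (fun z => ψ (z ^ 2)) (deriv ψ (z ^ 2) * (2 * z)) z :=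
    HasDerivAt.comp (h := fun z : ℝ => z ^ 2) z
      (hψ.hasDerivAt_of_isOpen isOpen_Ioi (mem_Ioi.2 hv)) hsq
  have hd : ContDiffOn ℝ (⊤ : ℕ∞) (deriv ψ) (Ioi 0) :=
    ((contDiffOn_infty_iff_deriv_of_isOpen isOpen_Ioi).1 hψ).2
  have hQ : HasDerivAt (fun z => deriv ψ (z ^ 2)) (deriv (deriv ψ) (z ^ 2) * (2 * z)) z :=
    HasDerivAt.comp (h := fun z : ℝ => z ^ 2) z
      (hd.hasDerivAt_of_isOpen isOpen_Ioi (mem_Ioi.2 hv)) hsq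
  have h := hode (z ^ 2) hv
  have h2 : iteratedDeriv 2 ψ (z ^ 2) = deriv (deriv ψ) (z ^ 2) := by
    rw [iteratedDeriv_succ, iteratedDeriv_one]
  rw [h2] at h
  push_cast at h
  have hR : deriv (deriv ψ) (z ^ 2) =
      -((1 - (2 * m : ℝ) / 2) * (z ^ 2 + 1) ^ 2 * deriv ψ (z ^ 2)
      + (2 * m : ℝ) * z ^ 2 * (z ^ 2 + 1) * deriv ψ (z ^ 2)
      + lam ^ 2 * ψ (z ^ 2)) / (z ^ 2 * (z ^ 2 + 1) ^ 2) := by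
    rw [eq_div_iff (by positivity)]
    linarith
  rw [hR] at hQ
  have h1 : HasDerivAt (fun z : ℝ => 1 + z ^ 2) (2 * z) z := hsq.const_add 1
  have h3 : HasDerivAt (fun z : ℝ => 1 - z ^ 2) (-(2 * z)) z := hsq.const_sub 1
  have hX := ((hsq.mul h1).mul hQ).sub ((h3.const_mul ((m - 1 / 2 : ℝ) / 2)).mul hP)
  have hN := (hX.pow 2).add ((hsq.const_mul (lam ^ 2 + (m - 1 / 2 : ℝ) ^ 2)).mul (hP.pow 2))
  refine ((hasDerivAt_energyExponent m s hz).exp.mul hN).congr_deriv ?_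
  simp only [Pi.mul_apply, Pi.sub_apply, Pi.add_apply, Pi.pow_apply,
    energyDensity, energyFlux]
  field_simp
  ring

theorem abs_energyFlux_mul_le {m : ℕ} (hm : 2 ≤ m) (lam : ℝ) (ψ : ℝ → ℝ) (z : ℝ) :
    2 * Real.sqrt (1 + lam ^ 2) * |energyFlux m ψ z * (z * ψ (z ^ 2))|
      ≤ energyDensity m lam ψ z := by
  have hm' : (2 : ℝ) ≤ m := by exact_mod_cast hm
  set L := Real.sqrt (1 + lam ^ 2)
  have hL : L ^ 2 = 1 + lam ^ 2 := Real.sq_sqrt (by positivity)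
  have hL0 : 0 ≤ L := Real.sqrt_nonneg _
  rw [show 2 * L * |energyFlux m ψ z * (z * ψ (z ^ 2))| =
    2 * |energyFlux m ψ z| * (L * |z * ψ (z ^ 2)|) by rw [abs_mul]; ring]
  refine (two_mul_le_add_sq _ _).trans ?_
  rw [mul_pow, sq_abs, sq_abs, hL]
  unfold energyDensity
  have : (1 + lam ^ 2) * (z * ψ (z ^ 2)) ^ 2 ≤
      (lam ^ 2 + (m - 1 / 2 : ℝ) ^ 2) * (z * ψ (z ^ 2)) ^ 2 :=
    mul_le_mul_of_nonneg_right (by nlinarith) (sq_nonneg _)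
  nlinarith

theorem antitoneOn_weightedEnergy {m : ℕ} (hm : 2 ≤ m) {lam s : ℝ} {ψ : ℝ → ℝ}
    (hψ : ContDiffOn ℝ (⊤ : ℕ∞) ψ (Ioi 0)) (hode : SolvesWaveODE (2 * m) lam ψ)
    (hs : 2 * Real.sqrt (1 + lam ^ 2) * s = -((m - 1 / 2 : ℝ) ^ 2 + (m - 1 / 2))) :
    AntitoneOn (weightedEnergy m lam s ψ) (Ioi 0) := by
  have hm' : (2 : ℝ) ≤ m := by exact_mod_cast hm
  refine antitoneOn_of_hasDerivWithinAt_nonpos (convex_Ioi 0)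
    (fun z hz => (hasDerivAt_weightedEnergy hψ hode hz).continuousAt.continuousWithinAt)
    (fun z hz => (hasDerivAt_weightedEnergy hψ hode
      (by simpa using hz)).hasDerivWithinAt) ?_
  intro z hz
  have h1 := abs_energyFlux_mul_le hm lam ψ z
  set L := Real.sqrt (1 + lam ^ 2)
  have hL : 0 < L := Real.sqrt_pos.2 (by positivity)
  refine mul_nonpos_of_nonneg_of_nonpos (Real.exp_pos _).le
    (mul_nonpos_of_nonneg_of_nonpos (by positivity) ?_)
  have h2 : (m - 1 / 2 : ℝ) ^ 2 + (m - 1 / 2) = 2 * L * -s := by linarith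
  have hs0 : 0 ≤ -s := by
    by_contra h
    have : 2 * L * -s < 0 := mul_neg_of_pos_of_neg (by positivity) (by linarith)
    nlinarith
  rw [h2]
  have h3 := mul_le_mul_of_nonneg_left (le_abs_self (energyFlux m ψ z * (z * ψ (z ^ 2))))
    (show 0 ≤ 2 * L * -s by positivity)
  nlinarith

theorem monotoneOn_weightedEnergy {m : ℕ} (hm : 2 ≤ m) {lam s : ℝ} {ψ : ℝ → ℝ}
    (hψ : ContDiffOn ℝ (⊤ : ℕ∞) ψ (Ioi 0)) (hode : SolvesWaveODE (2 * m) lam ψ)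
    (hs : 2 * Real.sqrt (1 + lam ^ 2) * s = (m - 1 / 2 : ℝ) ^ 2 + (m - 1 / 2)) :
    MonotoneOn (weightedEnergy m lam s ψ) (Ioi 0) := by
  have hm' : (2 : ℝ) ≤ m := by exact_mod_cast hm
  refine monotoneOn_of_hasDerivWithinAt_nonneg (convex_Ioi 0)
    (fun z hz => (hasDerivAt_weightedEnergy hψ hode hz).continuousAt.continuousWithinAt)
    (fun z hz => (hasDerivAt_weightedEnergy hψ hode
      (by simpa using hz)).hasDerivWithinAt) ?_
  intro z hz
  have h1 := abs_energyFlux_mul_le hm lam ψ z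
  set L := Real.sqrt (1 + lam ^ 2)
  have hL : 0 < L := Real.sqrt_pos.2 (by positivity)
  refine mul_nonneg (Real.exp_pos _).le (mul_nonneg (by positivity) ?_)
  have hs0 : 0 ≤ s := by
    by_contra h
    have : 2 * L * s < 0 := mul_neg_of_pos_of_neg (by positivity) (by linarith)
    nlinarith
  rw [← hs]
  have h3 := mul_le_mul_of_nonneg_left (neg_abs_le (energyFlux m ψ z * (z * ψ (z ^ 2))))
    (show 0 ≤ 2 * L * s by positivity)
  nlinarith

theorem eq_zero_of_cauchyData_eq_zero {m : ℕ} (hm : 2 ≤ m) {lam : ℝ} {ψ : ℝ → ℝ}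
    (hψ : ContDiffOn ℝ (⊤ : ℕ∞) ψ (Ioi 0)) (hode : SolvesWaveODE (2 * m) lam ψ)
    (h0 : ψ 1 = 0) (h1 : deriv ψ 1 = 0) {v : ℝ} (hv : 0 < v) : ψ v = 0 := by
  have hm' : (2 : ℝ) ≤ m := by exact_mod_cast hm
  have hL : 0 < Real.sqrt (1 + lam ^ 2) := Real.sqrt_pos.2 (by positivity)
  have hE1 : ∀ s, weightedEnergy m lam s ψ 1 = 0 := by
    intro s; simp [weightedEnergy, energyDensity, energyFlux, h0, h1]
  have hz : 0 < Real.sqrt v := Real.sqrt_pos.2 hv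
  have key : ∃ s, weightedEnergy m lam s ψ (Real.sqrt v) ≤ 0 := by
    rcases le_total (Real.sqrt v) 1 with h | h
    · refine ⟨((m - 1 / 2 : ℝ) ^ 2 + (m - 1 / 2)) / (2 * Real.sqrt (1 + lam ^ 2)), ?_⟩
      rw [← hE1]
      exact monotoneOn_weightedEnergy hm hψ hode (by field_simp) hz (mem_Ioi.2 one_pos) h
    · refine ⟨-((m - 1 / 2 : ℝ) ^ 2 + (m - 1 / 2)) / (2 * Real.sqrt (1 + lam ^ 2)), ?_⟩
      rw [← hE1]
      exact antitoneOn_weightedEnergy hm hψ hode (by field_simp) (mem_Ioi.2 one_pos) hz h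
  obtain ⟨s, hs⟩ := key
  have h2 : energyDensity m lam ψ (Real.sqrt v) ≤ 0 :=
    nonpos_of_mul_nonpos_right hs (Real.exp_pos _)
  unfold energyDensity at h2
  rw [Real.sq_sqrt hv.le] at h2
  have h3 : 0 < (lam ^ 2 + (m - 1 / 2 : ℝ) ^ 2) * v :=
    mul_pos (by nlinarith [sq_nonneg lam]) hv
  by_contra h
  nlinarith [sq_nonneg (energyFlux m ψ (Real.sqrt v)), mul_pos h3 (sq_pos_of_ne_zero h)]

/-- The Cauchy data at `v = 1` are controlled by the Cauchy data at `v = δ² / (1 + λ²)`. -/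
theorem exists_cauchyData_one_le {m : ℕ} (hm : 2 ≤ m) {δ : ℝ} (hδ : 0 < δ) (hδ1 : δ ≤ 1) :
    ∃ C > 0, ∀ lam : ℝ, ∀ ψ : ℝ → ℝ, ContDiffOn ℝ (⊤ : ℕ∞) ψ (Ioi 0) →
      SolvesWaveODE (2 * m) lam ψ → ∀ B : ℝ,
      |ψ (δ ^ 2 / (1 + lam ^ 2))| ≤ B →
      |δ ^ 2 / (1 + lam ^ 2) * deriv ψ (δ ^ 2 / (1 + lam ^ 2))| ≤ B →
      deriv ψ 1 ^ 2 + (1 + lam ^ 2) * ψ 1 ^ 2 ≤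
        C * Real.sqrt (1 + lam ^ 2) ^ (2 * m + 1) * B ^ 2 := by
  have hm' : (2 : ℝ) ≤ m := by exact_mod_cast hm
  set κ : ℝ := ((m - 1 / 2 : ℝ) ^ 2 + (m - 1 / 2)) / 2 with hκ
  have hκ0 : 0 < κ := by rw [hκ]; nlinarith
  refine ⟨Real.exp ((2 * m - 1) * Real.log 2 + κ / δ) * (δ ^ (2 * m + 1))⁻¹ *
    ((2 + m) ^ 2 + (1 + m ^ 2)), by positivity, ?_⟩
  intro lam ψ hψ hode B hB1 hB2
  set L := Real.sqrt (1 + lam ^ 2) with hLdef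
  have hL : L ^ 2 = 1 + lam ^ 2 := Real.sq_sqrt (by positivity)
  have hL1 : 1 ≤ L := Real.one_le_sqrt.2 (by nlinarith [sq_nonneg lam])
  have hL0 : 0 < L := by positivity
  set z := δ / L with hz
  have hz0 : 0 < z := by positivity
  have hz1 : z ≤ 1 := by rw [hz, div_le_one hL0]; linarith
  have hz2 : δ ^ 2 / (1 + lam ^ 2) = z ^ 2 := by rw [hz, div_pow, hL]
  rw [hz2] at hB1 hB2
  have hB0 : 0 ≤ B := (abs_nonneg _).trans hB1
  have hs : 2 * L * (-κ / L) = -((m - 1 / 2 : ℝ) ^ 2 + (m - 1 / 2)) := by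
    rw [hκ]; field_simp
  have hmono := antitoneOn_weightedEnergy hm hψ hode hs (mem_Ioi.2 hz0) (mem_Ioi.2 one_pos) hz1
  have hleft : deriv ψ 1 ^ 2 + (1 + lam ^ 2) * ψ 1 ^ 2 ≤ weightedEnergy m lam (-κ / L) ψ 1 := by
    have e1 : (1 : ℝ) ≤ Real.exp (energyExponent m (-κ / L) 1) := by
      rw [Real.one_le_exp_iff]
      simp only [energyExponent]
      norm_num
      have := Real.log_nonneg (one_le_two (α := ℝ))
      nlinarith
    have e2 : deriv ψ 1 ^ 2 + (1 + lam ^ 2) * ψ 1 ^ 2 ≤ energyDensity m lam ψ 1 := by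
      simp only [energyDensity, energyFlux]
      norm_num
      have : (1 + lam ^ 2) * ψ 1 ^ 2 ≤ (lam ^ 2 + (m - 1 / 2 : ℝ) ^ 2) * ψ 1 ^ 2 :=
        mul_le_mul_of_nonneg_right (by nlinarith) (sq_nonneg _)
      nlinarith [sq_nonneg (deriv ψ 1)]
    unfold weightedEnergy
    nlinarith [energyDensity_nonneg m lam ψ 1]
  have hN : energyDensity m lam ψ z ≤ ((2 + m) ^ 2 + (1 + m ^ 2)) * B ^ 2 := by
    have hzz : z ^ 2 ≤ 1 := pow_le_one₀ hz0.le hz1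
    have hX : |energyFlux m ψ z| ≤ (2 + m) * B := by
      unfold energyFlux
      have a1 : |(1 + z ^ 2) * (z ^ 2 * deriv ψ (z ^ 2))| ≤ 2 * B := by
        rw [abs_mul, abs_of_nonneg (by positivity)]
        gcongr; linarith
      have a2 : |(m - 1 / 2 : ℝ) / 2 * (1 - z ^ 2) * ψ (z ^ 2)| ≤ m * B := by
        rw [abs_mul, abs_of_nonneg (mul_nonneg (by linarith) (by linarith))]
        gcongr
        nlinarith [sq_nonneg z]
      calc _ = |(1 + z ^ 2) * (z ^ 2 * deriv ψ (z ^ 2)) -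
            (m - 1 / 2 : ℝ) / 2 * (1 - z ^ 2) * ψ (z ^ 2)| := by ring_nf
        _ ≤ _ := abs_sub _ _
        _ ≤ _ := by linarith
    have hX2 : energyFlux m ψ z ^ 2 ≤ ((2 + m) * B) ^ 2 := sq_le_sq' (abs_le.1 hX).1 (abs_le.1 hX).2
    have hP2 : ψ (z ^ 2) ^ 2 ≤ B ^ 2 := sq_le_sq' (abs_le.1 hB1).1 (abs_le.1 hB1).2
    have hc : (lam ^ 2 + (m - 1 / 2 : ℝ) ^ 2) * z ^ 2 ≤ 1 + m ^ 2 := by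
      have b1 : lam ^ 2 * z ^ 2 ≤ 1 := by
        have : L ^ 2 * z ^ 2 = δ ^ 2 := by rw [hz]; field_simp
        have := pow_le_one₀ hδ.le hδ1 (n := 2)
        nlinarith [sq_nonneg z]
      have b2 : (m - 1 / 2 : ℝ) ^ 2 * z ^ 2 ≤ m ^ 2 * 1 := by
        gcongr <;> linarith
      linarith
    unfold energyDensity
    calc _ ≤ ((2 + m) * B) ^ 2 + (1 + m ^ 2) * B ^ 2 := by gcongr
      _ = _ := by ring
  have hexp : Real.exp (energyExponent m (-κ / L) z) ≤
      Real.exp ((2 * m - 1) * Real.log 2 + κ / δ) * (δ ^ (2 * m + 1))⁻¹ * L ^ (2 * m + 1) := by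
    have e1 : (δ ^ (2 * m + 1))⁻¹ * L ^ (2 * m + 1) = Real.exp (-((2 * m + 1) * Real.log z)) := by
      rw [Real.exp_neg, ← div_eq_inv_mul, ← div_pow, mul_comm (2 * m + 1 : ℝ), Real.exp_mul,
        Real.exp_log hz0]
      rw [show (2 * m + 1 : ℝ) = ((2 * m + 1 : ℕ) : ℝ) by push_cast; ring, Real.rpow_natCast,
        ← inv_pow, hz, inv_div]
    rw [mul_assoc, e1, ← Real.exp_add, Real.exp_le_exp, energyExponent]
    have e2 : Real.log (1 + z ^ 2) ≤ Real.log 2 := by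
      apply Real.log_le_log (by positivity)
      have := pow_le_one₀ hz0.le hz1 (n := 2)
      linarith
    have e3 : -κ / L * (z - z⁻¹) ≤ κ / δ := by
      have : -κ / L * (z - z⁻¹) = κ / δ - κ / L * z := by rw [hz]; field_simp; ring
      rw [this]
      have : 0 ≤ κ / L * z := by positivity
      linarith
    have e4 := mul_le_mul_of_nonneg_left e2 (show (0 : ℝ) ≤ 2 * m - 1 by linarith)
    linarith
  calc _ ≤ _ := hleft
    _ ≤ _ := hmono
    _ ≤ (Real.exp ((2 * m - 1) * Real.log 2 + κ / δ) * (δ ^ (2 * m + 1))⁻¹ * L ^ (2 * m + 1)) *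
        (((2 + m) ^ 2 + (1 + m ^ 2)) * B ^ 2) := by
      unfold weightedEnergy
      exact mul_le_mul hexp hN (energyDensity_nonneg ..) (by positivity)
    _ = _ := by ring

theorem abs_powSum_le_two {a : ℕ → ℝ} {Q y : ℝ} (ha : ∀ j, |a j| ≤ Q ^ j) (hy : 0 ≤ y)
    (hQy : Q * y ≤ 1 / 2) (hQ : 0 ≤ Q) : |powSum a y| ≤ 2 := by
  rw [powSum, ← Real.norm_eq_abs]
  refine tsum_of_norm_bounded hasSum_geometric_two fun j => ?_
  rw [Real.norm_eq_abs, abs_mul, abs_of_nonneg (pow_nonneg hy j)]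
  calc |a j| * y ^ j ≤ Q ^ j * y ^ j := by gcongr; exact ha j
    _ = (Q * y) ^ j := (mul_pow _ _ _).symm
    _ ≤ (1 / 2) ^ j := by gcongr

theorem abs_powSum_add_mul_le {a : ℕ → ℝ} {Q y : ℝ} (m : ℕ) (ha : ∀ j, |a j| ≤ Q ^ j)
    (hy : 0 ≤ y) (hQy : Q * y ≤ 1 / 2) (hQ : 0 ≤ Q) :
    |powSum (fun j => (m + j : ℕ) * a j) y| ≤ 2 * m + 2 := by
  have h1 := (hasSum_geometric_two).mul_left (m : ℝ)
  have h2 := hasSum_coe_mul_geometric_of_norm_lt_one (r := (1 / 2 : ℝ)) (by norm_num)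
  have h3 := h1.add h2
  rw [show (m : ℝ) * 2 + 1 / 2 / (1 - 1 / 2) ^ 2 = 2 * m + 2 by ring] at h3
  rw [powSum, ← Real.norm_eq_abs]
  refine tsum_of_norm_bounded h3 fun j => ?_
  rw [Real.norm_eq_abs, abs_mul, abs_mul, abs_of_nonneg (pow_nonneg hy j), Nat.abs_cast]
  calc ((m + j : ℕ) : ℝ) * |a j| * y ^ j ≤ ((m + j : ℕ) : ℝ) * Q ^ j * y ^ j := by
        gcongr; exact ha j
    _ = ((m + j : ℕ) : ℝ) * (Q * y) ^ j := by rw [mul_pow]; ring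
    _ ≤ ((m + j : ℕ) : ℝ) * (1 / 2) ^ j := by gcongr
    _ = _ := by push_cast; ring

set_option maxHeartbeats 800000 in
/-- Bounds for the explicit solutions at the scale `v = δ² / (1 + λ²)`. -/
theorem exists_cauchyData_waveSol_le {m : ℕ} (hm : 2 ≤ m) :
    ∃ δ : ℝ, 0 < δ ∧ δ ≤ 1 ∧ ∃ C > 0, ∀ lam c d : ℝ,
      |waveSol m lam c d (δ ^ 2 / (1 + lam ^ 2))| ≤ C * (|c| +
        |d - c * logConst m lam * Real.log (1 + lam ^ 2)| / (1 + lam ^ 2) ^ m) ∧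
      |δ ^ 2 / (1 + lam ^ 2) * deriv (waveSol m lam c d) (δ ^ 2 / (1 + lam ^ 2))| ≤
        C * (|c| +
        |d - c * logConst m lam * Real.log (1 + lam ^ 2)| / (1 + lam ^ 2) ^ m) := by
  set S := stepBound m with hS
  have hS1 : 1 ≤ S := one_le_stepBound hm
  have hS0 : 0 < S := by linarith
  set δ : ℝ := 1 / (3 * S) with hδ
  have hδ0 : 0 < δ := by positivity
  have hδ1 : δ ≤ 1 := by rw [hδ, div_le_one (by positivity)]; linarith
  have hδS : 3 * S ^ 2 * δ ^ 2 ≤ 1 / 2 := by rw [hδ]; field_simp; norm_num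
  set Λ : ℝ := -Real.log (δ ^ 2 / 2) with hΛ
  have hδ21 : δ ^ 2 ≤ 1 := pow_le_one₀ hδ0.le hδ1
  have hΛ0 : 0 ≤ Λ := by
    rw [hΛ, neg_nonneg]
    exact Real.log_nonpos (by positivity) (by linarith)
  refine ⟨δ, hδ0, hδ1, 2 + 2 * S ^ m + (S ^ m * Λ + 1) * (2 * m + 2), by positivity, ?_⟩
  intro lam c d
  set A := 1 + lam ^ 2 with hA
  have hA1 : 1 ≤ A := by rw [hA]; nlinarith [sq_nonneg lam]
  have hA0 : 0 < A := by linarith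
  set v := δ ^ 2 / A with hv
  have hv0 : 0 < v := by positivity
  have hv1 : v ≤ 1 := by rw [hv, div_le_one hA0]; linarith
  set y := v / (1 + v) with hy
  have hyI : y ∈ Ioo (0 : ℝ) 1 := div_one_add_mem_Ioo hv0
  have hy1 : |y| < 1 := by rw [abs_of_pos hyI.1]; exact hyI.2
  have hy0 : 0 ≤ y := hyI.1.le
  have hyv : y ≤ v := by rw [hy, div_le_iff₀ (by positivity)]; nlinarith
  set Q := 3 * S ^ 2 * A with hQ
  have hQ0 : 0 ≤ Q := by positivity
  have hQy : Q * y ≤ 1 / 2 :=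
    calc Q * y ≤ Q * v := by gcongr
      _ = 3 * S ^ 2 * δ ^ 2 := by rw [hQ, hv]; field_simp
      _ ≤ _ := hδS
  have hSA : S * A ≤ Q := by
    rw [hQ]; gcongr; nlinarith
  have hreg : ∀ i, |regCoef m lam (m + i)| ≤ Q ^ i := fun i =>
    (abs_regCoef_add_le hm lam i).trans (by gcongr)
  have hsing : ∀ i, |singCoef m lam i| ≤ Q ^ i := abs_singCoef_le hm lam
  have hym : y ^ m ≤ 1 / A ^ m := by
    rw [← one_div_pow]
    gcongr
    exact hyv.trans (by rw [hv]; gcongr)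
  have b1 : |powSum (singCoef m lam) y| ≤ 2 := abs_powSum_le_two hsing hy0 hQy hQ0
  have b2 : |y * powSum (derivSeq (singCoef m lam)) y| ≤ 2 * (0 : ℕ) + 2 := by
    rw [mul_powSum_derivSeq (subExp_singCoef hm lam) hy1]
    have e : eulerSeq (singCoef m lam) = fun j => ((0 + j : ℕ) : ℝ) * singCoef m lam j := by
      ext j; simp [eulerSeq]
    rw [e]
    exact abs_powSum_add_mul_le 0 hsing hy0 hQy hQ0
  have b3 : |powSum (regCoef m lam) y| ≤ 2 / A ^ m := by
    rw [powSum_split (subExp_regCoef m lam) m hy1, Finset.sum_eq_zero, zero_add, abs_mul,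
      abs_of_nonneg (by positivity)]
    · calc _ ≤ 1 / A ^ m * 2 := by gcongr; exact abs_powSum_le_two hreg hy0 hQy hQ0
        _ = _ := by ring
    · intro j hj; rw [regCoef_of_lt lam (Finset.mem_range.1 hj), zero_mul]
  have b4 : |y * powSum (derivSeq (regCoef m lam)) y| ≤ (2 * m + 2) / A ^ m := by
    rw [mul_powSum_derivSeq (subExp_regCoef m lam) hy1,
      powSum_split (subExp_regCoef m lam).eulerSeq m hy1, Finset.sum_eq_zero, zero_add, abs_mul,
      abs_of_nonneg (by positivity)]
    · calc _ ≤ 1 / A ^ m * (2 * m + 2) := by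
            gcongr; exact abs_powSum_add_mul_le m hreg hy0 hQy hQ0
        _ = _ := by ring
    · intro j hj; rw [eulerSeq, regCoef_of_lt lam (Finset.mem_range.1 hj), mul_zero, zero_mul]
  have b5 : |logConst m lam| ≤ S ^ m * A ^ m := by
    rw [← mul_pow]; exact abs_logConst_le hm lam
  have b6 : |Real.log y + Real.log A| ≤ Λ := by
    rw [← Real.log_mul hyI.1.ne' hA0.ne']
    have e : y * A = δ ^ 2 / (1 + v) := by rw [hy, div_mul_eq_mul_div, hv]; field_simp
    rw [e, abs_le, hΛ, neg_neg]
    constructor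
    · apply Real.log_le_log (by positivity)
      gcongr; linarith
    · have : Real.log (δ ^ 2 / (1 + v)) ≤ 0 :=
        Real.log_nonpos (by positivity) (by rw [div_le_one (by positivity)]; linarith)
      linarith
  set ℓ := logConst m lam with hℓ
  set D := d - c * ℓ * Real.log A with hD
  have hc : c * ℓ * Real.log y + d = c * ℓ * (Real.log y + Real.log A) + D := by rw [hD]; ring
  have b7 : |c * ℓ * Real.log y + d| ≤ |c| * (S ^ m * A ^ m) * Λ + |D| := by
    rw [hc]
    refine (abs_add_le _ _).trans ?_
    rw [abs_mul, abs_mul]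
    gcongr
  have hD0 : 0 ≤ |D| / A ^ m := by positivity
  have hc0 := abs_nonneg c
  have b8 : ∀ K : ℝ, 0 ≤ K → ∀ x, |x| ≤ K / A ^ m →
      |(c * ℓ * Real.log y + d) * x| ≤ K * (S ^ m * Λ + 1) * (|c| + |D| / A ^ m) := by
    intro K hK x hx
    rw [abs_mul]
    calc _ ≤ (|c| * (S ^ m * A ^ m) * Λ + |D|) * (K / A ^ m) := by gcongr
      _ = K * (S ^ m * Λ * |c| + |D| / A ^ m) := by field_simp
      _ ≤ K * ((S ^ m * Λ + 1) * (|c| + |D| / A ^ m)) := by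
        gcongr
        have : 0 ≤ S ^ m * Λ := by positivity
        nlinarith
      _ = _ := by ring
  constructor
  · change |ySol m lam c d y| ≤ _
    unfold ySol
    refine (abs_add_le _ _).trans ?_
    have h1 : |c * powSum (singCoef m lam) y| ≤ |c| * 2 := by rw [abs_mul]; gcongr
    have h2 := b8 2 (by norm_num) _ b3
    have h3 : 2 * (S ^ m * Λ + 1) * (|c| + |D| / A ^ m) ≤
        (2 * m + 2) * (S ^ m * Λ + 1) * (|c| + |D| / A ^ m) := by
      gcongr; linarith [show (0 : ℝ) ≤ m by positivity]
    have h4 : 0 ≤ 2 * S ^ m * (|c| + |D| / A ^ m) := by positivity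
    calc _ ≤ |c| * 2 + 2 * (S ^ m * Λ + 1) * (|c| + |D| / A ^ m) := add_le_add h1 h2
      _ ≤ 2 * (|c| + |D| / A ^ m) + 2 * S ^ m * (|c| + |D| / A ^ m) +
          (2 * m + 2) * (S ^ m * Λ + 1) * (|c| + |D| / A ^ m) := by linarith
      _ = _ := by ring
  · rw [(hasDerivAt_waveSol hm lam c d hv0).deriv]
    have e : v * (ySolDeriv m lam c d (v / (1 + v)) * ((1 + v) ^ 2)⁻¹) =
        (1 + v)⁻¹ * (y * ySolDeriv m lam c d y) := by rw [hy]; field_simp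
    rw [e, abs_mul, abs_of_nonneg (by positivity)]
    have hle : (1 + v)⁻¹ ≤ 1 := inv_le_one_of_one_le₀ (by linarith)
    refine (mul_le_of_le_one_left (abs_nonneg _) hle).trans ?_
    have e2 : y * ySolDeriv m lam c d y = c * (y * powSum (derivSeq (singCoef m lam)) y) +
        (c * ℓ * powSum (regCoef m lam) y +
          (c * ℓ * Real.log y + d) * (y * powSum (derivSeq (regCoef m lam)) y)) := by
      have := hyI.1.ne'
      unfold ySolDeriv
      rw [← hℓ]
      field_simp
    rw [e2]
    have h1 : |c * (y * powSum (derivSeq (singCoef m lam)) y)| ≤ |c| * 2 := by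
      rw [abs_mul]; gcongr; simpa using b2
    have h2 : |c * ℓ * powSum (regCoef m lam) y| ≤ |c| * (2 * S ^ m) := by
      rw [abs_mul, abs_mul]
      calc _ ≤ |c| * (S ^ m * A ^ m) * (2 / A ^ m) := by gcongr
        _ = _ := by field_simp
    have h3 := b8 (2 * m + 2) (by positivity) _ b4
    have h4 : |c| * (2 * S ^ m) ≤ (|c| + |D| / A ^ m) * (2 * S ^ m) := by
      gcongr; linarith
    refine (abs_add_le _ _).trans ((add_le_add_right (abs_add_le _ _) _).trans ?_)
    calc _ ≤ |c| * 2 + (|c| * (2 * S ^ m) +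
          (2 * m + 2) * (S ^ m * Λ + 1) * (|c| + |D| / A ^ m)) :=
          add_le_add h1 (add_le_add h2 h3)
      _ ≤ (|c| + |D| / A ^ m) * 2 + ((|c| + |D| / A ^ m) * (2 * S ^ m) +
          (2 * m + 2) * (S ^ m * Λ + 1) * (|c| + |D| / A ^ m)) :=
          add_le_add (by linarith) (add_le_add h4 le_rfl)
      _ = _ := by ring

/-- The coefficient of `ψ'` when the wave ODE is solved for `ψ''`. -/
noncomputable def dampingCoef (m : ℕ) (v : ℝ) : ℝ := (m - 1) / v - 2 * m / (v + 1)

/-- The coefficient of `λ² ψ` when the wave ODE is solved for `ψ''`. -/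
noncomputable def potentialCoef (v : ℝ) : ℝ := -(v * (v + 1) ^ 2)⁻¹

theorem contDiffAt_dampingCoef (m : ℕ) (n : ℕ) : ContDiffAt ℝ n (dampingCoef m) 1 := by
  unfold dampingCoef
  exact (contDiffAt_const.div contDiffAt_id (by simp)).sub
    (contDiffAt_const.div (contDiffAt_id.add contDiffAt_const) (by norm_num))

theorem contDiffAt_potentialCoef (n : ℕ) : ContDiffAt ℝ n potentialCoef 1 := by
  unfold potentialCoef
  exact ((contDiffAt_id.mul ((contDiffAt_id.add contDiffAt_const).pow 2)).inv (by norm_num)).neg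

theorem iteratedDeriv_add_two_eq {m : ℕ} {lam : ℝ} {ψ : ℝ → ℝ}
    (hψ : ContDiffOn ℝ (⊤ : ℕ∞) ψ (Ioi 0)) (hode : SolvesWaveODE (2 * m) lam ψ) (a : ℕ) :
    iteratedDeriv (a + 2) ψ 1 =
      ∑ i ∈ Finset.range (a + 1), (a.choose i * iteratedDeriv i (dampingCoef m) 1 *
          iteratedDeriv (a - i + 1) ψ 1)
        + lam ^ 2 * ∑ i ∈ Finset.range (a + 1), (a.choose i * iteratedDeriv i potentialCoef 1 *
          iteratedDeriv (a - i) ψ 1) := by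
  have hn : Ioi (0 : ℝ) ∈ nhds (1 : ℝ) := Ioi_mem_nhds one_pos
  have hat : ContDiffAt ℝ a ψ 1 := (hψ.contDiffAt hn).of_le (by exact_mod_cast le_top)
  have hd : ContDiffOn ℝ (⊤ : ℕ∞) (deriv ψ) (Ioi 0) :=
    ((contDiffOn_infty_iff_deriv_of_isOpen isOpen_Ioi).1 hψ).2
  have hdat : ContDiffAt ℝ a (deriv ψ) 1 := (hd.contDiffAt hn).of_le (by exact_mod_cast le_top)
  have h2 : deriv (deriv ψ) =ᶠ[nhds 1]
      (dampingCoef m * deriv ψ) + fun v => lam ^ 2 * (potentialCoef * ψ) v := by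
    filter_upwards [hn] with v hv
    have hv0 : (0 : ℝ) < v := hv
    have h := hode v hv0
    rw [show iteratedDeriv 2 ψ v = deriv (deriv ψ) v by
      rw [iteratedDeriv_succ, iteratedDeriv_one]] at h
    push_cast at h
    simp only [Pi.add_apply, Pi.mul_apply, dampingCoef, potentialCoef]
    field_simp
    linear_combination h
  have h3 : ContDiffAt ℝ a (dampingCoef m * deriv ψ) 1 := (contDiffAt_dampingCoef m a).mul hdat
  have h4 : ContDiffAt ℝ a (fun v => lam ^ 2 * (potentialCoef * ψ) v) 1 :=
    contDiffAt_const.mul ((contDiffAt_potentialCoef a).mul hat)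
  rw [iteratedDeriv_succ', iteratedDeriv_succ', h2.iteratedDeriv_eq, iteratedDeriv_add h3 h4,
    iteratedDeriv_mul (contDiffAt_dampingCoef m a) hdat,
    iteratedDeriv_const_mul_field, iteratedDeriv_mul (contDiffAt_potentialCoef a) hat]
  simp only [iteratedDeriv_succ']

theorem exists_iteratedDeriv_one_le (m N : ℕ) :
    ∃ C ≥ 0, ∀ lam : ℝ, ∀ ψ : ℝ → ℝ, ContDiffOn ℝ (⊤ : ℕ∞) ψ (Ioi 0) →
      SolvesWaveODE (2 * m) lam ψ → ∀ a ≤ N + 1,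
      Real.sqrt (1 + lam ^ 2) * |iteratedDeriv a ψ 1| ≤ C * Real.sqrt (1 + lam ^ 2) ^ a *
        (|deriv ψ 1| + Real.sqrt (1 + lam ^ 2) * |ψ 1|) := by
  induction N with
  | zero =>
    refine ⟨1, zero_le_one, fun lam ψ _ _ a ha => ?_⟩
    have hL : 0 ≤ Real.sqrt (1 + lam ^ 2) := Real.sqrt_nonneg _
    interval_cases a
    · simp
    · simp only [iteratedDeriv_one, one_mul, pow_one]
      have := abs_nonneg (ψ 1)
      gcongr
      have : 0 ≤ Real.sqrt (1 + lam ^ 2) * |ψ 1| := by positivity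
      linarith
  | succ N ih =>
    obtain ⟨C, hC, h⟩ := ih
    set K1 := ∑ i ∈ Finset.range (N + 1), N.choose i * |iteratedDeriv i (dampingCoef m) 1|
    set K2 := ∑ i ∈ Finset.range (N + 1), N.choose i * |iteratedDeriv i potentialCoef 1|
    have hK1 : 0 ≤ K1 := Finset.sum_nonneg fun i _ => by positivity
    have hK2 : 0 ≤ K2 := Finset.sum_nonneg fun i _ => by positivity
    refine ⟨C + K1 * C + K2 * C, by positivity, fun lam ψ hψ hode a ha => ?_⟩
    specialize h lam ψ hψ hode
    have hLsq : Real.sqrt (1 + lam ^ 2) ^ 2 = 1 + lam ^ 2 := Real.sq_sqrt (by positivity)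
    have hL1 : 1 ≤ Real.sqrt (1 + lam ^ 2) := Real.one_le_sqrt.2 (by nlinarith [sq_nonneg lam])
    set L := Real.sqrt (1 + lam ^ 2)
    set E := |deriv ψ 1| + L * |ψ 1|
    have hL0 : 0 ≤ L := by linarith
    have hE : 0 ≤ E := by positivity
    rcases Nat.lt_or_ge (N + 1) a with h1 | h1
    · obtain rfl : a = N + 2 := by omega
      rw [iteratedDeriv_add_two_eq hψ hode]
      have s1 : L * |∑ i ∈ Finset.range (N + 1), (N.choose i * iteratedDeriv i (dampingCoef m) 1 *
          iteratedDeriv (N - i + 1) ψ 1)| ≤ K1 * (C * L ^ (N + 2) * E) := by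
        rw [Finset.sum_mul]
        refine (mul_le_mul_of_nonneg_left (Finset.abs_sum_le_sum_abs _ _) hL0).trans ?_
        rw [Finset.mul_sum]
        refine Finset.sum_le_sum fun i hi => ?_
        rw [abs_mul, abs_mul, Nat.abs_cast]
        calc _ = N.choose i * |iteratedDeriv i (dampingCoef m) 1| *
              (L * |iteratedDeriv (N - i + 1) ψ 1|) := by ring
          _ ≤ N.choose i * |iteratedDeriv i (dampingCoef m) 1| * (C * L ^ (N - i + 1) * E) :=
            mul_le_mul_of_nonneg_left (h _ (by omega)) (by positivity)
          _ ≤ _ := by gcongr <;> omega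
      have s2 : L * |∑ i ∈ Finset.range (N + 1), (N.choose i * iteratedDeriv i potentialCoef 1 *
          iteratedDeriv (N - i) ψ 1)| ≤ K2 * (C * L ^ N * E) := by
        rw [Finset.sum_mul]
        refine (mul_le_mul_of_nonneg_left (Finset.abs_sum_le_sum_abs _ _) hL0).trans ?_
        rw [Finset.mul_sum]
        refine Finset.sum_le_sum fun i hi => ?_
        rw [abs_mul, abs_mul, Nat.abs_cast]
        calc _ = N.choose i * |iteratedDeriv i potentialCoef 1| *
              (L * |iteratedDeriv (N - i) ψ 1|) := by ring
          _ ≤ N.choose i * |iteratedDeriv i potentialCoef 1| * (C * L ^ (N - i) * E) :=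
            mul_le_mul_of_nonneg_left (h _ (by omega)) (by positivity)
          _ ≤ _ := by gcongr; omega
      calc _ ≤ L * (|∑ i ∈ Finset.range (N + 1),
            (N.choose i * iteratedDeriv i (dampingCoef m) 1 * iteratedDeriv (N - i + 1) ψ 1)| +
            lam ^ 2 * |∑ i ∈ Finset.range (N + 1),
            (N.choose i * iteratedDeriv i potentialCoef 1 * iteratedDeriv (N - i) ψ 1)|) := by
            gcongr
            refine (abs_add_le _ _).trans_eq ?_
            rw [abs_mul, abs_of_nonneg (sq_nonneg lam)]
        _ ≤ K1 * (C * L ^ (N + 2) * E) + L ^ 2 * (K2 * (C * L ^ N * E)) := by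
            rw [mul_add, mul_left_comm]
            have : lam ^ 2 ≤ L ^ 2 := by linarith
            gcongr
        _ ≤ C * L ^ (N + 2) * E + (K1 * (C * L ^ (N + 2) * E) +
              L ^ 2 * (K2 * (C * L ^ N * E))) := le_add_of_nonneg_left (by positivity)
        _ = _ := by ring
    · refine (h a h1).trans ?_
      have : 0 ≤ K1 * C + K2 * C := by positivity
      gcongr
      linarith

theorem tendsto_self_mul_one_add_log_sq :
    Tendsto (fun v : ℝ => v * (1 + Real.log v ^ 2)) (nhdsWithin 0 (Ioi 0)) (nhds 0) := by
  have h1 : Tendsto (fun v : ℝ => v) (nhdsWithin 0 (Ioi 0)) (nhds 0) := nhdsWithin_le_nhds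
  have h2 := (tendsto_log_mul_rpow_nhdsGT_zero (r := 1 / 2) (by norm_num)).pow 2
  have h3 := h1.add h2
  simp only [zero_pow two_ne_zero, add_zero] at h3
  refine h3.congr' ?_
  filter_upwards [self_mem_nhdsWithin] with v hv
  have hv0 : (0 : ℝ) ≤ v := le_of_lt hv
  rw [mul_pow, ← Real.sqrt_eq_rpow, Real.sq_sqrt hv0]
  ring

theorem eq_zero_of_abs_le_mul_one_add_log_sq {x K : ℝ}
    (h : ∀ v ∈ Ioc (0 : ℝ) 1, |x| ≤ K * v * (1 + Real.log v ^ 2)) : x = 0 := by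
  have h1 := tendsto_self_mul_one_add_log_sq.const_mul K
  rw [mul_zero] at h1
  have h2 : |x| ≤ 0 := ge_of_tendsto h1 (by
    filter_upwards [Ioc_mem_nhdsGT one_pos] with v hv
    rw [← mul_assoc]
    exact h v hv)
  exact abs_nonpos_iff.1 h2

theorem HasAsymptoticDataODE.unique {n : ℕ} {lam : ℝ} {ψ₁ ψ₂ : ℝ → ℝ} {φ₁ φ₂ O₁ O₂ h₁ h₂ : ℝ}
    (H₁ : HasAsymptoticDataODE n lam ψ₁ φ₁ O₁ h₁) (H₂ : HasAsymptoticDataODE n lam ψ₂ φ₂ O₂ h₂)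
    (heq : ∀ v > 0, ψ₁ v = ψ₂ v) : φ₁ = φ₂ ∧ O₁ = O₂ ∧ h₁ = h₂ := by
  obtain ⟨hc₁, -, -, -, h0₁, K₁, -, hK₁⟩ := H₁
  obtain ⟨hc₂, -, -, -, h0₂, K₂, -, hK₂⟩ := H₂
  have hev : ∀ v > 0, ψ₁ =ᶠ[nhds v] ψ₂ := fun v hv => by
    filter_upwards [Ioi_mem_nhds hv] with w hw using heq w hw
  have hO : O₁ = O₂ := by
    have : O₁ / 2 - O₂ / 2 = 0 := by
      refine eq_zero_of_abs_le_mul_one_add_log_sq (K := K₁ + K₂) fun v hv => ?_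
      have e₁ := abs_le.1 (hK₁ v hv).2
      have e₂ := abs_le.1 (hK₂ v hv).2
      rw [(hev v hv.1).iteratedDeriv_eq] at e₁
      rw [abs_le]
      constructor <;> linarith [e₁.1, e₁.2, e₂.1, e₂.2]
    linarith
  subst hO
  refine ⟨?_, rfl, ?_⟩
  · have t₁ := (hc₁ 0 self_mem_Ici).mono_left (nhdsWithin_mono 0 Ioi_subset_Ici_self)
    have t₂ := (hc₂ 0 self_mem_Ici).mono_left (nhdsWithin_mono 0 Ioi_subset_Ici_self)
    rw [← h0₁, ← h0₂]
    refine tendsto_nhds_unique_of_eventuallyEq t₁ t₂ ?_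
    filter_upwards [self_mem_nhdsWithin] with v hv using heq v hv
  · have : h₁ - h₂ = 0 := by
      refine eq_zero_of_abs_le_mul_one_add_log_sq (K := K₁ + K₂) fun v hv => ?_
      have e₁ := abs_le.1 (hK₁ v hv).1
      have e₂ := abs_le.1 (hK₂ v hv).1
      rw [(hev v hv.1).iteratedDeriv_eq] at e₁
      rw [abs_le]
      constructor <;> linarith [e₁.1, e₁.2, e₂.1, e₂.2]
    linarith

theorem SolvesWaveODE.sub {n : ℕ} {lam : ℝ} {f g : ℝ → ℝ} (hf : ContDiffOn ℝ (⊤ : ℕ∞) f (Ioi 0))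
    (hg : ContDiffOn ℝ (⊤ : ℕ∞) g (Ioi 0)) (hf' : SolvesWaveODE n lam f)
    (hg' : SolvesWaveODE n lam g) : SolvesWaveODE n lam (f - g) := by
  intro v hv
  have af := hf.contDiffAt (Ioi_mem_nhds hv)
  have ag := hg.contDiffAt (Ioi_mem_nhds hv)
  have h2 : ((2 : ℕ) : WithTop ℕ∞) ≤ (⊤ : ℕ∞) := 
    WithTop.coe_le_coe.2 (le_top : ((2 : ℕ) : ℕ∞) ≤ ⊤)
  rw [iteratedDeriv_sub (af.of_le h2) (ag.of_le h2),
    deriv_sub (af.differentiableAt (by simp)) (ag.differentiableAt (by simp)), Pi.sub_apply]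
  linear_combination hf' v hv - hg' v hv

theorem deriv_waveSol_one {m : ℕ} (hm : 2 ≤ m) (lam c d : ℝ) :
    deriv (waveSol m lam c d) 1 = ySolDeriv m lam c d (1 / 2) / 4 := by
  rw [(hasDerivAt_waveSol hm lam c d one_pos).deriv]
  norm_num
  ring

/-- The Cauchy data at `v = 1` of the explicit solutions, as a linear map. -/
noncomputable def cauchyMap (m : ℕ) (lam : ℝ) : ℝ × ℝ →ₗ[ℝ] ℝ × ℝ where
  toFun p := (waveSol m lam p.1 p.2 1, ySolDeriv m lam p.1 p.2 (1 / 2) / 4)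
  map_add' p q := by
    simp only [waveSol, ySol, ySolDeriv, Prod.fst_add, Prod.snd_add, Prod.mk_add_mk, Prod.mk.injEq]
    constructor <;> ring
  map_smul' r p := by
    simp only [waveSol, ySol, ySolDeriv, Prod.smul_fst, Prod.smul_snd, Prod.smul_mk, smul_eq_mul,
      RingHom.id_apply, Prod.mk.injEq]
    constructor <;> ring

theorem cauchyMap_surjective {m : ℕ} (hm : 2 ≤ m) (lam : ℝ) :
    Function.Surjective (cauchyMap m lam) := by
  rw [← LinearMap.injective_iff_surjective, injective_iff_map_eq_zero]
  rintro ⟨c, d⟩ h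
  have h1 : waveSol m lam c d 1 = 0 := congrArg Prod.fst h
  have h2 : deriv (waveSol m lam c d) 1 = 0 :=
    (deriv_waveSol_one hm lam c d).trans (congrArg Prod.snd h)
  have H := hasAsymptoticDataODE_waveSol hm lam c d
  have hz : ∀ v > 0, waveSol m lam c d v = waveSol m lam 0 0 v := by
    intro v hv
    rw [eq_zero_of_cauchyData_eq_zero hm H.2.1 H.2.2.1 h1 h2 hv]
    simp [waveSol, ySol]
  obtain ⟨hc, -, hh⟩ := H.unique (hasAsymptoticDataODE_waveSol hm lam 0 0) hz
  subst hc
  have hd : d = 0 := by simpa [Nat.factorial_ne_zero] using hh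
  simp [hd]

theorem HasAsymptoticDataODE.exists_eq_waveSol {m : ℕ} (hm : 2 ≤ m) {lam : ℝ} {ψ : ℝ → ℝ}
    {φ₀ O h : ℝ} (H : HasAsymptoticDataODE (2 * m) lam ψ φ₀ O h) :
    ∃ d, (∀ v > 0, ψ v = waveSol m lam φ₀ d v) ∧
      O = 2 * m.factorial * (φ₀ * logConst m lam) ∧
      h = φ₀ * singTrace m lam + m.factorial * d := by
  obtain ⟨⟨c, d⟩, hcd⟩ := cauchyMap_surjective hm lam (ψ 1, deriv ψ 1)
  have h1 : waveSol m lam c d 1 = ψ 1 := congrArg Prod.fst hcd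
  have h2 : deriv (waveSol m lam c d) 1 = deriv ψ 1 :=
    (deriv_waveSol_one hm lam c d).trans (congrArg Prod.snd hcd)
  have W := hasAsymptoticDataODE_waveSol hm lam c d
  have hat := H.2.1.contDiffAt (Ioi_mem_nhds one_pos)
  have hat' := W.2.1.contDiffAt (Ioi_mem_nhds one_pos)
  have heq : ∀ v > 0, ψ v = waveSol m lam c d v := fun v hv =>
    sub_eq_zero.1 (eq_zero_of_cauchyData_eq_zero hm (H.2.1.sub W.2.1)
      (H.2.2.1.sub H.2.1 W.2.1 W.2.2.1) (sub_eq_zero.2 h1.symm) (by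
        rw [deriv_fun_sub (hat.differentiableAt (by simp)) (hat'.differentiableAt (by simp)), h2,
          sub_self]) hv)
  obtain ⟨rfl, hO, hh⟩ := H.unique W heq
  exact ⟨d, heq, hO, hh⟩

theorem exists_abs_singTrace_le {m : ℕ} (hm : 2 ≤ m) :
    ∃ C ≥ 0, ∀ lam : ℝ, |singTrace m lam| ≤ C * (1 + lam ^ 2) ^ m := by
  set S := stepBound m
  have hS1 : 1 ≤ S := one_le_stepBound hm
  refine ⟨∑ j ∈ Finset.range m, (3 * S ^ 2) ^ m *
    |iteratedDeriv m (fun v : ℝ => (v / (1 + v)) ^ j) 0| + logDerivCoef m m * S ^ m,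
    add_nonneg (Finset.sum_nonneg fun j _ => by positivity) (by positivity), fun lam => ?_⟩
  have hA1 : 1 ≤ 1 + lam ^ 2 := by nlinarith [sq_nonneg lam]
  have hQ1 : 1 ≤ 3 * S ^ 2 * (1 + lam ^ 2) := by
    have : 1 ≤ S ^ 2 := one_le_pow₀ hS1
    nlinarith
  unfold singTrace
  refine (abs_add_le _ _).trans ?_
  rw [add_mul, Finset.sum_mul]
  refine add_le_add ((Finset.abs_sum_le_sum_abs _ _).trans (Finset.sum_le_sum fun j hj => ?_)) ?_
  · rw [abs_mul]
    calc _ ≤ (3 * S ^ 2 * (1 + lam ^ 2)) ^ m *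
          |iteratedDeriv m (fun v : ℝ => (v / (1 + v)) ^ j) 0| := by
          gcongr
          refine (abs_singCoef_le hm lam j).trans ?_
          exact pow_le_pow_right₀ hQ1 (Finset.mem_range.1 hj).le
      _ = _ := by rw [mul_pow]; ring
  · rw [abs_mul, Nat.abs_cast, mul_assoc, ← mul_pow]
    exact mul_le_mul_of_nonneg_left (abs_logConst_le hm lam) (Nat.cast_nonneg _)

theorem exists_forward_estimate {m : ℕ} (hm : 2 ≤ m) :
    ∃ C > 0, ∀ lam : ℝ, ∀ ψ : ℝ → ℝ, ∀ φ₀ O h : ℝ, HasAsymptoticDataODE (2 * m) lam ψ φ₀ O h →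
      Real.sqrt (1 + lam ^ 2) * ∑ a ∈ Finset.range (m + 1), iteratedDeriv a ψ 1 ^ 2
          + (Real.sqrt (1 + lam ^ 2))⁻¹ * iteratedDeriv (m + 1) ψ 1 ^ 2
        ≤ C * ((h - O * Real.log (Real.sqrt (1 + lam ^ 2))) ^ 2
            + (1 + lam ^ 2) ^ (2 * m) * φ₀ ^ 2) := by
  obtain ⟨δ, hδ0, hδ1, C₁, hC₁, near⟩ := exists_cauchyData_waveSol_le hm
  obtain ⟨C₂, hC₂, energy⟩ := exists_cauchyData_one_le hm hδ0 hδ1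
  obtain ⟨C₃, hC₃, higher⟩ := exists_iteratedDeriv_one_le m m
  obtain ⟨C₄, hC₄, trace⟩ := exists_abs_singTrace_le hm
  refine ⟨(m + 2) * C₃ ^ 2 * (2 * C₂) * (2 * C₁ ^ 2 * (1 + C₄) ^ 2) + 1, by positivity, ?_⟩
  intro lam ψ φ₀ O h H
  obtain ⟨d, heq, hO, hh⟩ := H.exists_eq_waveSol hm
  have hLsq : Real.sqrt (1 + lam ^ 2) ^ 2 = 1 + lam ^ 2 := Real.sq_sqrt (by positivity)
  have hL1 : 1 ≤ Real.sqrt (1 + lam ^ 2) := Real.one_le_sqrt.2 (by nlinarith [sq_nonneg lam])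
  have hA0 : 0 < 1 + lam ^ 2 := by positivity
  have hlog : O * Real.log (Real.sqrt (1 + lam ^ 2)) =
      m.factorial * (φ₀ * logConst m lam * Real.log (1 + lam ^ 2)) := by
    rw [Real.log_sqrt hA0.le, hO]; ring
  set D := d - φ₀ * logConst m lam * Real.log (1 + lam ^ 2) with hD
  set 𝔥 := h - O * Real.log (Real.sqrt (1 + lam ^ 2)) with h𝔥
  have hren : m.factorial * D = 𝔥 - φ₀ * singTrace m lam := by
    rw [h𝔥, hlog, hh, hD]; ring
  obtain ⟨n1, n2⟩ := near lam φ₀ d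
  have hv0 : 0 < δ ^ 2 / (1 + lam ^ 2) := by positivity
  have hev : ψ =ᶠ[nhds (δ ^ 2 / (1 + lam ^ 2))] waveSol m lam φ₀ d := by
    filter_upwards [Ioi_mem_nhds hv0] with w hw using heq w hw
  rw [← heq _ hv0] at n1
  rw [← hev.deriv_eq] at n2
  have en := energy lam ψ H.2.1 H.2.2.1 _ n1 n2
  have hi := higher lam ψ H.2.1 H.2.2.1
  have tr := trace lam
  set A := 1 + lam ^ 2
  set L := Real.sqrt A
  have hL0 : 0 < L := by linarith
  set E := |deriv ψ 1| + L * |ψ 1| with hE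
  have hE2 : E ^ 2 ≤ 2 * (deriv ψ 1 ^ 2 + A * ψ 1 ^ 2) := by
    rw [hE, ← hLsq, ← sq_abs (deriv ψ 1), ← sq_abs (ψ 1)]
    nlinarith [sq_nonneg (|deriv ψ 1| - L * |ψ 1|)]
  have hDle : |D| ≤ |𝔥| + |φ₀| * (C₄ * A ^ m) := by
    have hf : (1 : ℝ) ≤ m.factorial := by exact_mod_cast m.factorial_pos
    calc |D| ≤ m.factorial * |D| := le_mul_of_one_le_left (abs_nonneg _) hf
      _ = |𝔥 - φ₀ * singTrace m lam| := by rw [← hren, abs_mul, Nat.abs_cast]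
      _ ≤ |𝔥| + |φ₀ * singTrace m lam| := abs_sub _ _
      _ ≤ _ := by rw [abs_mul]; gcongr
  have hB : (A ^ m * (C₁ * (|φ₀| + |D| / A ^ m))) ^ 2 ≤
      2 * C₁ ^ 2 * (1 + C₄) ^ 2 * (𝔥 ^ 2 + A ^ (2 * m) * φ₀ ^ 2) := by
    have e1 : A ^ m * (C₁ * (|φ₀| + |D| / A ^ m)) ≤ C₁ * ((1 + C₄) * (A ^ m * |φ₀| + |𝔥|)) := by
      calc _ = C₁ * (A ^ m * |φ₀| + |D|) := by field_simp
        _ ≤ C₁ * (A ^ m * |φ₀| + (|𝔥| + |φ₀| * (C₄ * A ^ m))) := by gcongr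
        _ ≤ _ := by
          gcongr
          have : 0 ≤ C₄ * |𝔥| := by positivity
          linarith
    calc _ ≤ (C₁ * ((1 + C₄) * (A ^ m * |φ₀| + |𝔥|))) ^ 2 := by gcongr
      _ = C₁ ^ 2 * (1 + C₄) ^ 2 * (A ^ m * |φ₀| + |𝔥|) ^ 2 := by ring
      _ ≤ C₁ ^ 2 * (1 + C₄) ^ 2 * (2 * ((A ^ m * |φ₀|) ^ 2 + |𝔥| ^ 2)) := by
          gcongr; exact add_sq_le
      _ = _ := by rw [mul_pow, sq_abs, sq_abs]; ring
  have hterm : ∀ a ≤ m, L ^ 2 * iteratedDeriv a ψ 1 ^ 2 ≤ C₃ ^ 2 * L ^ (2 * m) * E ^ 2 := by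
    intro a ha
    calc _ = (L * |iteratedDeriv a ψ 1|) ^ 2 := by rw [mul_pow, sq_abs]
      _ ≤ (C₃ * L ^ m * E) ^ 2 := by
          refine pow_le_pow_left₀ (by positivity) ((hi a (by omega)).trans ?_) 2
          gcongr
      _ = _ := by ring
  have hlast : iteratedDeriv (m + 1) ψ 1 ^ 2 ≤ C₃ ^ 2 * L ^ (2 * m) * E ^ 2 := by
    have e1 : |iteratedDeriv (m + 1) ψ 1| ≤ C₃ * L ^ m * E := by
      refine le_of_mul_le_mul_left ((hi (m + 1) le_rfl).trans_eq ?_) hL0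
      ring
    calc _ = |iteratedDeriv (m + 1) ψ 1| ^ 2 := (sq_abs _).symm
      _ ≤ (C₃ * L ^ m * E) ^ 2 := by gcongr
      _ = _ := by ring
  have hsum : L ^ 2 * ∑ a ∈ Finset.range (m + 1), iteratedDeriv a ψ 1 ^ 2 ≤
      (m + 1) * (C₃ ^ 2 * L ^ (2 * m) * E ^ 2) := by
    rw [Finset.mul_sum]
    refine (Finset.sum_le_card_nsmul _ _ _ fun a ha =>
      hterm a (Nat.lt_succ_iff.1 (Finset.mem_range.1 ha))).trans_eq ?_
    rw [Finset.card_range, nsmul_eq_mul]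
    push_cast; ring
  have hLA : L ^ (2 * m) = A ^ m := by rw [pow_mul, hLsq]
  refine le_of_mul_le_mul_left ?_ hL0
  calc L * (L * ∑ a ∈ Finset.range (m + 1), iteratedDeriv a ψ 1 ^ 2 +
        L⁻¹ * iteratedDeriv (m + 1) ψ 1 ^ 2)
      = L ^ 2 * ∑ a ∈ Finset.range (m + 1), iteratedDeriv a ψ 1 ^ 2 +
        iteratedDeriv (m + 1) ψ 1 ^ 2 := by field_simp
    _ ≤ (m + 1) * (C₃ ^ 2 * L ^ (2 * m) * E ^ 2) + C₃ ^ 2 * L ^ (2 * m) * E ^ 2 :=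
        add_le_add hsum hlast
    _ = (m + 2) * C₃ ^ 2 * A ^ m * E ^ 2 := by rw [hLA]; ring
    _ ≤ (m + 2) * C₃ ^ 2 * A ^ m *
        (2 * (C₂ * L ^ (2 * m + 1) * (C₁ * (|φ₀| + |D| / A ^ m)) ^ 2)) := by
        gcongr
        exact hE2.trans (by gcongr)
    _ = L * ((m + 2) * C₃ ^ 2 * (2 * C₂) * (A ^ m * (C₁ * (|φ₀| + |D| / A ^ m))) ^ 2) := by
        rw [pow_succ L, hLA]; ring
    _ ≤ L * ((m + 2) * C₃ ^ 2 * (2 * C₂) *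
        (2 * C₁ ^ 2 * (1 + C₄) ^ 2 * (𝔥 ^ 2 + A ^ (2 * m) * φ₀ ^ 2))) := by gcongr
    _ ≤ _ := by
        refine mul_le_mul_of_nonneg_left ?_ hL0.le
        have : 0 ≤ 𝔥 ^ 2 + A ^ (2 * m) * φ₀ ^ 2 := by positivity
        linarith

/-- Existence, uniqueness, and forward estimate for the self-similar wave ODE
with asymptotic data at `v = 0` (Proposition 4.4 of the paper, single-mode
version). -/
theorem existence_uniqueness_forward_waveODE (n : ℕ) (hn : Even n) (hn4 : 4 ≤ n) :
    ∃ C > 0, ∀ lam : ℝ, 0 ≤ lam → ∀ φ₀ h : ℝ,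
      (∃ ψ : ℝ → ℝ, ∃ O : ℝ, HasAsymptoticDataODE n lam ψ φ₀ O h) ∧
      (∀ ψ₁ ψ₂ : ℝ → ℝ, ∀ O₁ O₂ : ℝ,
        HasAsymptoticDataODE n lam ψ₁ φ₀ O₁ h →
        HasAsymptoticDataODE n lam ψ₂ φ₀ O₂ h →
        (∀ v ≥ (0:ℝ), ψ₁ v = ψ₂ v) ∧ O₁ = O₂) ∧
      (∀ ψ : ℝ → ℝ, ∀ O : ℝ, HasAsymptoticDataODE n lam ψ φ₀ O h →
        Real.sqrt (1 + lam ^ 2) * ∑ a ∈ Finset.range (n / 2 + 1), iteratedDeriv a ψ 1 ^ 2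
            + (Real.sqrt (1 + lam ^ 2))⁻¹ * iteratedDeriv (n / 2 + 1) ψ 1 ^ 2
          ≤ C * ((h - O * Real.log (Real.sqrt (1 + lam ^ 2))) ^ 2
              + (1 + lam ^ 2) ^ n * φ₀ ^ 2)) := by
  obtain ⟨m, rfl⟩ := hn.two_dvd
  have hm : 2 ≤ m := by omega
  have hf : (m.factorial : ℝ) ≠ 0 := by exact_mod_cast m.factorial_ne_zero
  obtain ⟨C, hC, hest⟩ := exists_forward_estimate hm
  refine ⟨C, hC, fun lam _ φ₀ h => ⟨?_, ?_, ?_⟩⟩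
  · have H := hasAsymptoticDataODE_waveSol hm lam φ₀ ((h - φ₀ * singTrace m lam) / m.factorial)
    rw [mul_div_cancel₀ _ hf, add_sub_cancel] at H
    exact ⟨_, _, H⟩
  · intro ψ₁ ψ₂ O₁ O₂ H₁ H₂
    obtain ⟨d₁, e₁, hO₁, hh₁⟩ := H₁.exists_eq_waveSol hm
    obtain ⟨d₂, e₂, hO₂, hh₂⟩ := H₂.exists_eq_waveSol hm
    have hd : d₁ = d₂ := mul_left_cancel₀ hf (by linarith)
    subst hd
    refine ⟨fun v hv => ?_, hO₁.trans hO₂.symm⟩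
    rcases hv.eq_or_lt with rfl | hv
    · exact H₁.2.2.2.2.1.trans H₂.2.2.2.2.1.symm
    · rw [e₁ v hv, e₂ v hv]
  · intro ψ O H
    rw [Nat.mul_div_cancel_left m two_pos]
    exact hest lam ψ φ₀ O h H
end

section
/- Asymptotic completeness and backward estimate for the self-similar wave ODE (Proposition 4.5 of the paper, single-mode version): for every even integer n ≥ 4 there exists a constant C > 0, depending only on n, such that for every λ ≥ 0 the following holds. Let ψ be smooth on (0,∞) and satisfy the mode-λ self-similar wave ODE on (0,∞). Then ψ extends to a continuous function on [0,∞) and there exist O, h ∈ ℝ such that ψ has asymptotic data (ψ(0), O, h) at v = 0 in the mode-λ sense; moreover, setting φ₀ := ψ(0) and 𝔥 := h − O·log√(1+λ²) (the single-mode version of the renormalization 𝔥 = h − (log∇)O), one has: 𝔥² + (1+λ²)ⁿ·φ₀² ≤ C·( √(1+λ²)·Σ_{a=0}^{n/2} (ψ⁽ᵃ⁾(1))² + (1+λ²)^(−1/2)·(ψ⁽ⁿᐟ²⁺¹⁾(1))² ). -/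
open Set Filter

/-- A backward Grönwall inequality: if `G' ≥ -c' G` on `[a, b]` then `G * exp c` increases. -/
lemma mul_exp_le_mul_exp_of_neg_mul_le_deriv {G G' c c' : ℝ → ℝ} {a b : ℝ} (hab : a ≤ b)
    (hG : ∀ x ∈ Icc a b, HasDerivAt G (G' x) x) (hc : ∀ x ∈ Icc a b, HasDerivAt c (c' x) x)
    (h : ∀ x ∈ Icc a b, -(c' x * G x) ≤ G' x) :
    G a * Real.exp (c a) ≤ G b * Real.exp (c b) := by
  have hd : ∀ x ∈ Icc a b, HasDerivAt (fun x => G x * Real.exp (c x))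
      (G' x * Real.exp (c x) + G x * (Real.exp (c x) * c' x)) x :=
    fun x hx => (hG x hx).mul (hc x hx).exp
  have hmono : MonotoneOn (fun x => G x * Real.exp (c x)) (Icc a b) := by
    refine monotoneOn_of_deriv_nonneg (convex_Icc a b)
      (fun x hx => (hd x hx).continuousAt.continuousWithinAt)
      (fun x hx => (hd x (interior_subset hx)).differentiableAt.differentiableWithinAt)
      fun x hx => ?_
    rw [(hd x (interior_subset hx)).deriv]
    nlinarith [h x (interior_subset hx), Real.exp_pos (c x)]
  exact hmono (left_mem_Icc.2 hab) (right_mem_Icc.2 hab) hab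

/-- If `|f'| ≤ g'` on `(0, 1]`, increments of `f` are bounded by those of `g`. -/
lemma abs_sub_le_sub_of_abs_deriv_le {f f' g g' : ℝ → ℝ}
    (hf : ∀ x ∈ Ioc (0 : ℝ) 1, HasDerivAt f (f' x) x)
    (hg : ∀ x ∈ Ioc (0 : ℝ) 1, HasDerivAt g (g' x) x)
    (h : ∀ x ∈ Ioc (0 : ℝ) 1, |f' x| ≤ g' x) {x y : ℝ} (hx : 0 < x) (hxy : x ≤ y) (hy : y ≤ 1) :
    |f y - f x| ≤ g y - g x := by
  have hx1 : x ∈ Ioc (0 : ℝ) 1 := ⟨hx, hxy.trans hy⟩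
  have hy1 : y ∈ Ioc (0 : ℝ) 1 := ⟨hx.trans_le hxy, hy⟩
  have h1 : MonotoneOn (fun x => g x - f x) (Ioc 0 1) := by
    have hd := fun x hx => (hg x hx).sub (hf x hx)
    refine monotoneOn_of_deriv_nonneg (convex_Ioc 0 1)
      (fun x hx => (hd x hx).continuousAt.continuousWithinAt)
      (fun x hx => (hd x (interior_subset hx)).differentiableAt.differentiableWithinAt)
      fun x hx => ?_
    have := (hd x (interior_subset hx)).deriv
    change deriv (g - f) x ≥ 0
    rw [this]
    linarith [le_abs_self (f' x), h x (interior_subset hx)]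
  have h2 : MonotoneOn (fun x => g x + f x) (Ioc 0 1) := by
    have hd := fun x hx => (hg x hx).add (hf x hx)
    refine monotoneOn_of_deriv_nonneg (convex_Ioc 0 1)
      (fun x hx => (hd x hx).continuousAt.continuousWithinAt)
      (fun x hx => (hd x (interior_subset hx)).differentiableAt.differentiableWithinAt)
      fun x hx => ?_
    have := (hd x (interior_subset hx)).deriv
    change deriv (g + f) x ≥ 0
    rw [this]
    linarith [neg_abs_le (f' x), h x (interior_subset hx)]
  have h3 := h1 hx1 hy1 hxy
  have h4 := h2 hx1 hy1 hxy
  simp only at h3 h4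
  rw [abs_le]
  constructor <;> linarith

/-- If `|f'| ≤ g'` on `(0, 1]` with `g ≥ 0`, then `f` stays within `g` of some limiting value. -/
lemma exists_abs_sub_le_of_abs_deriv_le {f f' g g' : ℝ → ℝ}
    (hf : ∀ x ∈ Ioc (0 : ℝ) 1, HasDerivAt f (f' x) x)
    (hg : ∀ x ∈ Ioc (0 : ℝ) 1, HasDerivAt g (g' x) x)
    (h : ∀ x ∈ Ioc (0 : ℝ) 1, |f' x| ≤ g' x) (hg0 : ∀ x ∈ Ioc (0 : ℝ) 1, 0 ≤ g x) :
    ∃ L, ∀ x ∈ Ioc (0 : ℝ) 1, |f x - L| ≤ g x := by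
  have key : ∀ x ∈ Ioc (0 : ℝ) 1, ∀ y ∈ Ioc (0 : ℝ) 1, f x - g x ≤ f y + g y := by
    intro x hx y hy
    have hgx := hg0 x hx
    have hgy := hg0 y hy
    rcases le_total x y with hxy | hxy
    · have := abs_le.1 (abs_sub_le_sub_of_abs_deriv_le hf hg h hx.1 hxy hy.2)
      linarith
    · have := abs_le.1 (abs_sub_le_sub_of_abs_deriv_le hf hg h hy.1 hxy hx.2)
      linarith
  have hne : ((fun x => f x + g x) '' Ioc (0 : ℝ) 1).Nonempty := ⟨_, 1, by simp, rfl⟩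
  refine ⟨sInf ((fun x => f x + g x) '' Ioc 0 1), fun x hx => ?_⟩
  have h1 : sInf ((fun x => f x + g x) '' Ioc (0 : ℝ) 1) ≤ f x + g x := by
    refine csInf_le ⟨f x - g x, ?_⟩ ⟨x, hx, rfl⟩
    rintro _ ⟨y, hy, rfl⟩
    exact key x hx y hy
  have h2 : f x - g x ≤ sInf ((fun x => f x + g x) '' Ioc (0 : ℝ) 1) := by
    refine le_csInf hne ?_
    rintro _ ⟨y, hy, rfl⟩
    exact key x hx y hy
  rw [abs_le]
  constructor <;> linarith

/-- Logarithmic asymptotics at `0` for the rescaled Legendre system on `(0, 1]`, with bounds on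
the coefficients in terms of the data at `1`. -/
lemma exists_log_asymptotics_inner {W P c : ℝ → ℝ}
    (hW : ∀ x ∈ Ioc (0 : ℝ) 1, HasDerivAt W (P x / x) x)
    (hP : ∀ x ∈ Ioc (0 : ℝ) 1, HasDerivAt P (-(c x * W x)) x)
    (hc0 : ∀ x ∈ Ioc (0 : ℝ) 1, 0 ≤ c x) (hc1 : ∀ x ∈ Ioc (0 : ℝ) 1, c x ≤ 1) {M : ℝ}
    (hM : 0 ≤ M) (hdata : 4 * (P 1 ^ 2 + W 1 ^ 2) ≤ M ^ 2) :
    ∃ A B, |A| ≤ 3 * M ∧ |B| ≤ 4 * M ∧ ∀ x ∈ Ioc (0 : ℝ) 1,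
      |P x - A| ≤ M * (x * (2 - Real.log x)) ∧
      |W x - A * Real.log x - B| ≤ M * (x * (3 - Real.log x)) := by
  have hPM : ∀ x ∈ Ioc (0 : ℝ) 1, |P x| ≤ M := by
    intro x hx
    have hsub : ∀ y ∈ Icc x 1, y ∈ Ioc (0 : ℝ) 1 := fun y hy => ⟨hx.1.trans_le hy.1, hy.2⟩
    have hE := mul_exp_le_mul_exp_of_neg_mul_le_deriv (G := fun y => P y ^ 2 + y * W y ^ 2)
      (G' := fun y => W y ^ 2 + 2 * (1 - c y) * (P y * W y)) (c := fun y => y) (c' := fun _ => 1)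
      hx.2 (fun y hy => by
        have hy' := hsub y hy
        have hy0 : y ≠ 0 := hy'.1.ne'
        refine (((hP y hy').pow 2).add ((hasDerivAt_id y).mul ((hW y hy').pow 2))).congr_deriv ?_
        simp only [id, Pi.pow_apply]
        field_simp
        push_cast
        ring) (fun y _ => hasDerivAt_id y) (fun y hy => by
        have hy' := hsub y hy
        have h0 := hc0 y hy'
        have h1 := hc1 y hy'
        have : 0 ≤ (W y + (1 - c y) * P y) ^ 2 := sq_nonneg _
        have h2 : (1 - c y) ^ 2 * P y ^ 2 ≤ 1 * P y ^ 2 :=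
          mul_le_mul_of_nonneg_right (by nlinarith) (sq_nonneg _)
        have h3 : 0 ≤ y * W y ^ 2 := mul_nonneg hy'.1.le (sq_nonneg _)
        nlinarith)
    have he1 : (1 : ℝ) ≤ Real.exp x := Real.one_le_exp hx.1.le
    have he2 : Real.exp 1 ≤ 4 := by linarith [Real.exp_one_lt_d9]
    have h3 : 0 ≤ x * W x ^ 2 := mul_nonneg hx.1.le (sq_nonneg _)
    have h4 : 0 ≤ P x ^ 2 := sq_nonneg _
    have h5 : 0 ≤ P 1 ^ 2 + W 1 ^ 2 := by positivity
    apply abs_le_of_sq_le_sq _ hM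
    simp only [one_mul] at hE
    nlinarith
  have hlog : ∀ x ∈ Ioc (0 : ℝ) 1, Real.log x ≤ 0 := fun x hx => Real.log_nonpos hx.1.le hx.2
  have hW1 : |W 1| ≤ M := abs_le_of_sq_le_sq (by nlinarith [sq_nonneg (P 1), sq_nonneg (W 1)]) hM
  have h1mem : (1 : ℝ) ∈ Ioc (0 : ℝ) 1 := by simp
  have hWM : ∀ x ∈ Ioc (0 : ℝ) 1, |W x| ≤ M * (1 - Real.log x) := by
    intro x hx
    have := abs_sub_le_sub_of_abs_deriv_le (g := fun x => M * Real.log x)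
      (g' := fun x => M * x⁻¹) hW
      (fun y hy => (Real.hasDerivAt_log hy.1.ne').const_mul M) (fun y hy => by
        rw [abs_div, abs_of_pos hy.1, div_eq_mul_inv]
        exact mul_le_mul_of_nonneg_right (hPM y hy) (inv_nonneg.2 hy.1.le)) hx.1 hx.2 le_rfl
    simp only [Real.log_one, mul_zero, zero_sub] at this
    rw [abs_le] at this hW1 ⊢
    constructor <;> linarith
  have hg : ∀ a : ℝ, ∀ x ∈ Ioc (0 : ℝ) 1, HasDerivAt (fun x => M * (x * (a - Real.log x)))
      (M * (a - 1 - Real.log x)) x := by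
    intro a x hx
    have hx0 : x ≠ 0 := hx.1.ne'
    refine (((hasDerivAt_id x).mul
      ((Real.hasDerivAt_log hx0).const_sub a)).const_mul M).congr_deriv ?_
    simp only [id]
    field_simp
    ring
  obtain ⟨A, hA⟩ := exists_abs_sub_le_of_abs_deriv_le hP (hg 2) (fun x hx => by
      rw [abs_neg, abs_mul, abs_of_nonneg (hc0 x hx)]
      have := hWM x hx
      nlinarith [hc1 x hx, hc0 x hx, abs_nonneg (W x)]) (fun x hx => by
      have := hlog x hx
      exact mul_nonneg hM (mul_nonneg hx.1.le (by linarith)))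
  obtain ⟨B, hB⟩ := exists_abs_sub_le_of_abs_deriv_le (f := fun x => W x - A * Real.log x)
    (f' := fun x => P x / x - A * x⁻¹)
    (fun x hx => (hW x hx).sub ((Real.hasDerivAt_log hx.1.ne').const_mul A)) (hg 3) (fun x hx => by
      have h1 := hA x hx
      have : P x / x - A * x⁻¹ = (P x - A) / x := by rw [sub_div, div_eq_mul_inv A]
      rw [this, abs_div, abs_of_pos hx.1, div_le_iff₀ hx.1]
      linarith) (fun x hx => by
      have := hlog x hx
      exact mul_nonneg hM (mul_nonneg hx.1.le (by linarith)))
  refine ⟨A, B, ?_, ?_, fun x hx => ⟨hA x hx, hB x hx⟩⟩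
  · have h1 := hA 1 h1mem
    have h2 := hPM 1 h1mem
    rw [Real.log_one] at h1
    rw [abs_le] at *
    constructor <;> linarith
  · have h1 := hB 1 h1mem
    rw [Real.log_one] at h1
    rw [abs_le] at *
    constructor <;> linarith

/-- Energy estimate for the Legendre system on the oscillatory region `[κ⁻¹, 1]`, in the variable
`t = √v`. -/
lemma sq_add_sq_le_of_oscillatory {w p : ℝ → ℝ} {κ : ℝ} (hκ : 1 ≤ κ)
    (hw : ∀ t > (0 : ℝ), HasDerivAt w (2 * p t / t) t)
    (hp : ∀ t > (0 : ℝ), HasDerivAt p (-(2 * t * κ ^ 2 * w t / (1 + t ^ 2) ^ 2)) t) :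
    p κ⁻¹ ^ 2 + w κ⁻¹ ^ 2 ≤ 12 * Real.exp 5 * (κ⁻¹ * p 1 ^ 2 + κ * w 1 ^ 2) := by
  have hκ0 : 0 < κ := by linarith
  have hκi : κ⁻¹ ≤ 1 := inv_le_one_of_one_le₀ hκ
  have hκi0 : 0 < κ⁻¹ := inv_pos.2 hκ0
  set E₀ : ℝ → ℝ := fun t => p t ^ 2 / t + κ ^ 2 * t * w t ^ 2 / (1 + t ^ 2) ^ 2 with hE₀
  set E : ℝ → ℝ := fun t => E₀ t + p t * w t / (2 * t) with hE
  have hcross : ∀ t ∈ Icc κ⁻¹ 1, |p t * w t| ≤ κ⁻¹ * E₀ t := by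
    intro t ht
    have ht0 : 0 < t := hκi0.trans_le ht.1
    obtain ⟨q, hq⟩ : ∃ q, w t = κ⁻¹ * (1 + t ^ 2) * q :=
      ⟨κ * w t / (1 + t ^ 2), by field_simp⟩
    have h1 : E₀ t = p t ^ 2 / t + t * q ^ 2 := by
      simp only [hE₀, hq]
      field_simp
    have h2 : 2 * |p t * q| ≤ E₀ t := by
      rw [h1, div_add' _ _ _ ht0.ne', le_div_iff₀ ht0]
      rcases abs_cases (p t * q) with h | h <;> rw [h.1]
      · nlinarith [sq_nonneg (p t - t * q)]
      · nlinarith [sq_nonneg (p t + t * q)]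
    have h3 : |p t * w t| = κ⁻¹ * ((1 + t ^ 2) * |p t * q|) := by
      rw [hq, show p t * (κ⁻¹ * (1 + t ^ 2) * q) = κ⁻¹ * ((1 + t ^ 2) * (p t * q)) by ring,
        abs_mul, abs_mul, abs_of_pos hκi0, abs_of_pos (by positivity : 0 < 1 + t ^ 2)]
    rw [h3]
    refine mul_le_mul_of_nonneg_left ?_ hκi0.le
    have : t ^ 2 ≤ 1 := by nlinarith [ht.2]
    nlinarith [abs_nonneg (p t * q)]
  have hE₀nn : ∀ t ∈ Icc κ⁻¹ 1, 0 ≤ E₀ t := by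
    intro t ht
    have ht0 : 0 < t := hκi0.trans_le ht.1
    simp only [hE₀]
    positivity
  have hcomp : ∀ t ∈ Icc κ⁻¹ 1, |E t - E₀ t| ≤ E₀ t / 2 := by
    intro t ht
    have ht0 : 0 < t := hκi0.trans_le ht.1
    have h1 := hcross t ht
    have : E t - E₀ t = p t * w t / (2 * t) := by simp [hE]
    rw [this, abs_div, abs_of_pos (by positivity : 0 < 2 * t), div_le_iff₀ (by positivity)]
    nlinarith [ht.1, hE₀nn t ht]
  have hder : ∀ t ∈ Icc κ⁻¹ 1, HasDerivAt E
      (-(4 * κ ^ 2 * t ^ 2 * w t ^ 2 / (1 + t ^ 2) ^ 3) - p t * w t / (2 * t ^ 2)) t := by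
    intro t ht
    have ht0 : 0 < t := hκi0.trans_le ht.1
    have hw' := hw t ht0
    have hp' := hp t ht0
    have hd : HasDerivAt (fun t : ℝ => (1 + t ^ 2) ^ 2) (2 * (1 + t ^ 2) * (2 * t)) t := by
      refine (((hasDerivAt_pow 2 t).const_add 1).pow 2).congr_deriv ?_
      simp
    have h1 := ((hp'.pow 2).div (hasDerivAt_id t) ht0.ne').add
      (((((hasDerivAt_id t).const_mul (κ ^ 2)).mul (hw'.pow 2))).div hd (by positivity))
    have h2 := (hp'.mul hw').div ((hasDerivAt_id t).const_mul 2) (by simp [ht0.ne'])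
    refine (h1.add h2).congr_deriv ?_
    simp only [id, Pi.pow_apply, Pi.mul_apply]
    field_simp
    push_cast
    ring
  have hmain := mul_exp_le_mul_exp_of_neg_mul_le_deriv hκi hder (c := fun t => 4 * t - κ⁻¹ * t⁻¹)
    (c' := fun t => 4 + κ⁻¹ * (t ^ 2)⁻¹) (fun t ht => by
      have ht0 : t ≠ 0 := (hκi0.trans_le ht.1).ne'
      refine (((hasDerivAt_id t).const_mul 4).sub
        ((hasDerivAt_inv ht0).const_mul κ⁻¹)).congr_deriv ?_
      simp) (fun t ht => by
      have ht0 : 0 < t := hκi0.trans_le ht.1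
      have h1 := hcross t ht
      have h2 := abs_le.1 (hcomp t ht)
      have h3 := hE₀nn t ht
      have h4 : 4 * κ ^ 2 * t ^ 2 * w t ^ 2 / (1 + t ^ 2) ^ 3 ≤ 2 * E₀ t := by
        have ha : κ ^ 2 * t * w t ^ 2 / (1 + t ^ 2) ^ 2 ≤ E₀ t := by
          simp only [hE₀]
          have : 0 ≤ p t ^ 2 / t := by positivity
          linarith
        have hb : 4 * κ ^ 2 * t ^ 2 * w t ^ 2 / (1 + t ^ 2) ^ 3
            = κ ^ 2 * t * w t ^ 2 / (1 + t ^ 2) ^ 2 * (4 * t / (1 + t ^ 2)) := by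
          field_simp
        have hc : 4 * t / (1 + t ^ 2) ≤ 2 := by
          rw [div_le_iff₀ (by positivity)]
          nlinarith [sq_nonneg (t - 1)]
        rw [hb]
        have hd : 0 ≤ κ ^ 2 * t * w t ^ 2 / (1 + t ^ 2) ^ 2 := by positivity
        nlinarith
      have h5 : p t * w t / (2 * t ^ 2) ≤ κ⁻¹ * (t ^ 2)⁻¹ * (E₀ t / 2) := by
        rw [div_le_iff₀ (by positivity)]
        have : κ⁻¹ * (t ^ 2)⁻¹ * (E₀ t / 2) * (2 * t ^ 2) = κ⁻¹ * E₀ t := by field_simp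
        rw [this]
        exact (le_abs_self _).trans h1
      have h6 : 0 ≤ κ⁻¹ * (t ^ 2)⁻¹ := by positivity
      nlinarith [mul_le_mul_of_nonneg_left (by linarith : E₀ t / 2 ≤ E t) h6])
  have hl : κ⁻¹ ∈ Icc κ⁻¹ 1 := ⟨le_rfl, hκi⟩
  have hr : (1 : ℝ) ∈ Icc κ⁻¹ 1 := ⟨hκi, le_rfl⟩
  have h1 := abs_le.1 (hcomp _ hl)
  have h2 := abs_le.1 (hcomp _ hr)
  have h3 := hE₀nn _ hl
  have h4 := hE₀nn _ hr
  have h5 : E κ⁻¹ ≤ E 1 * Real.exp 5 := by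
    have e1 : E κ⁻¹ * Real.exp (-1) ≤ E κ⁻¹ * Real.exp (4 * κ⁻¹ - κ⁻¹ * κ⁻¹⁻¹) := by
      refine mul_le_mul_of_nonneg_left (Real.exp_le_exp.2 ?_) (by linarith)
      rw [inv_inv, inv_mul_cancel₀ hκ0.ne']
      linarith
    have e2 : E 1 * Real.exp (4 * 1 - κ⁻¹ * 1⁻¹) ≤ E 1 * Real.exp 4 := by
      refine mul_le_mul_of_nonneg_left (Real.exp_le_exp.2 ?_) (by linarith)
      simp [hκ0.le]
    have e3 := (e1.trans hmain).trans e2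
    have e4 : E κ⁻¹ * Real.exp (-1) * Real.exp 1 ≤ E 1 * Real.exp 4 * Real.exp 1 :=
      mul_le_mul_of_nonneg_right e3 (Real.exp_pos 1).le
    rw [mul_assoc, mul_assoc, ← Real.exp_add, ← Real.exp_add] at e4
    norm_num at e4
    linarith
  have h6 : κ * (p κ⁻¹ ^ 2 + w κ⁻¹ ^ 2) ≤ 4 * E₀ κ⁻¹ := by
    have e1 : E₀ κ⁻¹ = κ * p κ⁻¹ ^ 2 + κ * w κ⁻¹ ^ 2 / (1 + κ⁻¹ ^ 2) ^ 2 := by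
      simp only [hE₀]
      field_simp
    have e2 : κ * w κ⁻¹ ^ 2 / 4 ≤ κ * w κ⁻¹ ^ 2 / (1 + κ⁻¹ ^ 2) ^ 2 := by
      refine div_le_div_of_nonneg_left (by positivity) (by positivity) ?_
      have : κ⁻¹ ^ 2 ≤ 1 := by nlinarith
      nlinarith [sq_nonneg κ⁻¹]
    have e3 : 0 ≤ κ * p κ⁻¹ ^ 2 := by positivity
    rw [e1]
    linarith
  have h7 : E₀ 1 ≤ p 1 ^ 2 + κ ^ 2 * w 1 ^ 2 := by
    simp only [hE₀]
    have : 0 ≤ κ ^ 2 * w 1 ^ 2 := by positivity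
    norm_num
    linarith
  have h8 : κ * (p κ⁻¹ ^ 2 + w κ⁻¹ ^ 2) ≤ 12 * Real.exp 5 * (p 1 ^ 2 + κ ^ 2 * w 1 ^ 2) := by
    nlinarith [Real.exp_pos 5]
  have h9 : p κ⁻¹ ^ 2 + w κ⁻¹ ^ 2 = κ⁻¹ * (κ * (p κ⁻¹ ^ 2 + w κ⁻¹ ^ 2)) := by field_simp
  have h10 : 12 * Real.exp 5 * (κ⁻¹ * p 1 ^ 2 + κ * w 1 ^ 2)
      = κ⁻¹ * (12 * Real.exp 5 * (p 1 ^ 2 + κ ^ 2 * w 1 ^ 2)) := by field_simp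
  rw [h9, h10]
  exact mul_le_mul_of_nonneg_left h8 hκi0.le

/-- `f v = c * log v + d + O(v * (1 + log² v))` on `(0, 1]`. -/
def LogAsymp (f : ℝ → ℝ) (c d : ℝ) : Prop :=
  ∃ K : ℝ, 0 ≤ K ∧ ∀ v ∈ Ioc (0 : ℝ) 1,
    |f v - c * Real.log v - d| ≤ K * (v * (1 + Real.log v ^ 2))

lemma mul_one_add_log_sq_le {v : ℝ} (hv : v ∈ Ioc (0 : ℝ) 1) :
    v * (1 + Real.log v ^ 2) ≤ 17 * √v := by
  obtain ⟨s, hs0, hs1, rfl⟩ : ∃ s : ℝ, 0 < s ∧ s ≤ 1 ∧ v = s ^ 4 := by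
    refine ⟨√√v, by have := hv.1; positivity, ?_, ?_⟩
    · exact Real.sqrt_le_one.2 (Real.sqrt_le_one.2 hv.2)
    · rw [show √√v ^ 4 = (√√v ^ 2) ^ 2 by ring, Real.sq_sqrt (Real.sqrt_nonneg _),
        Real.sq_sqrt hv.1.le]
  have h1 : √(s ^ 4) = s ^ 2 := by
    rw [show s ^ 4 = (s ^ 2) ^ 2 by ring, Real.sqrt_sq (by positivity)]
  have h2 := abs_lt.1 (Real.abs_log_mul_self_lt s hs0 hs1)
  have h3 : (Real.log s * s) ^ 2 ≤ 1 := by nlinarith [h2.1, h2.2]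
  have h4 : s ^ 2 ≤ 1 := by nlinarith
  have h5 : 0 < s ^ 2 := by positivity
  rw [h1, Real.log_pow]
  push_cast
  have h6 : s ^ 4 * (1 + (4 * Real.log s) ^ 2)
      = s ^ 2 * (s ^ 2 + 16 * (Real.log s * s) ^ 2) := by ring
  rw [h6]
  nlinarith

lemma mul_one_add_log_sq_le_const {v : ℝ} (hv : v ∈ Ioc (0 : ℝ) 1) :
    v * (1 + Real.log v ^ 2) ≤ 17 := by
  have h1 := mul_one_add_log_sq_le hv
  have h2 : √v ≤ 1 := Real.sqrt_le_one.2 hv.2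
  linarith

lemma le_mul_one_add_log_sq {v : ℝ} (hv : 0 < v) : v ≤ v * (1 + Real.log v ^ 2) := by
  nlinarith [sq_nonneg (Real.log v)]

namespace LogAsymp

variable {f g : ℝ → ℝ} {c d c' d' : ℝ}

lemma congr (hf : LogAsymp f c d) (h : ∀ v ∈ Ioc (0 : ℝ) 1, g v = f v) : LogAsymp g c d := by
  obtain ⟨K, hK, hb⟩ := hf
  refine ⟨K, hK, fun v hv => ?_⟩
  rw [h v hv]
  exact hb v hv

lemma zero : LogAsymp (fun _ => 0) 0 0 := ⟨0, le_rfl, fun v _ => by simp⟩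

lemma add (hf : LogAsymp f c d) (hg : LogAsymp g c' d') :
    LogAsymp (fun v => f v + g v) (c + c') (d + d') := by
  obtain ⟨K, hK, hb⟩ := hf
  obtain ⟨K', hK', hb'⟩ := hg
  refine ⟨K + K', by positivity, fun v hv => ?_⟩
  have h1 := hb v hv
  have h2 := hb' v hv
  rw [abs_le] at *
  constructor <;> nlinarith

lemma mul_left (hf : LogAsymp f c d) {g₀ Kg : ℝ}
    (hg : ∀ v ∈ Ioc (0 : ℝ) 1, |g v - g₀| ≤ Kg * v) :
    LogAsymp (fun v => g v * f v) (g₀ * c) (g₀ * d) := by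
  obtain ⟨K, hK, hb⟩ := hf
  have hKg : 0 ≤ Kg := by
    have := (abs_nonneg _).trans (hg 1 (by simp))
    linarith
  refine ⟨(|g₀| + Kg) * K + Kg * (|c| + |d|), by positivity, fun v hv => ?_⟩
  have h1 := hb v hv
  have h2 := hg v hv
  have h3 : g v * f v - g₀ * c * Real.log v - g₀ * d
      = g v * (f v - c * Real.log v - d) + (g v - g₀) * (c * Real.log v + d) := by ring
  have h4 : |g v| ≤ |g₀| + Kg := by
    have e1 : |g v| ≤ |g v - g₀| + |g₀| := by
      simpa using abs_add_le (g v - g₀) g₀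
    nlinarith [hv.2]
  have h5 : |c * Real.log v + d| ≤ (|c| + |d|) * (1 + Real.log v ^ 2) := by
    have e1 : |Real.log v| ≤ 1 + Real.log v ^ 2 := by
      rw [abs_le]
      constructor <;> nlinarith [sq_nonneg (Real.log v - 1), sq_nonneg (Real.log v + 1)]
    have e2 := abs_add_le (c * Real.log v) d
    rw [abs_mul] at e2
    nlinarith [abs_nonneg c, abs_nonneg d, sq_nonneg (Real.log v),
      mul_le_mul_of_nonneg_left e1 (abs_nonneg c),
      mul_nonneg (abs_nonneg d) (sq_nonneg (Real.log v))]
  rw [h3]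
  refine (abs_add_le _ _).trans ?_
  rw [abs_mul, abs_mul]
  have h6 : |g v| * |f v - c * Real.log v - d|
      ≤ (|g₀| + Kg) * (K * (v * (1 + Real.log v ^ 2))) :=
    mul_le_mul h4 h1 (abs_nonneg _) (by positivity)
  have h7 : |g v - g₀| * |c * Real.log v + d|
      ≤ (Kg * v) * ((|c| + |d|) * (1 + Real.log v ^ 2)) :=
    mul_le_mul h2 h5 (abs_nonneg _) (by have := hv.1; positivity)
  linarith

lemma const_mul (hf : LogAsymp f c d) (a : ℝ) : LogAsymp (fun v => a * f v) (a * c) (a * d) :=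
  hf.mul_left (g := fun _ => a) (Kg := 0) (by simp)

lemma id_mul (hf : LogAsymp f c d) : LogAsymp (fun v => v * f v) 0 0 := by
  have := hf.mul_left (g := fun v => v) (g₀ := 0) (Kg := 1) (fun v hv => by
    simp [abs_of_pos hv.1])
  simpa using this

lemma inv_one_add_pow_mul (hf : LogAsymp f c d) (j : ℕ) :
    LogAsymp (fun v => ((1 + v) ^ j)⁻¹ * f v) c d := by
  induction j with
  | zero => simpa using hf
  | succ j ih =>
    have := ih.mul_left (g := fun v => (1 + v)⁻¹) (g₀ := 1) (Kg := 1) (fun v hv => by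
      have hv0 := hv.1
      have : (1 + v)⁻¹ - 1 = -(v / (1 + v)) := by
        field_simp
        ring
      rw [this, abs_neg, abs_of_pos (by positivity), one_mul]
      exact div_le_self hv0.le (by linarith))
    rw [one_mul, one_mul] at this
    refine this.congr fun v hv => ?_
    rw [pow_succ, mul_inv]
    ring

lemma sum {ι : Type*} (s : Finset ι) {F : ι → ℝ → ℝ} {C D : ι → ℝ}
    (h : ∀ i ∈ s, LogAsymp (F i) (C i) (D i)) :
    LogAsymp (fun v => ∑ i ∈ s, F i v) (∑ i ∈ s, C i) (∑ i ∈ s, D i) := by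
  classical
  induction s using Finset.induction_on with
  | empty => simpa using zero
  | insert i s his ih =>
    simp only [Finset.sum_insert his]
    exact (h i (Finset.mem_insert_self i s)).add
      (ih fun j hj => h j (Finset.mem_insert_of_mem hj))

lemma tendsto (hf : LogAsymp f 0 d) : Tendsto f (nhdsWithin 0 (Ioi 0)) (nhds d) := by
  obtain ⟨K, hK, hb⟩ := hf
  have hlim : Tendsto (fun v : ℝ => K * (17 * √v)) (nhdsWithin 0 (Ioi 0)) (nhds 0) := by
    have : Tendsto (fun v : ℝ => K * (17 * √v)) (nhds 0) (nhds (K * (17 * √0))) :=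
      (by fun_prop : Continuous fun v : ℝ => K * (17 * √v)).tendsto 0
    simp only [Real.sqrt_zero, mul_zero] at this
    exact this.mono_left nhdsWithin_le_nhds
  rw [tendsto_iff_norm_sub_tendsto_zero]
  refine squeeze_zero' (Eventually.of_forall fun v => norm_nonneg _) ?_ hlim
  filter_upwards [Ioc_mem_nhdsGT (zero_lt_one' ℝ)] with v hv
  have h1 := hb v hv
  rw [zero_mul, sub_zero] at h1
  exact h1.trans (mul_le_mul_of_nonneg_left (mul_one_add_log_sq_le hv) hK)

lemma unique (hf : LogAsymp f 0 d) (hf' : LogAsymp f 0 d') : d = d' :=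
  tendsto_nhds_unique hf.tendsto hf'.tendsto

/-- It suffices to check the asymptotics near `0`. -/
lemma of_le_of_continuousOn {δ K : ℝ} (hδ : 0 < δ) (hf : ContinuousOn f (Ioi 0)) (hK : 0 ≤ K)
    (hb : ∀ v ∈ Ioc (0 : ℝ) δ, |f v - c * Real.log v - d| ≤ K * (v * (1 + Real.log v ^ 2))) :
    LogAsymp f c d := by
  have hcont : ContinuousOn (fun v => f v - c * Real.log v - d) (Icc δ 1) := by
    have hsub : Icc δ 1 ⊆ Ioi 0 := fun v hv => hδ.trans_le hv.1
    refine ((hf.mono hsub).sub (continuousOn_const.mul ?_)).sub continuousOn_const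
    exact Real.continuousOn_log.mono fun v hv => (hδ.trans_le hv.1).ne'
  obtain ⟨K', hK'⟩ := isCompact_Icc.exists_bound_of_continuousOn hcont
  refine ⟨K + |K'| / δ, by positivity, fun v hv => ?_⟩
  have h0 := le_mul_one_add_log_sq hv.1
  have h00 : 0 ≤ v * (1 + Real.log v ^ 2) := hv.1.le.trans h0
  rcases le_total v δ with h | h
  · refine (hb v ⟨hv.1, h⟩).trans (mul_le_mul_of_nonneg_right ?_ h00)
    have : 0 ≤ |K'| / δ := by positivity
    linarith
  · have h1 := (hK' v ⟨h, hv.2⟩).trans (le_abs_self K')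
    rw [Real.norm_eq_abs] at h1
    have h2 : |K'| ≤ |K'| / δ * v := by
      rw [div_mul_eq_mul_div, le_div_iff₀ hδ]
      exact mul_le_mul_of_nonneg_left h (abs_nonneg _)
    have h3 : |K'| / δ * v ≤ |K'| / δ * (v * (1 + Real.log v ^ 2)) :=
      mul_le_mul_of_nonneg_left h0 (by positivity)
    nlinarith [mul_nonneg hK h00]

/-- Integrating a bounded function preserves the existence of asymptotics. -/
lemma exists_of_hasDerivAt {f' : ℝ → ℝ} (hf' : LogAsymp f' 0 d)
    (hd : ∀ v ∈ Ioc (0 : ℝ) 1, HasDerivAt f (f' v / (1 + v) ^ 2) v) :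
    ∃ d', LogAsymp f 0 d' := by
  obtain ⟨K, hK, hb⟩ := hf'
  have hbound : ∀ v ∈ Ioc (0 : ℝ) 1, |f' v / (1 + v) ^ 2| ≤ K * 17 + |d| := by
    intro v hv
    have hv0 := hv.1
    have h1 := hb v hv
    rw [zero_mul, sub_zero] at h1
    have h2 := mul_le_mul_of_nonneg_left (mul_one_add_log_sq_le_const hv) hK
    have h3 : |f' v| ≤ |f' v - d| + |d| := by simpa using abs_add_le (f' v - d) d
    rw [abs_div, abs_of_pos (by positivity : 0 < (1 + v) ^ 2)]
    refine (div_le_self (abs_nonneg _) ?_).trans (by linarith)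
    nlinarith
  obtain ⟨L, hL⟩ := exists_abs_sub_le_of_abs_deriv_le hd
    (g := fun v => (K * 17 + |d|) * v) (g' := fun _ => K * 17 + |d|)
    (fun v _ => by simpa using (hasDerivAt_id v).const_mul (K * 17 + |d|)) hbound
    (fun v hv => by have := hv.1; positivity)
  refine ⟨L, K * 17 + |d|, by positivity, fun v hv => ?_⟩
  rw [zero_mul, sub_zero]
  exact (hL v hv).trans (mul_le_mul_of_nonneg_left (le_mul_one_add_log_sq hv.1) (by positivity))

end LogAsymp

/-- Uniform estimates for the logarithmic coefficients of solutions of the Legendre equation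
`(1 + v)² (v W')' + κ² W = 0`. -/
lemma legendre_log_asymptotics {W P : ℝ → ℝ} {κ S : ℝ} (hκ : 1 ≤ κ) (hS : 0 ≤ S)
    (hW : ∀ v > (0 : ℝ), HasDerivAt W (P v / v) v)
    (hP : ∀ v > (0 : ℝ), HasDerivAt P (-(κ ^ 2 * W v / (1 + v) ^ 2)) v)
    (hdata : κ⁻¹ * P 1 ^ 2 + κ * W 1 ^ 2 ≤ S ^ 2) :
    ∃ A B, LogAsymp W A B ∧ LogAsymp P 0 A ∧ |A| ≤ 324 * S ∧
      |B - 2 * A * Real.log κ| ≤ 432 * S := by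
  have hκ0 : 0 < κ := by linarith
  have hosc := sq_add_sq_le_of_oscillatory (w := fun t => W (t ^ 2)) (p := fun t => P (t ^ 2)) hκ
    (fun t ht => by
      have := (hW (t ^ 2) (by positivity)).comp t (hasDerivAt_pow 2 t)
      refine this.congr_deriv ?_
      have : t ≠ 0 := ht.ne'
      field_simp
      norm_num
      ring) (fun t ht => by
      have := (hP (t ^ 2) (by positivity)).comp t (hasDerivAt_pow 2 t)
      refine this.congr_deriv ?_
      field_simp
      norm_num
      ring)
  have he : Real.exp 5 ≤ 243 := by
    have h1 : Real.exp 5 = Real.exp 1 ^ 5 := by rw [← Real.exp_nat_mul]; norm_num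
    rw [h1]
    calc Real.exp 1 ^ 5 ≤ 3 ^ 5 :=
          pow_le_pow_left₀ (Real.exp_pos 1).le (by linarith [Real.exp_one_lt_d9]) 5
      _ = 243 := by norm_num
  simp only [one_pow] at hosc
  have hscale : ∀ x : ℝ, HasDerivAt (fun x : ℝ => κ⁻¹ ^ 2 * x) (κ⁻¹ ^ 2) x := fun x => by
    simpa only [mul_one, id] using (hasDerivAt_id x).const_mul (κ⁻¹ ^ 2)
  obtain ⟨A, B, hA, hB, hAB⟩ := exists_log_asymptotics_inner (W := fun x => W (κ⁻¹ ^ 2 * x))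
    (P := fun x => P (κ⁻¹ ^ 2 * x)) (c := fun x => ((1 + κ⁻¹ ^ 2 * x) ^ 2)⁻¹) (M := 108 * S)
    (fun x hx => by
      have hx0 := hx.1
      refine ((hW (κ⁻¹ ^ 2 * x) (by positivity)).comp x (hscale x)).congr_deriv ?_
      field_simp) (fun x hx => by
      have hx0 := hx.1
      refine ((hP (κ⁻¹ ^ 2 * x) (by positivity)).comp x (hscale x)).congr_deriv ?_
      field_simp) (fun x hx => by positivity) (fun x hx => by
      have hx0 := hx.1
      have : 0 ≤ κ⁻¹ ^ 2 * x := by positivity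
      exact inv_le_one_of_one_le₀ (by nlinarith)) (by positivity) (by
      simp only [mul_one]
      have h1 : 0 ≤ κ⁻¹ * P 1 ^ 2 + κ * W 1 ^ 2 := by positivity
      nlinarith)
  have hlogκ : 0 ≤ Real.log κ := Real.log_nonneg hκ
  have hrescale : ∀ v ∈ Ioc (0 : ℝ) (κ⁻¹ ^ 2), κ ^ 2 * v ∈ Ioc (0 : ℝ) 1 ∧
      κ⁻¹ ^ 2 * (κ ^ 2 * v) = v ∧ Real.log (κ ^ 2 * v) = 2 * Real.log κ + Real.log v := by
    intro v hv
    have hv0 := hv.1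
    refine ⟨⟨by positivity, ?_⟩, by field_simp, ?_⟩
    · have := mul_le_mul_of_nonneg_left hv.2 (sq_nonneg κ)
      rwa [← mul_pow, mul_inv_cancel₀ hκ0.ne', one_pow] at this
    · rw [Real.log_mul (by positivity) hv0.ne', Real.log_pow]
      norm_num
  have herr : ∀ v ∈ Ioc (0 : ℝ) (κ⁻¹ ^ 2), ∀ a ≤ (3 : ℝ),
      108 * S * (κ ^ 2 * v * (a - Real.log (κ ^ 2 * v)))
        ≤ 432 * S * κ ^ 2 * (v * (1 + Real.log v ^ 2)) := by
    intro v hv a ha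
    have hv0 := hv.1
    rw [(hrescale v hv).2.2]
    have h1 : a - (2 * Real.log κ + Real.log v) ≤ 4 * (1 + Real.log v ^ 2) := by
      nlinarith [sq_nonneg (Real.log v + 1), sq_nonneg (Real.log v)]
    have h2 : 0 ≤ 108 * S * (κ ^ 2 * v) := by positivity
    nlinarith [mul_le_mul_of_nonneg_left h1 h2]
  refine ⟨A, B + 2 * A * Real.log κ, ?_, ?_, by linarith, ?_⟩
  · refine LogAsymp.of_le_of_continuousOn (K := 432 * S * κ ^ 2) (δ := κ⁻¹ ^ 2) (by positivity)
      (fun v hv => (hW v hv).continuousAt.continuousWithinAt) (by positivity) fun v hv => ?_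
    have h1 := (hAB _ (hrescale v hv).1).2
    simp only [(hrescale v hv).2.1] at h1
    have h2 := h1.trans (herr v hv 3 le_rfl)
    rw [(hrescale v hv).2.2] at h2
    rwa [show W v - A * Real.log v - (B + 2 * A * Real.log κ)
      = W v - A * (2 * Real.log κ + Real.log v) - B by ring]
  · refine LogAsymp.of_le_of_continuousOn (K := 432 * S * κ ^ 2) (δ := κ⁻¹ ^ 2) (by positivity)
      (fun v hv => (hP v hv).continuousAt.continuousWithinAt) (by positivity) fun v hv => ?_
    have h1 := (hAB _ (hrescale v hv).1).1
    simp only [(hrescale v hv).2.1] at h1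
    rw [zero_mul, sub_zero]
    exact h1.trans (herr v hv 2 (by norm_num))
  · rw [add_sub_cancel_right]
    linarith

/-- Iterated derivatives with respect to the variable `-1 / (1 + v)`. -/
noncomputable def conformalDeriv (ψ : ℝ → ℝ) : ℕ → ℝ → ℝ
  | 0 => ψ
  | k + 1 => fun v => (1 + v) ^ 2 * deriv (conformalDeriv ψ k) v

section Smooth

variable {ψ : ℝ → ℝ}

lemma contDiffOn_conformalDeriv (hψ : ContDiffOn ℝ (⊤ : ℕ∞) ψ (Ioi 0)) (k : ℕ) :
    ContDiffOn ℝ (⊤ : ℕ∞) (conformalDeriv ψ k) (Ioi 0) := by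
  induction k with
  | zero => exact hψ
  | succ k ih =>
    have h1 : ContDiff ℝ (⊤ : ℕ∞) fun v : ℝ => (1 + v) ^ 2 := by fun_prop
    exact h1.contDiffOn.mul (ih.deriv_of_isOpen isOpen_Ioi (by simp))

lemma hasDerivAt_conformalDeriv (hψ : ContDiffOn ℝ (⊤ : ℕ∞) ψ (Ioi 0)) (k : ℕ) {v : ℝ}
    (hv : 0 < v) :
    HasDerivAt (conformalDeriv ψ k) (conformalDeriv ψ (k + 1) v / (1 + v) ^ 2) v := by
  have h1 : DifferentiableAt ℝ (conformalDeriv ψ k) v :=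
    ((contDiffOn_conformalDeriv hψ k).contDiffAt (Ioi_mem_nhds hv)).differentiableAt (by simp)
  refine h1.hasDerivAt.congr_deriv ?_
  simp only [conformalDeriv]
  field_simp

lemma contDiffOn_iteratedDeriv_Ioi (hψ : ContDiffOn ℝ (⊤ : ℕ∞) ψ (Ioi 0)) (k : ℕ) :
    ContDiffOn ℝ (⊤ : ℕ∞) (iteratedDeriv k ψ) (Ioi 0) := by
  induction k with
  | zero => simpa using hψ
  | succ k ih =>
    rw [iteratedDeriv_succ]
    exact ih.deriv_of_isOpen isOpen_Ioi (by simp)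

lemma hasDerivAt_iteratedDeriv_Ioi (hψ : ContDiffOn ℝ (⊤ : ℕ∞) ψ (Ioi 0)) (k : ℕ) {v : ℝ}
    (hv : 0 < v) : HasDerivAt (iteratedDeriv k ψ) (iteratedDeriv (k + 1) ψ v) v := by
  have h1 : DifferentiableAt ℝ (iteratedDeriv k ψ) v :=
    ((contDiffOn_iteratedDeriv_Ioi hψ k).contDiffAt (Ioi_mem_nhds hv)).differentiableAt (by simp)
  rw [iteratedDeriv_succ]
  exact h1.hasDerivAt

end Smooth

/-- Reindexing used to expand derivatives of sums in a triangular basis. -/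
lemma sum_range_triangular_succ (L u Y : ℕ → ℝ) (a : ℕ) (hL : L (a + 1) = 0) :
    ∑ k ∈ Finset.range (a + 1), L k * (u k * Y k + Y (k + 1))
      = ∑ k ∈ Finset.range (a + 2), (L k * u k + if k = 0 then 0 else L (k - 1)) * Y k := by
  have h1 : ∑ k ∈ Finset.range (a + 2), L k * u k * Y k
      = ∑ k ∈ Finset.range (a + 1), L k * u k * Y k := by
    rw [Finset.sum_range_succ, hL]
    ring
  have h2 : ∑ k ∈ Finset.range (a + 2), (if k = 0 then 0 else L (k - 1)) * Y k
      = ∑ k ∈ Finset.range (a + 1), L k * Y (k + 1) := by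
    rw [Finset.sum_range_succ']
    simp
  simp only [add_mul, Finset.sum_add_distrib]
  rw [h1, h2, ← Finset.sum_add_distrib]
  exact Finset.sum_congr rfl fun k _ => by ring

lemma iteratedDeriv_eq_sum_conformalDeriv (a : ℕ) :
    ∃ L : ℕ → ℝ, L a = 1 ∧ (∀ k > a, L k = 0) ∧ ∀ ψ : ℝ → ℝ,
      ContDiffOn ℝ (⊤ : ℕ∞) ψ (Ioi 0) → ∀ v > (0 : ℝ), iteratedDeriv a ψ v
        = ∑ k ∈ Finset.range (a + 1), L k * (((1 + v) ^ (a + k))⁻¹ * conformalDeriv ψ k v) := by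
  induction a with
  | zero =>
    refine ⟨fun k => if k = 0 then 1 else 0, by simp, fun k hk => if_neg (by omega), ?_⟩
    intro ψ _ v _
    simp [conformalDeriv]
  | succ a ih =>
    obtain ⟨L, hLa, hL0, hL⟩ := ih
    refine ⟨fun k => L k * (-((a : ℝ) + k)) + if k = 0 then 0 else L (k - 1), ?_, ?_, ?_⟩
    · simp [hL0, hLa]
    · intro k hk
      have h1 : k ≠ 0 := by omega
      simp [h1, hL0 k (by omega), hL0 (k - 1) (by omega)]
    · intro ψ hψ v hv
      have hd : HasDerivAt (fun v => ∑ k ∈ Finset.range (a + 1),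
          L k * (((1 + v) ^ (a + k))⁻¹ * conformalDeriv ψ k v))
          (∑ k ∈ Finset.range (a + 1), L k *
            ((-((a : ℝ) + k)) * (((1 + v) ^ (a + 1 + k))⁻¹ * conformalDeriv ψ k v)
              + ((1 + v) ^ (a + 1 + (k + 1)))⁻¹ * conformalDeriv ψ (k + 1) v)) v := by
        refine HasDerivAt.fun_sum fun k _ => HasDerivAt.const_mul _ ?_
        have h1 : HasDerivAt (fun v : ℝ => 1 + v) 1 v := (hasDerivAt_id v).const_add 1
        have h3 : (1 + v) ≠ 0 := by positivity
        have h2 := ((h1.pow (a + k)).inv (pow_ne_zero _ h3)).mul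
          (hasDerivAt_conformalDeriv hψ k hv)
        refine h2.congr_deriv ?_
        simp only [Pi.pow_apply, Pi.inv_apply]
        rcases Nat.eq_zero_or_pos (a + k) with h0 | h0
        · obtain ⟨rfl, rfl⟩ : a = 0 ∧ k = 0 := by omega
          simp
          field_simp
        · obtain ⟨j, hj⟩ : ∃ j, a + k = j + 1 := ⟨a + k - 1, by omega⟩
          rw [show a + 1 + k = j + 2 by omega, show a + 1 + (k + 1) = j + 3 by omega, hj,
            ← Nat.cast_add, hj]
          simp only [Nat.add_sub_cancel]
          field_simp
          ring
      have heq : iteratedDeriv a ψ =ᶠ[nhds v] fun v => ∑ k ∈ Finset.range (a + 1),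
          L k * (((1 + v) ^ (a + k))⁻¹ * conformalDeriv ψ k v) := by
        filter_upwards [Ioi_mem_nhds hv] with w hw using hL ψ hψ w hw
      rw [(hasDerivAt_iteratedDeriv_Ioi hψ a hv).unique (hd.congr_of_eventuallyEq heq)]
      exact sum_range_triangular_succ L (fun k => -((a : ℝ) + k))
        (fun k => ((1 + v) ^ (a + 1 + k))⁻¹ * conformalDeriv ψ k v) a (hL0 _ (by omega))

lemma conformalDeriv_eq_sum_iteratedDeriv (a : ℕ) :
    ∃ L : ℕ → ℝ, (∀ k > a, L k = 0) ∧ ∀ ψ : ℝ → ℝ,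
      ContDiffOn ℝ (⊤ : ℕ∞) ψ (Ioi 0) → ∀ v > (0 : ℝ), conformalDeriv ψ a v
        = ∑ k ∈ Finset.range (a + 1), L k * ((1 + v) ^ (a + k) * iteratedDeriv k ψ v) := by
  induction a with
  | zero =>
    refine ⟨fun k => if k = 0 then 1 else 0, fun k hk => if_neg (by omega), ?_⟩
    intro ψ _ v _
    simp [conformalDeriv]
  | succ a ih =>
    obtain ⟨L, hL0, hL⟩ := ih
    refine ⟨fun k => L k * ((a : ℝ) + k) + if k = 0 then 0 else L (k - 1), ?_, ?_⟩
    · intro k hk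
      have h1 : k ≠ 0 := by omega
      simp [h1, hL0 k (by omega), hL0 (k - 1) (by omega)]
    · intro ψ hψ v hv
      have hd : HasDerivAt (fun v => ∑ k ∈ Finset.range (a + 1),
          L k * ((1 + v) ^ (a + k) * iteratedDeriv k ψ v))
          (∑ k ∈ Finset.range (a + 1), L k *
            (((a : ℝ) + k) * (1 + v) ^ (a + k - 1) * iteratedDeriv k ψ v
              + (1 + v) ^ (a + k) * iteratedDeriv (k + 1) ψ v)) v := by
        refine HasDerivAt.fun_sum fun k _ => HasDerivAt.const_mul _ ?_
        have h1 : HasDerivAt (fun v : ℝ => 1 + v) 1 v := (hasDerivAt_id v).const_add 1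
        have h2 := (h1.pow (a + k)).mul (hasDerivAt_iteratedDeriv_Ioi hψ k hv)
        refine h2.congr_deriv ?_
        simp
      have heq : conformalDeriv ψ a =ᶠ[nhds v] fun v => ∑ k ∈ Finset.range (a + 1),
          L k * ((1 + v) ^ (a + k) * iteratedDeriv k ψ v) := by
        filter_upwards [Ioi_mem_nhds hv] with w hw using hL ψ hψ w hw
      have h3 := (hasDerivAt_conformalDeriv hψ a hv).unique (hd.congr_of_eventuallyEq heq)
      rw [div_eq_iff (by positivity)] at h3
      rw [h3, ← sum_range_triangular_succ L (fun k => (a : ℝ) + k)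
        (fun k => (1 + v) ^ (a + 1 + k) * iteratedDeriv k ψ v) a (hL0 _ (by omega)),
        Finset.sum_mul]
      refine Finset.sum_congr rfl fun k _ => ?_
      rcases Nat.eq_zero_or_pos (a + k) with h0 | h0
      · obtain ⟨rfl, rfl⟩ : a = 0 ∧ k = 0 := by omega
        simp
        ring
      · obtain ⟨j, hj⟩ : ∃ j, a + k = j + 1 := ⟨a + k - 1, by omega⟩
        rw [show a + 1 + k = j + 2 by omega, show a + 1 + (k + 1) = j + 3 by omega, hj]
        simp only [Nat.add_sub_cancel]
        ring

lemma exists_conformalDeriv_one_sq_le (a : ℕ) :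
    ∃ C : ℝ, 0 ≤ C ∧ ∀ ψ : ℝ → ℝ, ContDiffOn ℝ (⊤ : ℕ∞) ψ (Ioi 0) →
      conformalDeriv ψ a 1 ^ 2 ≤ C * ∑ k ∈ Finset.range (a + 1), iteratedDeriv k ψ 1 ^ 2 := by
  obtain ⟨L, -, hL⟩ := conformalDeriv_eq_sum_iteratedDeriv a
  refine ⟨∑ k ∈ Finset.range (a + 1), (L k * 2 ^ (a + k)) ^ 2,
    Finset.sum_nonneg fun k _ => sq_nonneg _, fun ψ hψ => ?_⟩
  rw [hL ψ hψ 1 one_pos]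
  refine le_trans (le_of_eq ?_) (Finset.sum_mul_sq_le_sq_mul_sq (Finset.range (a + 1))
    (fun k => L k * 2 ^ (a + k)) fun k => iteratedDeriv k ψ 1)
  congr 1
  refine Finset.sum_congr rfl fun k _ => ?_
  norm_num
  ring

/-- The Gegenbauer equations satisfied by the conformal derivatives of a solution. -/
lemma SolvesWaveODE.conformalDeriv_eq_zero {m : ℕ} {lam : ℝ} {ψ : ℝ → ℝ}
    (hψ : ContDiffOn ℝ (⊤ : ℕ∞) ψ (Ioi 0)) (hode : SolvesWaveODE (m + m) lam ψ) (k : ℕ) :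
    ∀ v > (0 : ℝ), v / (1 + v) ^ 2 * conformalDeriv ψ (k + 2) v
      - ((m : ℝ) - 1 - k) * ((1 - v) / (1 + v)) * conformalDeriv ψ (k + 1) v
      + (lam ^ 2 + k * (2 * m - 1 - k)) * conformalDeriv ψ k v = 0 := by
  induction k with
  | zero =>
    intro v hv
    have h1 : HasDerivAt (conformalDeriv ψ 1)
        (2 * (1 + v) * iteratedDeriv 1 ψ v + (1 + v) ^ 2 * iteratedDeriv 2 ψ v) v := by
      have e1 : HasDerivAt (fun v : ℝ => (1 + v) ^ 2) (2 * (1 + v)) v := by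
        exact (((hasDerivAt_id v).const_add 1).pow 2).congr_deriv (by simp)
      have e2 := e1.mul (hasDerivAt_iteratedDeriv_Ioi hψ 1 hv)
      rwa [iteratedDeriv_one] at e2 ⊢
    have h2 := (hasDerivAt_conformalDeriv hψ 1 hv).unique h1
    rw [div_eq_iff (by positivity)] at h2
    have h3 := hode v hv
    rw [iteratedDeriv_one] at h2
    have h4 : conformalDeriv ψ (0 + 1) v = (1 + v) ^ 2 * deriv ψ v := rfl
    have h5 : conformalDeriv ψ 0 v = ψ v := rfl
    have h6 : conformalDeriv ψ (0 + 2) v = conformalDeriv ψ (1 + 1) v := rfl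
    rw [h4, h5, h6, h2]
    have h7 : (1 + v) ≠ 0 := by positivity
    rw [← h3]
    push_cast
    field_simp
    ring
  | succ k ih =>
    intro v hv
    have h7 : (1 + v) ≠ 0 := by positivity
    have e0 : HasDerivAt (fun v : ℝ => 1 + v) 1 v := (hasDerivAt_id v).const_add 1
    have e1 : HasDerivAt (fun v : ℝ => v / (1 + v) ^ 2) ((1 - v) / (1 + v) ^ 3) v := by
      refine ((hasDerivAt_id v).div (e0.pow 2) (pow_ne_zero _ h7)).congr_deriv ?_
      simp only [id, Pi.pow_apply]
      field_simp
      norm_num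
      ring
    have e2 : HasDerivAt (fun v : ℝ => (1 - v) / (1 + v)) (-2 / (1 + v) ^ 2) v := by
      refine (((hasDerivAt_id v).const_sub 1).div e0 h7).congr_deriv ?_
      simp only [id]
      field_simp
      ring
    have e3 := ((e1.mul (hasDerivAt_conformalDeriv hψ (k + 2) hv)).sub
      ((e2.const_mul ((m : ℝ) - 1 - k)).mul (hasDerivAt_conformalDeriv hψ (k + 1) hv))).add
      ((hasDerivAt_conformalDeriv hψ k hv).const_mul (lam ^ 2 + k * (2 * m - 1 - k)))
    have e4 : HasDerivAt (fun _ : ℝ => (0 : ℝ)) 0 v := hasDerivAt_const v 0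
    have e5 := e3.unique (e4.congr_of_eventuallyEq (by
      filter_upwards [Ioi_mem_nhds hv] with w hw using ih w hw))
    have e6 := congrArg (fun x => (1 + v) ^ 2 * x) e5
    simp only [mul_zero] at e6
    rw [← e6]
    push_cast
    rw [show k + 1 + 2 = k + 2 + 1 by ring, show k + 1 + 1 = k + 2 by ring]
    field_simp
    ring

/-- For bounded frequencies a solution is controlled on `(0, 1]` by its data at `1`. -/
lemma SolvesWaveODE.sq_le_of_le_one {m : ℕ} (hm : 1 ≤ m) {lam : ℝ} {ψ : ℝ → ℝ}
    (hψ : ContDiffOn ℝ (⊤ : ℕ∞) ψ (Ioi 0)) (hode : SolvesWaveODE (m + m) lam ψ)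
    (hlam : lam ^ 2 ≤ 1) {v : ℝ} (hv : v ∈ Ioc (0 : ℝ) 1) :
    ψ v ^ 2 ≤ 81 * (ψ 1 ^ 2 + conformalDeriv ψ 1 1 ^ 2) := by
  have hm' : (1 : ℝ) ≤ m := by exact_mod_cast hm
  have hE := mul_exp_le_mul_exp_of_neg_mul_le_deriv
    (G := fun x => x * conformalDeriv ψ 1 x ^ 2 + conformalDeriv ψ 0 x ^ 2)
    (G' := fun x => (1 + 2 * ((m - 1) * ((1 - x) / (1 + x)))) * conformalDeriv ψ 1 x ^ 2
      + 2 * (((1 + x) ^ 2)⁻¹ - lam ^ 2) * (conformalDeriv ψ 0 x * conformalDeriv ψ 1 x))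
    (c := fun x => 4 * x) (c' := fun _ => 4) hv.2 (fun x hx => by
      have hx0 : 0 < x := hv.1.trans_le hx.1
      have h1 := SolvesWaveODE.conformalDeriv_eq_zero hψ hode 0 x hx0
      have h2 := ((hasDerivAt_id x).mul ((hasDerivAt_conformalDeriv hψ 1 hx0).pow 2)).add
        ((hasDerivAt_conformalDeriv hψ 0 hx0).pow 2)
      refine h2.congr_deriv ?_
      simp only [id, Pi.pow_apply, Nat.cast_zero, zero_mul, add_zero, sub_zero, zero_add,
        Nat.cast_ofNat, Nat.reduceAdd, Nat.add_one_sub_one, pow_one, one_mul] at h1 ⊢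
      linear_combination 2 * conformalDeriv ψ 1 x * h1) (fun x _ => by
      simpa using (hasDerivAt_id x).const_mul 4) (fun x hx => by
      have hx0 : 0 < x := hv.1.trans_le hx.1
      have h1 : 0 ≤ (m - 1) * ((1 - x) / (1 + x)) :=
        mul_nonneg (by linarith) (div_nonneg (by linarith [hx.2]) (by linarith))
      have h2 : ((1 + x) ^ 2)⁻¹ ≤ 1 := inv_le_one_of_one_le₀ (by nlinarith)
      have h3 : 0 ≤ ((1 + x) ^ 2)⁻¹ := by positivity
      set q := ((1 + x) ^ 2)⁻¹ - lam ^ 2 with hq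
      have h4 : q ^ 2 ≤ 1 := by nlinarith [sq_nonneg lam]
      have h5 : 0 ≤ (conformalDeriv ψ 1 x + q * conformalDeriv ψ 0 x) ^ 2 := sq_nonneg _
      have h6 := mul_le_mul_of_nonneg_right h4 (sq_nonneg (conformalDeriv ψ 0 x))
      have h7 := mul_nonneg h1 (sq_nonneg (conformalDeriv ψ 1 x))
      have h8 : 0 ≤ x * conformalDeriv ψ 1 x ^ 2 := by positivity
      nlinarith [sq_nonneg (conformalDeriv ψ 0 x)])
  have he : Real.exp (4 * 1) ≤ 81 := by
    have h1 : Real.exp (4 * 1) = Real.exp 1 ^ 4 := by rw [← Real.exp_nat_mul]; norm_num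
    rw [h1]
    calc Real.exp 1 ^ 4 ≤ 3 ^ 4 :=
          pow_le_pow_left₀ (Real.exp_pos 1).le (by linarith [Real.exp_one_lt_d9]) 4
      _ = 81 := by norm_num
  have he1 : 1 ≤ Real.exp (4 * v) := Real.one_le_exp (by linarith [hv.1])
  have h1 : 0 ≤ v * conformalDeriv ψ 1 v ^ 2 := mul_nonneg hv.1.le (sq_nonneg _)
  have h2 : conformalDeriv ψ 0 = ψ := rfl
  rw [h2] at hE
  simp only [one_mul] at hE
  nlinarith [sq_nonneg (ψ v), sq_nonneg (ψ 1), sq_nonneg (conformalDeriv ψ 1 1)]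

/-- Logarithmic asymptotics of the conformal derivatives of a solution, with the recursive
relations between their values at `0` and uniform bounds on the logarithmic coefficients. -/
lemma SolvesWaveODE.exists_logAsymp_conformalDeriv {m : ℕ} (hm : 1 ≤ m) {lam κ S : ℝ}
    {ψ : ℝ → ℝ} (hψ : ContDiffOn ℝ (⊤ : ℕ∞) ψ (Ioi 0)) (hode : SolvesWaveODE (m + m) lam ψ)
    (hκ : 1 ≤ κ) (hκsq : κ ^ 2 = lam ^ 2 + m * (m - 1)) (hS : 0 ≤ S)
    (hdata : κ⁻¹ * conformalDeriv ψ (m + 1) 1 ^ 2 + κ * conformalDeriv ψ m 1 ^ 2 ≤ S ^ 2) :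
    ∃ A B : ℝ, ∃ d : ℕ → ℝ, LogAsymp (conformalDeriv ψ m) A B ∧
      LogAsymp (fun v => v * conformalDeriv ψ (m + 1) v) 0 A ∧
      (∀ k < m, LogAsymp (conformalDeriv ψ k) 0 (d k)) ∧
      |A| ≤ 324 * S ∧ |B - 2 * A * Real.log κ| ≤ 432 * S ∧
      κ ^ 2 * |d (m - 1)| = |A| ∧
      ∀ k, k + 1 < m → (lam ^ 2 + k * (2 * m - 1 - k)) * d k = (m - 1 - k) * d (k + 1) := by
  obtain ⟨l, rfl⟩ : ∃ l, m = l + 1 := ⟨m - 1, by omega⟩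
  have hκ0 : 0 < κ := by linarith
  have hP_eq : ∀ v > (0 : ℝ), v * conformalDeriv ψ (l + 2) v / (1 + v) ^ 2
      = -κ ^ 2 * conformalDeriv ψ l v := by
    intro v hv
    have h1 := SolvesWaveODE.conformalDeriv_eq_zero hψ hode l v hv
    rw [hκsq]
    push_cast at h1 ⊢
    linear_combination h1
  obtain ⟨A, B, hWas, hPas, hA, hB⟩ := legendre_log_asymptotics (W := conformalDeriv ψ (l + 1))
    (P := fun v => -κ ^ 2 * conformalDeriv ψ l v) hκ hS (fun v hv => by
      refine (hasDerivAt_conformalDeriv hψ (l + 1) hv).congr_deriv ?_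
      have h1 := hP_eq v hv
      rw [← h1]
      have : v ≠ 0 := ne_of_gt hv
      field_simp) (fun v hv => by
      refine ((hasDerivAt_conformalDeriv hψ l hv).const_mul _).congr_deriv ?_
      ring) (by
      refine le_trans ?_ hdata
      have h1 := hP_eq 1 one_pos
      rw [← h1]
      have h2 : 0 < κ⁻¹ := inv_pos.2 hκ0
      have h3 : κ⁻¹ * (1 * conformalDeriv ψ (l + 2) 1 / (1 + 1) ^ 2) ^ 2
          = κ⁻¹ * conformalDeriv ψ (l + 1 + 1) 1 ^ 2 / 16 := by ring
      have h4 : 0 ≤ κ⁻¹ * conformalDeriv ψ (l + 1 + 1) 1 ^ 2 := by positivity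
      rw [h3]
      linarith)
  have hdown : ∀ j ≤ l, ∃ d, LogAsymp (conformalDeriv ψ (l - j)) 0 d := by
    intro j
    induction j with
    | zero =>
      intro _
      have h1 := hPas.const_mul (-(κ ^ 2)⁻¹)
      rw [mul_zero] at h1
      refine ⟨_, h1.congr fun v _ => ?_⟩
      rw [Nat.sub_zero]
      field_simp
    | succ j ih =>
      intro hj
      obtain ⟨d, hd⟩ := ih (by omega)
      rw [show l - j = l - (j + 1) + 1 by omega] at hd
      exact hd.exists_of_hasDerivAt fun v hv => hasDerivAt_conformalDeriv hψ _ hv.1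
  have hex : ∀ k, ∃ d, k < l + 1 → LogAsymp (conformalDeriv ψ k) 0 d := by
    intro k
    by_cases hk : k < l + 1
    · obtain ⟨d, hd⟩ := hdown (l - k) (by omega)
      rw [show l - (l - k) = k by omega] at hd
      exact ⟨d, fun _ => hd⟩
    · exact ⟨0, fun h => absurd h hk⟩
  choose d hd using hex
  have hdA : -κ ^ 2 * d l = A := by
    have h1 := (hd l (by omega)).const_mul (-κ ^ 2)
    rw [mul_zero] at h1
    exact h1.unique hPas
  refine ⟨A, B, d, hWas, ?_, hd, hA, hB, ?_, fun k hk => ?_⟩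
  · have h1 := hPas.mul_left (g := fun v => (1 + v) ^ 2) (g₀ := 1) (Kg := 3) (fun v hv => by
      have hv0 := hv.1
      have hv1 := hv.2
      rw [abs_of_nonneg (by nlinarith)]
      nlinarith)
    rw [one_mul, one_mul] at h1
    refine h1.congr fun v hv => ?_
    have hv0 := hv.1
    rw [← hP_eq v hv0]
    field_simp
  · rw [← hdA, abs_mul, abs_neg, abs_of_nonneg (sq_nonneg κ), Nat.add_sub_cancel]
  · have h1 : LogAsymp (fun v => v * conformalDeriv ψ (k + 2) v) 0 0 := by
      rcases Nat.lt_or_ge (k + 2) (l + 1) with h | h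
      · exact (hd _ h).id_mul
      · obtain rfl : l = k + 1 := by omega
        exact hWas.id_mul
    have h2 := (h1.inv_one_add_pow_mul 2).const_mul (-1)
    have h3 := (hd (k + 1) (by omega)).mul_left (g := fun v => (1 - v) / (1 + v)) (g₀ := 1)
      (Kg := 2) (fun v hv => by
        have hv0 := hv.1
        have : (1 - v) / (1 + v) - 1 = -(2 * v / (1 + v)) := by
          field_simp
          ring
        rw [this, abs_neg, abs_of_pos (by positivity)]
        exact div_le_self (by positivity) (by linarith))
    have h4 := (h3.const_mul (((l + 1 : ℕ) : ℝ) - 1 - k)).add h2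
    have h5 := (hd k (by omega)).const_mul (lam ^ 2 + k * (2 * ((l + 1 : ℕ) : ℝ) - 1 - k))
    have h6 := h5.congr (g := fun v => (((l + 1 : ℕ) : ℝ) - 1 - k)
        * ((1 - v) / (1 + v) * conformalDeriv ψ (k + 1) v)
        + -1 * (((1 + v) ^ 2)⁻¹ * (v * conformalDeriv ψ (k + 2) v))) fun v hv => by
      have h7 := SolvesWaveODE.conformalDeriv_eq_zero hψ hode k v hv.1
      rw [div_eq_mul_inv v] at h7
      linear_combination -h7
    simp only [mul_zero, add_zero, one_mul] at h4 h6
    exact h6.unique h4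

/-- The recursion for the values at `0` turns a bound on the logarithmic coefficient into
frequency-weighted bounds on the Taylor coefficients of positive order. -/
lemma pow_mul_abs_le_of_recursion {m : ℕ} {lam κ A : ℝ} {d : ℕ → ℝ} (hm : 2 ≤ m)
    (hκsq : κ ^ 2 = lam ^ 2 + m * (m - 1)) (hA : κ ^ 2 * |d (m - 1)| = |A|)
    (hrec : ∀ k, k + 1 < m →
      (lam ^ 2 + k * (2 * m - 1 - k)) * d k = (m - 1 - k) * d (k + 1)) {k : ℕ} (hk : 1 ≤ k)
    (hkm : k < m) : (1 + lam ^ 2) ^ (m - k) * |d k| ≤ m ^ m * |A| := by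
  have hm' : (2 : ℝ) ≤ m := by exact_mod_cast hm
  have hstep : ∀ j, j + 1 < m → (1 + lam ^ 2) ^ (j + 1) * |d (m - (j + 1))| ≤ m ^ j * |A| := by
    intro j
    induction j with
    | zero =>
      intro _
      rw [zero_add, pow_one, pow_zero, one_mul, ← hA]
      exact mul_le_mul_of_nonneg_right (by nlinarith) (abs_nonneg _)
    | succ j ih =>
      intro hj
      have h1 := ih (by omega)
      have h2 := hrec (m - (j + 2)) (by omega)
      have hi1 : 1 ≤ m - (j + 2) := by omega
      rw [show m - (j + 1) = m - (j + 2) + 1 by omega] at h1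
      rw [show m - (j + 1 + 1) = m - (j + 2) by omega]
      have hil : m - (j + 2) + 2 ≤ m := by omega
      generalize m - (j + 2) = i at *
      have hi : (1 : ℝ) ≤ i := by exact_mod_cast hi1
      have him : (i : ℝ) + 2 ≤ m := by exact_mod_cast hil
      have h3 : 1 + lam ^ 2 ≤ lam ^ 2 + i * (2 * m - 1 - i) := by nlinarith
      have h4 := congrArg abs h2
      rw [abs_mul, abs_mul, abs_of_nonneg (by nlinarith [sq_nonneg lam]),
        abs_of_nonneg (by linarith : (0 : ℝ) ≤ m - 1 - i)] at h4
      have h5 : (1 + lam ^ 2) * |d i| ≤ m * |d (i + 1)| :=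
        calc (1 + lam ^ 2) * |d i| ≤ (lam ^ 2 + i * (2 * m - 1 - i)) * |d i| :=
              mul_le_mul_of_nonneg_right h3 (abs_nonneg _)
          _ = (m - 1 - i) * |d (i + 1)| := h4
          _ ≤ m * |d (i + 1)| := mul_le_mul_of_nonneg_right (by linarith) (abs_nonneg _)
      calc (1 + lam ^ 2) ^ (j + 1 + 1) * |d i|
          = (1 + lam ^ 2) ^ (j + 1) * ((1 + lam ^ 2) * |d i|) := by ring
        _ ≤ (1 + lam ^ 2) ^ (j + 1) * (m * |d (i + 1)|) :=
            mul_le_mul_of_nonneg_left h5 (by positivity)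
        _ = m * ((1 + lam ^ 2) ^ (j + 1) * |d (i + 1)|) := by ring
        _ ≤ m * (m ^ j * |A|) := mul_le_mul_of_nonneg_left h1 (by positivity)
        _ = m ^ (j + 1) * |A| := by ring
  obtain ⟨j, rfl⟩ : ∃ j, k = m - (j + 1) := ⟨m - k - 1, by omega⟩
  have h1 := hstep j (by omega)
  rw [show m - (m - (j + 1)) = j + 1 by omega]
  refine h1.trans (mul_le_mul_of_nonneg_right ?_ (abs_nonneg _))
  exact pow_le_pow_right₀ (by linarith) (by omega)

/-- The value at `0` of a solution, weighted by the frequency, is controlled by the logarithmic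
coefficient (for high frequencies) and by the data at `1` (for low frequencies). -/
lemma SolvesWaveODE.pow_mul_abs_le {m : ℕ} (hm : 2 ≤ m) {lam κ A S : ℝ} {ψ : ℝ → ℝ} {d : ℕ → ℝ}
    (hψ : ContDiffOn ℝ (⊤ : ℕ∞) ψ (Ioi 0)) (hode : SolvesWaveODE (m + m) lam ψ)
    (hκsq : κ ^ 2 = lam ^ 2 + m * (m - 1)) (hA : κ ^ 2 * |d (m - 1)| = |A|)
    (hrec : ∀ k, k + 1 < m →
      (lam ^ 2 + k * (2 * m - 1 - k)) * d k = (m - 1 - k) * d (k + 1))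
    (h0 : LogAsymp ψ 0 (d 0)) (hS : 0 ≤ S)
    (hdata : ψ 1 ^ 2 + conformalDeriv ψ 1 1 ^ 2 ≤ S ^ 2) :
    (1 + lam ^ 2) ^ m * |d 0| ≤ 2 * m * m ^ m * |A| + 2 ^ m * (9 * S) := by
  have hm' : (2 : ℝ) ≤ m := by exact_mod_cast hm
  rcases le_total (lam ^ 2) 1 with hlam | hlam
  · have h1 : |d 0| ≤ 9 * S := by
      refine le_of_tendsto h0.tendsto.abs ?_
      filter_upwards [Ioc_mem_nhdsGT (zero_lt_one' ℝ)] with v hv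
      have := SolvesWaveODE.sq_le_of_le_one (by omega) hψ hode hlam hv
      exact abs_le_of_sq_le_sq (by nlinarith) (by positivity)
    have h2 : (1 + lam ^ 2) ^ m ≤ 2 ^ m := pow_le_pow_left₀ (by positivity) (by linarith) m
    have h3 : 0 ≤ 2 * m * m ^ m * |A| := by positivity
    have h4 := mul_le_mul h2 h1 (abs_nonneg _) (by positivity)
    linarith
  · have h1 := hrec 0 (by omega)
    have h2 := pow_mul_abs_le_of_recursion hm hκsq hA hrec le_rfl (by omega : 1 < m)
    have h3 := congrArg abs h1
    simp only [Nat.cast_zero, zero_mul, add_zero, sub_zero, zero_add] at h3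
    rw [abs_mul, abs_mul, abs_of_nonneg (sq_nonneg lam),
      abs_of_nonneg (by linarith : (0 : ℝ) ≤ m - 1)] at h3
    have h4 : (1 + lam ^ 2) * |d 0| ≤ 2 * m * |d 1| := by
      nlinarith [abs_nonneg (d 0), abs_nonneg (d 1)]
    have h5 : 0 ≤ 2 ^ m * (9 * S) := by positivity
    calc (1 + lam ^ 2) ^ m * |d 0| = (1 + lam ^ 2) ^ (m - 1) * ((1 + lam ^ 2) * |d 0|) := by
          rw [← mul_assoc, ← pow_succ, show m - 1 + 1 = m by omega]
      _ ≤ (1 + lam ^ 2) ^ (m - 1) * (2 * m * |d 1|) :=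
          mul_le_mul_of_nonneg_left h4 (by positivity)
      _ = 2 * m * ((1 + lam ^ 2) ^ (m - 1) * |d 1|) := by ring
      _ ≤ 2 * m * (m ^ m * |A|) := mul_le_mul_of_nonneg_left h2 (by positivity)
      _ ≤ 2 * m * m ^ m * |A| + 2 ^ m * (9 * S) := by linarith

/-- The extension by the limiting value at `0` of a solution with logarithmic asymptotics has
asymptotic data. -/
lemma SolvesWaveODE.hasAsymptoticDataODE {m : ℕ} (hm : 1 ≤ m) {lam A B : ℝ} {ψ : ℝ → ℝ}
    {d L : ℕ → ℝ}
    (hψ : ContDiffOn ℝ (⊤ : ℕ∞) ψ (Ioi 0)) (hode : SolvesWaveODE (m + m) lam ψ)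
    (hW : LogAsymp (conformalDeriv ψ m) A B)
    (hP : LogAsymp (fun v => v * conformalDeriv ψ (m + 1) v) 0 A)
    (hd : ∀ k < m, LogAsymp (conformalDeriv ψ k) 0 (d k)) (hLm : L m = 1)
    (hL : ∀ v > (0 : ℝ), iteratedDeriv m ψ v
      = ∑ k ∈ Finset.range (m + 1), L k * (((1 + v) ^ (m + k))⁻¹ * conformalDeriv ψ k v)) :
    HasAsymptoticDataODE (m + m) lam (Function.update ψ 0 (d 0)) (d 0) (2 * A)
      (∑ k ∈ Finset.range m, L k * d k + B) := by
  have heq : ∀ v > (0 : ℝ), Function.update ψ 0 (d 0) v = ψ v :=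
    fun v hv => Function.update_of_ne (ne_of_gt hv) _ _
  have hev : ∀ v > (0 : ℝ), Function.update ψ 0 (d 0) =ᶠ[nhds v] ψ := fun v hv => by
    filter_upwards [Ioi_mem_nhds hv] with w hw using heq w hw
  have hit : ∀ a, ∀ v > (0 : ℝ),
      iteratedDeriv a (Function.update ψ 0 (d 0)) v = iteratedDeriv a ψ v :=
    fun a v hv => (hev v hv).iteratedDeriv_eq a
  have hmain : LogAsymp (iteratedDeriv m ψ) A (∑ k ∈ Finset.range m, L k * d k + B) := by
    have h1 := LogAsymp.sum (Finset.range m) fun k hk =>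
      ((hd k (Finset.mem_range.1 hk)).inv_one_add_pow_mul (m + k)).const_mul (L k)
    have h2 := h1.add ((hW.inv_one_add_pow_mul (m + m)).const_mul (L m))
    rw [hLm] at h2
    simp only [mul_zero, Finset.sum_const_zero, zero_add, one_mul] at h2
    refine h2.congr fun v hv => ?_
    rw [hL v hv.1, Finset.sum_range_succ, hLm, one_mul]
  have hmain' : LogAsymp (fun v => v * iteratedDeriv (m + 1) ψ v) 0 A := by
    obtain ⟨L', hL'm, -, hL'⟩ := iteratedDeriv_eq_sum_conformalDeriv (m + 1)
    have h1 := LogAsymp.sum (C := fun _ => 0) (D := fun _ => 0) (Finset.range (m + 1))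
      (F := fun k v => L' k * (((1 + v) ^ (m + 1 + k))⁻¹ * (v * conformalDeriv ψ k v)))
      fun k hk => by
        have h2 : LogAsymp (fun v => v * conformalDeriv ψ k v) 0 0 := by
          rcases Nat.lt_succ_iff_lt_or_eq.1 (Finset.mem_range.1 hk) with h | rfl
          · exact (hd k h).id_mul
          · exact hW.id_mul
        simpa using (h2.inv_one_add_pow_mul (m + 1 + k)).const_mul (L' k)
    have h2 := h1.add (hP.inv_one_add_pow_mul (m + 1 + (m + 1)))
    simp only [Finset.sum_const_zero, zero_add] at h2
    refine h2.congr fun v hv => ?_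
    rw [hL' ψ hψ v hv.1, Finset.sum_range_succ, hL'm, mul_add, Finset.mul_sum]
    congr 1
    · exact Finset.sum_congr rfl fun k _ => by ring
    · ring
  refine ⟨?_, hψ.congr fun v hv => heq v hv, ?_, ?_, by simp, ?_⟩
  · intro v hv
    rcases eq_or_lt_of_le (show (0 : ℝ) ≤ v from hv) with rfl | hv0
    · rw [← continuousWithinAt_sdiff_self, Ici_sdiff_left]
      have h1 := (hd 0 (by omega)).tendsto
      rw [ContinuousWithinAt, Function.update_self]
      refine h1.congr' ?_
      filter_upwards [self_mem_nhdsWithin] with w hw using (heq w hw).symm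
    · have h1 := (hψ.contDiffAt (Ioi_mem_nhds hv0)).continuousAt
      exact (h1.congr (hev v hv0).symm).continuousWithinAt
  · intro v hv
    rw [hit 2 v hv, heq v hv, (hev v hv).deriv_eq]
    exact hode v hv
  · intro a ha
    obtain ⟨L', -, -, hL'⟩ := iteratedDeriv_eq_sum_conformalDeriv a
    have h1 := LogAsymp.sum (Finset.range (a + 1)) fun k hk =>
      ((hd k (by have := Finset.mem_range.1 hk; omega)).inv_one_add_pow_mul (a + k)).const_mul
        (L' k)
    simp only [mul_zero, Finset.sum_const_zero] at h1
    refine ⟨_, h1.tendsto.congr' ?_⟩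
    filter_upwards [self_mem_nhdsWithin] with v hv
    rw [hit a v hv, hL' ψ hψ v hv]
  · obtain ⟨K, hK, hKb⟩ := hmain
    obtain ⟨K', hK', hKb'⟩ := hmain'
    rw [show (m + m) / 2 = m by omega]
    refine ⟨K + K', by positivity, fun v hv => ?_⟩
    have hv0 := hv.1
    have h1 := hKb v hv
    have h2 := hKb' v hv
    have h3 : 0 ≤ v * (1 + Real.log v ^ 2) := by positivity
    rw [hit m v hv0, hit (m + 1) v hv0]
    constructor
    · rw [show (1 : ℝ) / 2 * (2 * A) = A by ring]
      nlinarith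
    · rw [zero_mul, sub_zero] at h2
      rw [show 2 * A / 2 = A by ring]
      nlinarith

set_option maxHeartbeats 1000000 in
/-- Asymptotic completeness and backward estimate for the self-similar wave ODE
(Proposition 4.5 of the paper, single-mode version). -/
theorem asymptotic_completeness_backward_waveODE (n : ℕ) (hn : Even n) (hn4 : 4 ≤ n) :
    ∃ C > 0, ∀ lam : ℝ, 0 ≤ lam → ∀ ψ : ℝ → ℝ,
      ContDiffOn ℝ (⊤ : ℕ∞) ψ (Ioi 0) →
      SolvesWaveODE n lam ψ →
      ∃ ψ' : ℝ → ℝ, ∃ O h : ℝ,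
        (∀ v > (0:ℝ), ψ' v = ψ v) ∧
        HasAsymptoticDataODE n lam ψ' (ψ' 0) O h ∧
        (h - O * Real.log (Real.sqrt (1 + lam ^ 2))) ^ 2
            + (1 + lam ^ 2) ^ n * (ψ' 0) ^ 2
          ≤ C * (Real.sqrt (1 + lam ^ 2)
              * ∑ a ∈ Finset.range (n / 2 + 1), iteratedDeriv a ψ 1 ^ 2
              + (Real.sqrt (1 + lam ^ 2))⁻¹ * iteratedDeriv (n / 2 + 1) ψ 1 ^ 2) := by
  obtain ⟨m, rfl⟩ := hn
  have hm : 2 ≤ m := by omega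
  have hm' : (2 : ℝ) ≤ m := by exact_mod_cast hm
  obtain ⟨L, hLm, -, hL⟩ := iteratedDeriv_eq_sum_conformalDeriv m
  obtain ⟨C₁, hC₁, hU₁⟩ := exists_conformalDeriv_one_sq_le 1
  obtain ⟨C₂, hC₂, hU₂⟩ := exists_conformalDeriv_one_sq_le m
  obtain ⟨C₃, hC₃, hU₃⟩ := exists_conformalDeriv_one_sq_le (m + 1)
  set c : ℝ := 1 + C₁ + m * C₂ + 2 * C₃ with hc
  have hc1 : 1 ≤ c := by
    have : 0 ≤ m * C₂ := by positivity
    linarith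
  set a₀ : ℝ := 2 * m * m ^ m * 324 + 2 ^ m * 9 with ha₀
  have ha₀0 : 0 ≤ a₀ := by positivity
  set a₁ : ℝ := 432 + 648 * m + (∑ k ∈ Finset.range m, |L k|) * a₀ with ha₁
  have hLsum : 0 ≤ ∑ k ∈ Finset.range m, |L k| := Finset.sum_nonneg fun k _ => abs_nonneg _
  have ha₁0 : 0 ≤ a₁ := by positivity
  refine ⟨(a₁ ^ 2 + a₀ ^ 2 + 1) * c, by positivity, fun lam _ ψ hψ hode => ?_⟩
  rw [show (m + m) / 2 = m by omega]
  set μ := √(1 + lam ^ 2) with hμ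
  have hμsq : μ ^ 2 = 1 + lam ^ 2 := Real.sq_sqrt (by positivity)
  have hμ1 : 1 ≤ μ := Real.one_le_sqrt.2 (by nlinarith [sq_nonneg lam])
  have hμ0 : 0 < μ := by linarith
  set κ := √(lam ^ 2 + m * (m - 1)) with hκ
  have hmm : (1 : ℝ) ≤ m * (m - 1) := by nlinarith
  have hκsq : κ ^ 2 = lam ^ 2 + m * (m - 1) :=
    Real.sq_sqrt (by nlinarith [sq_nonneg lam])
  have hμκ : μ ≤ κ := Real.sqrt_le_sqrt (by linarith)
  have hκ1 : 1 ≤ κ := hμ1.trans hμκ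
  have hκ0 : 0 < κ := by linarith
  have hκμ : κ ≤ m * μ := by
    apply abs_le_of_sq_le_sq' _ (by positivity) |>.2
    rw [mul_pow, hκsq, hμsq]
    nlinarith [sq_nonneg lam, mul_nonneg (by nlinarith : (0 : ℝ) ≤ m ^ 2 - 1) (sq_nonneg lam)]
  set N₀ := ∑ a ∈ Finset.range (m + 1), iteratedDeriv a ψ 1 ^ 2 with hN₀
  have hN₀0 : 0 ≤ N₀ := Finset.sum_nonneg fun k _ => sq_nonneg _
  set T := iteratedDeriv (m + 1) ψ 1 ^ 2 with hT
  have hT0 : 0 ≤ T := sq_nonneg _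
  set Q := μ * N₀ + μ⁻¹ * T with hQ
  have hμi0 : 0 < μ⁻¹ := inv_pos.2 hμ0
  have hμi1 : μ⁻¹ ≤ 1 := inv_le_one_of_one_le₀ hμ1
  have hTQ : 0 ≤ μ⁻¹ * T := by positivity
  have hNμ : N₀ ≤ μ * N₀ := by nlinarith
  have hQ0 : 0 ≤ Q := by positivity
  have hNQ : N₀ ≤ Q := by linarith
  set S := √(c * Q) with hS
  have hSsq : S ^ 2 = c * Q := Real.sq_sqrt (by positivity)
  have hS0 : 0 ≤ S := Real.sqrt_nonneg _
  have hdata : κ⁻¹ * conformalDeriv ψ (m + 1) 1 ^ 2 + κ * conformalDeriv ψ m 1 ^ 2 ≤ S ^ 2 := by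
    have h1 : κ * conformalDeriv ψ m 1 ^ 2 ≤ m * C₂ * Q :=
      calc κ * conformalDeriv ψ m 1 ^ 2 ≤ m * μ * (C₂ * N₀) :=
            mul_le_mul hκμ (hU₂ ψ hψ) (sq_nonneg _) (by positivity)
        _ = m * C₂ * (μ * N₀) := by ring
        _ ≤ m * C₂ * Q := mul_le_mul_of_nonneg_left (by linarith) (by positivity)
    have h2 : κ⁻¹ * conformalDeriv ψ (m + 1) 1 ^ 2 ≤ 2 * C₃ * Q := by
      have e1 := hU₃ ψ hψ
      rw [Finset.sum_range_succ] at e1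
      calc κ⁻¹ * conformalDeriv ψ (m + 1) 1 ^ 2 ≤ μ⁻¹ * (C₃ * (N₀ + T)) :=
            mul_le_mul (inv_anti₀ hμ0 hμκ) e1 (sq_nonneg _) hμi0.le
        _ = C₃ * (μ⁻¹ * N₀ + μ⁻¹ * T) := by ring
        _ ≤ C₃ * (2 * Q) := by
            refine mul_le_mul_of_nonneg_left ?_ hC₃
            nlinarith
        _ = 2 * C₃ * Q := by ring
    have h3 := mul_nonneg hC₁ hQ0
    rw [hSsq, hc]
    linarith
  have hdata₁ : ψ 1 ^ 2 + conformalDeriv ψ 1 1 ^ 2 ≤ S ^ 2 := by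
    have h1 : ψ 1 ^ 2 ≤ N₀ := by
      have := Finset.single_le_sum (f := fun a => iteratedDeriv a ψ 1 ^ 2)
        (fun a _ => sq_nonneg _) (Finset.mem_range.2 (Nat.succ_pos m))
      simpa using this
    have h2 : conformalDeriv ψ 1 1 ^ 2 ≤ C₁ * N₀ := by
      refine (hU₁ ψ hψ).trans (mul_le_mul_of_nonneg_left ?_ hC₁)
      refine Finset.sum_le_sum_of_subset_of_nonneg ?_ fun a _ _ => sq_nonneg _
      exact Finset.range_subset_range.2 (by omega)
    have h3 := mul_le_mul_of_nonneg_left hNQ hC₁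
    have h4 : 0 ≤ (m * C₂ + 2 * C₃) * Q := by positivity
    rw [hSsq, hc]
    linarith
  obtain ⟨A, B, d, hW, hP, hd, hA, hB, hdA, hrec⟩ :=
    hode.exists_logAsymp_conformalDeriv (by omega) hψ hκ1 hκsq hS0 hdata
  have hd0 : (1 + lam ^ 2) ^ m * |d 0| ≤ a₀ * S := by
    refine (hode.pow_mul_abs_le hm hψ hκsq hdA hrec (hd 0 (by omega)) hS0 hdata₁).trans ?_
    have := mul_le_mul_of_nonneg_left hA (by positivity : (0 : ℝ) ≤ 2 * m * m ^ m)
    rw [ha₀]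
    linarith
  have hone : (1 : ℝ) ≤ 1 + lam ^ 2 := by nlinarith [sq_nonneg lam]
  have hdk : ∀ k < m, |d k| ≤ a₀ * S := by
    intro k hk
    rcases Nat.eq_zero_or_pos k with rfl | hk0
    · exact (le_mul_of_one_le_left (abs_nonneg _) (one_le_pow₀ hone)).trans hd0
    · have h1 := pow_mul_abs_le_of_recursion hm hκsq hdA hrec hk0 hk
      have h2 := le_mul_of_one_le_left (abs_nonneg (d k)) (one_le_pow₀ hone (n := m - k))
      have h3 : (m : ℝ) ^ m * |A| ≤ m ^ m * (324 * S) :=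
        mul_le_mul_of_nonneg_left hA (by positivity)
      have h4 : (0 : ℝ) ≤ (2 * m - 1) * (m ^ m * (324 * S)) :=
        mul_nonneg (by linarith) (by positivity)
      have h5 : 0 ≤ 2 ^ m * 9 * S := by positivity
      rw [ha₀]
      nlinarith
  refine ⟨Function.update ψ 0 (d 0), 2 * A, ∑ k ∈ Finset.range m, L k * d k + B,
    fun v hv => Function.update_of_ne (ne_of_gt hv) _ _, ?_, ?_⟩
  · rw [Function.update_self]
    exact hode.hasAsymptoticDataODE (by omega) hψ hW hP hd hLm (hL ψ hψ)
  · rw [Function.update_self]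
    have hlog : |Real.log κ - Real.log μ| ≤ m := by
      have h1 := Real.log_le_log hμ0 hμκ
      have h2 := Real.log_le_log hκ0 hκμ
      rw [Real.log_mul (by positivity) hμ0.ne'] at h2
      have h3 := Real.log_le_sub_one_of_pos (by linarith : (0 : ℝ) < m)
      rw [abs_of_nonneg (by linarith)]
      linarith
    have hsum : |∑ k ∈ Finset.range m, L k * d k| ≤ (∑ k ∈ Finset.range m, |L k|) * (a₀ * S) := by
      refine (Finset.abs_sum_le_sum_abs _ _).trans ?_
      rw [Finset.sum_mul]
      refine Finset.sum_le_sum fun k hk => ?_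
      rw [abs_mul]
      exact mul_le_mul_of_nonneg_left (hdk k (Finset.mem_range.1 hk)) (abs_nonneg _)
    have hh : |∑ k ∈ Finset.range m, L k * d k + B - 2 * A * Real.log μ| ≤ a₁ * S := by
      have h1 : ∑ k ∈ Finset.range m, L k * d k + B - 2 * A * Real.log μ
          = ∑ k ∈ Finset.range m, L k * d k + (B - 2 * A * Real.log κ)
            + 2 * A * (Real.log κ - Real.log μ) := by ring
      have h2 : |2 * A * (Real.log κ - Real.log μ)| ≤ 2 * (324 * S) * m := by
        rw [abs_mul, abs_mul, abs_of_pos (zero_lt_two' ℝ)]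
        exact mul_le_mul (by linarith) hlog (abs_nonneg _) (by positivity)
      rw [h1]
      refine (abs_add_three _ _ _).trans ?_
      rw [ha₁]
      linarith
    have h1 : (∑ k ∈ Finset.range m, L k * d k + B - 2 * A * Real.log μ) ^ 2 ≤ (a₁ * S) ^ 2 :=
      sq_le_sq' (abs_le.1 hh).1 (abs_le.1 hh).2
    have h2 : (1 + lam ^ 2) ^ (m + m) * d 0 ^ 2 ≤ (a₀ * S) ^ 2 := by
      have h3 := pow_le_pow_left₀ (by positivity) hd0 2
      rw [mul_pow, sq_abs, ← pow_mul, mul_comm m 2, two_mul] at h3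
      exact h3
    rw [mul_pow, hSsq] at h1 h2
    have h3 : 0 ≤ c * Q := by positivity
    linarith
end
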